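/- arXiv:1010.1536 — 2 statements merged into one kernel-verified Lean document; each statement's English description precedes it below -/
import Mathlib

section
/- Let (R, 𝔪, k) be a Cohen-Macaulay Noetherian local ring of Krull dimension d with a canonical module ω_R, and let N be a finitely generated generalized Cohen-Macaulay R-module of dimension d. Set N^∨ := Hom_R(N, ω_R). Then for each r = 2, …, d−1 there is an isomorphism H^{d−r+1}_𝔪(N) ≅ Hom_R(H^r_𝔪(N^∨), E(k)), where E(k) is an injective hull of the residue field k. -/
open CategoryTheory Opposite IsLocalRing

/-- The Ext module `Ext^i_R(M, N)` as an object of `ModuleCat R`. -/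
noncomputable def extMod (R : Type) [CommRing R] (M N : Type) [AddCommGroup M] [Module R M]
    [AddCommGroup N] [Module R N] (i : ℕ) : ModuleCat R :=
  ((Ext R (ModuleCat R) i).obj (op (ModuleCat.of R M))).obj (ModuleCat.of R N)

/-- The Tor module `Tor_i^R(M, N)` as an object of `ModuleCat R`. -/
noncomputable def torMod (R : Type) [CommRing R] (M N : Type) [AddCommGroup M] [Module R M]
    [AddCommGroup N] [Module R N] (i : ℕ) : ModuleCat R :=
  ((Tor (ModuleCat R) i).obj (ModuleCat.of R M)).obj (ModuleCat.of R N)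

/-- The depth of a module over a Noetherian local ring: the least `i` such that
`Ext^i_R(k, M) ≠ 0`, with the convention `depth 0 = ⊤` (as `sInf ∅ = ⊤` in `ℕ∞`). -/
noncomputable def rdepth (R : Type) [CommRing R] [IsLocalRing R] (M : Type) [AddCommGroup M]
    [Module R M] : ℕ∞ :=
  sInf {n : ℕ∞ | ∃ i : ℕ, Nontrivial (extMod R (ResidueField R) M i) ∧ n = i}

/-- The Krull dimension of a module: `dim R⧸Ann M`. -/
noncomputable def mdim (R : Type) [CommRing R] (M : Type) [AddCommGroup M] [Module R M] :
    WithBot ℕ∞ :=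
  ringKrullDim (R ⧸ Module.annihilator R M)

/-- `M` is Cohen-Macaulay of dimension `n`: depth and dimension both equal `n`. -/
def isCMofDim (R : Type) [CommRing R] [IsLocalRing R] (M : Type) [AddCommGroup M] [Module R M]
    (n : ℕ) : Prop :=
  rdepth R M = (n : ℕ∞) ∧ mdim R M = (n : ℕ)

/-- `M` is Cohen-Macaulay: depth equals dimension. -/
def isCM (R : Type) [CommRing R] [IsLocalRing R] (M : Type) [AddCommGroup M] [Module R M] : Prop :=
  (rdepth R M : WithBot ℕ∞) = mdim R M

/-- `R` is a Cohen-Macaulay local ring of dimension `d`. -/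
def isCMLocalRing (R : Type) [CommRing R] [IsLocalRing R] (d : ℕ) : Prop :=
  ringKrullDim R = (d : ℕ) ∧ rdepth R R = (d : ℕ∞)

/-- `M` has Sliding Depth of Extension modules: for `1 ≤ i ≤ d-1`, either `Ext^i(M,R) = 0`
or `depth Ext^i(M,R) ≥ d - i`. -/
def isSDE (R : Type) [CommRing R] [IsLocalRing R] (M : Type) [AddCommGroup M] [Module R M]
    (d : ℕ) : Prop :=
  ∀ i : ℕ, 1 ≤ i → i ≤ d - 1 →
    Subsingleton (extMod R M R i) ∨ ((d - i : ℕ) : ℕ∞) ≤ rdepth R (extMod R M R i)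

/-- `M` has Cohen-Macaulay Extension modules: for `1 ≤ i ≤ d-1`, either `Ext^i(M,R) = 0`
or `Ext^i(M,R)` is Cohen-Macaulay of dimension `d - i`. -/
def isCME (R : Type) [CommRing R] [IsLocalRing R] (M : Type) [AddCommGroup M] [Module R M]
    (d : ℕ) : Prop :=
  ∀ i : ℕ, 1 ≤ i → i ≤ d - 1 →
    Subsingleton (extMod R M R i) ∨ isCMofDim R (extMod R M R i) (d - i)

/-- `M` is sequentially Cohen-Macaulay: it has a filtration with Cohen-Macaulay quotients
of strictly increasing dimensions. -/
def isSeqCM (R : Type) [CommRing R] [IsLocalRing R] (M : Type) [AddCommGroup M] [Module R M] :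
    Prop :=
  ∃ (r : ℕ) (Φ : Fin (r + 1) → Submodule R M), Φ 0 = ⊥ ∧ Φ (Fin.last r) = ⊤ ∧ StrictMono Φ ∧
    (∀ i : Fin r, isCM R (↥(Φ i.succ) ⧸ (Φ i.castSucc).comap (Φ i.succ).subtype)) ∧
    (∀ i j : Fin r, i < j →
      mdim R (↥(Φ i.succ) ⧸ (Φ i.castSucc).comap (Φ i.succ).subtype) <
      mdim R (↥(Φ j.succ) ⧸ (Φ j.castSucc).comap (Φ j.succ).subtype))

/-- `ω` is a canonical module of the `d`-dimensional local ring `R`: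
`Ext^i_R(k, ω) = 0` for `i ≠ d` and `Ext^d_R(k, ω) ≅ k`. -/
def isCanonicalModule (R : Type) [CommRing R] [IsLocalRing R] (d : ℕ) (ω : Type)
    [AddCommGroup ω] [Module R ω] : Prop :=
  Module.Finite R ω ∧ (∀ i : ℕ, i ≠ d → Subsingleton (extMod R (ResidueField R) ω i)) ∧
    Nonempty ((extMod R (ResidueField R) ω d) ≃ₗ[R] ResidueField R)

/-- The local cohomology module `H^i_𝔪(M)` supported at the maximal ideal. -/
noncomputable def lcMod (R : Type) [CommRing R] [IsLocalRing R] (i : ℕ) (M : Type)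
    [AddCommGroup M] [Module R M] : ModuleCat R :=
  (localCohomology (maximalIdeal R) i).obj (ModuleCat.of R M)

/-- The 𝔪-torsion submodule `Γ_𝔪(M) = {x ∈ M | 𝔪^n x = 0 for some n}`. -/
noncomputable def mTorsion (R : Type) [CommRing R] [IsLocalRing R] (M : Type) [AddCommGroup M]
    [Module R M] : Submodule R M :=
  ⨆ n : ℕ, Submodule.torsionBySet R M ((maximalIdeal R ^ n : Ideal R) : Set R)

/-- The natural evaluation (biduality) map `M → Hom_R(Hom_R(M, ω), ω)`. -/
noncomputable def evMap (R : Type) [CommRing R] (M ω : Type) [AddCommGroup M] [Module R M]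
    [AddCommGroup ω] [Module R ω] : M →ₗ[R] ((M →ₗ[R] ω) →ₗ[R] ω) :=
  (LinearMap.id : (M →ₗ[R] ω) →ₗ[R] (M →ₗ[R] ω)).flip

/-- Serre's condition `(S₂)` on the punctured spectrum. -/
def serreS2Punctured (R : Type) [CommRing R] [IsLocalRing R] (M : Type) [AddCommGroup M]
    [Module R M] : Prop :=
  ∀ (𝔭 : Ideal R) [𝔭.IsPrime], 𝔭 ≠ maximalIdeal R →
    min (2 : WithBot ℕ∞) (mdim (Localization.AtPrime 𝔭) (LocalizedModule 𝔭.primeCompl M)) ≤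
      (rdepth (Localization.AtPrime 𝔭) (LocalizedModule 𝔭.primeCompl M) : WithBot ℕ∞)

namespace LocCoh

section ModuleExt

/-- `Ext^i_R(A, M)` for modules, computed in the derived category. -/
def EX (R : Type) [CommRing R] (A M : Type) [AddCommGroup A] [Module R A]
    [AddCommGroup M] [Module R M] (i : ℕ) : Type :=
  Abelian.Ext (ModuleCat.of R A) (ModuleCat.of R M) i

variable {R : Type} [CommRing R]
  {A B C M N P : Type} [AddCommGroup A] [Module R A] [AddCommGroup B] [Module R B]
  [AddCommGroup C] [Module R C]
  [AddCommGroup M] [Module R M] [AddCommGroup N] [Module R N] [AddCommGroup P] [Module R P]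

noncomputable instance (i : ℕ) : AddCommGroup (EX R A M i) :=
  inferInstanceAs (AddCommGroup (Abelian.Ext (ModuleCat.of R A) (ModuleCat.of R M) i))

noncomputable instance (i : ℕ) : Module R (EX R A M i) :=
  inferInstanceAs (Module R (Abelian.Ext (ModuleCat.of R A) (ModuleCat.of R M) i))

variable (M) in
/-- Functoriality of `Ext` in the first variable. -/
noncomputable def EX.pre (a : A →ₗ[R] B) (i : ℕ) : EX R B M i →ₗ[R] EX R A M i :=
  Abelian.Ext.precompOfLinear (Abelian.Ext.mk₀ (ModuleCat.ofHom a)) R (ModuleCat.of R M)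
    (zero_add i)

variable (A) in
/-- Functoriality of `Ext` in the second variable. -/
noncomputable def EX.post (f : M →ₗ[R] N) (i : ℕ) : EX R A M i →ₗ[R] EX R A N i :=
  Abelian.Ext.postcompOfLinear (Abelian.Ext.mk₀ (ModuleCat.ofHom f)) R (ModuleCat.of R A)
    (add_zero i)

theorem EX.pre_apply (a : A →ₗ[R] B) (i : ℕ) (x : EX R B M i) :
    EX.pre M a i x = (Abelian.Ext.mk₀ (ModuleCat.ofHom a)).comp (Z := ModuleCat.of R M) x
      (zero_add i) := rfl

theorem EX.post_apply (f : M →ₗ[R] N) (i : ℕ) (x : EX R A M i) :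
    EX.post A f i x = Abelian.Ext.comp (X := ModuleCat.of R A) x
      (Abelian.Ext.mk₀ (ModuleCat.ofHom f)) (add_zero i) := rfl

@[simp]
theorem EX.pre_id (i : ℕ) (x : EX R A M i) : EX.pre M LinearMap.id i x = x :=
  Abelian.Ext.mk₀_id_comp _

@[simp]
theorem EX.post_id (i : ℕ) (x : EX R A M i) : EX.post A LinearMap.id i x = x :=
  Abelian.Ext.comp_mk₀_id _

theorem EX.pre_comp (a : A →ₗ[R] B) (b : B →ₗ[R] C) (i : ℕ) (x : EX R C M i) :
    EX.pre M (b ∘ₗ a) i x = EX.pre M a i (EX.pre M b i x) := by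
  simp only [EX.pre_apply, ModuleCat.ofHom_comp]
  exact (Abelian.Ext.mk₀_comp_mk₀_assoc _ _ _).symm

theorem EX.post_comp (f : M →ₗ[R] N) (g : N →ₗ[R] P) (i : ℕ) (x : EX R A M i) :
    EX.post A (g ∘ₗ f) i x = EX.post A g i (EX.post A f i x) := by
  simp only [EX.post_apply, ModuleCat.ofHom_comp]
  rw [← Abelian.Ext.mk₀_comp_mk₀]
  exact (Abelian.Ext.comp_assoc_of_third_deg_zero _ _ _ _).symm

theorem EX.pre_post (a : A →ₗ[R] B) (f : M →ₗ[R] N) (i : ℕ) (x : EX R B M i) :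
    EX.pre N a i (EX.post B f i x) = EX.post A f i (EX.pre M a i x) :=
  (Abelian.Ext.comp_assoc_of_third_deg_zero _ _ _ (zero_add i)).symm

theorem EX.pre_add (a b : A →ₗ[R] B) (i : ℕ) : EX.pre M (a + b) i = EX.pre M a i + EX.pre M b i := by
  ext x
  simp only [LinearMap.add_apply, EX.pre_apply, ModuleCat.ofHom_add, Abelian.Ext.mk₀_add]
  exact Abelian.Ext.add_comp _ _ _ _

theorem EX.post_add (f g : M →ₗ[R] N) (i : ℕ) :
    EX.post A (f + g) i = EX.post A f i + EX.post A g i := by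
  ext x
  simp only [LinearMap.add_apply, EX.post_apply, ModuleCat.ofHom_add, Abelian.Ext.mk₀_add]
  exact Abelian.Ext.comp_add _ _ _ _

theorem EX.pre_smul (r : R) (a : A →ₗ[R] B) (i : ℕ) : EX.pre M (r • a) i = r • EX.pre M a i := by
  ext x
  have : ModuleCat.ofHom (r • a) = r • ModuleCat.ofHom a := rfl
  simp only [LinearMap.smul_apply, EX.pre_apply, this, Abelian.Ext.mk₀_smul]
  exact Abelian.Ext.smul_comp _ _ _ _

theorem EX.post_smul (r : R) (f : M →ₗ[R] N) (i : ℕ) :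
    EX.post A (r • f) i = r • EX.post A f i := by
  ext x
  have : ModuleCat.ofHom (r • f) = r • ModuleCat.ofHom f := rfl
  simp only [LinearMap.smul_apply, EX.post_apply, this, Abelian.Ext.mk₀_smul]
  exact Abelian.Ext.comp_smul _ _ _ _

@[simp]
theorem EX.pre_zero (i : ℕ) : EX.pre M (0 : A →ₗ[R] B) i = 0 := by
  simpa using EX.pre_smul (M := M) (0 : R) (0 : A →ₗ[R] B) i

@[simp]
theorem EX.post_zero (i : ℕ) : EX.post A (0 : M →ₗ[R] N) i = 0 := by
  simpa using EX.post_smul (A := A) (0 : R) (0 : M →ₗ[R] N) i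

/-- `Ext^0` is `Hom`. -/
noncomputable def EX.homEquiv : EX R A M 0 ≃ₗ[R] (A →ₗ[R] M) :=
  (Abelian.Ext.linearEquiv₀ (R := R)).trans ModuleCat.homLinearEquiv

theorem EX.homEquiv_pre (a : A →ₗ[R] B) (x : EX R B M 0) :
    EX.homEquiv (EX.pre M a 0 x) = EX.homEquiv x ∘ₗ a := by
  obtain ⟨f, rfl⟩ := EX.homEquiv.symm.surjective x
  apply EX.homEquiv.symm.injective
  rw [LinearEquiv.symm_apply_apply, LinearEquiv.apply_symm_apply]
  exact Abelian.Ext.mk₀_comp_mk₀ _ _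

theorem EX.homEquiv_post (g : M →ₗ[R] N) (x : EX R A M 0) :
    EX.homEquiv (EX.post A g 0 x) = g ∘ₗ EX.homEquiv x := by
  obtain ⟨f, rfl⟩ := EX.homEquiv.symm.surjective x
  apply EX.homEquiv.symm.injective
  rw [LinearEquiv.symm_apply_apply, LinearEquiv.apply_symm_apply]
  exact Abelian.Ext.mk₀_comp_mk₀ _ _

/-- An exact sequence of modules gives a short exact sequence in `ModuleCat`. -/
theorem shortExact {f : M →ₗ[R] N} {g : N →ₗ[R] P} (hf : Function.Injective f)
    (hfg : Function.Exact f g) (hg : Function.Surjective g) :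
    (ModuleCat.shortComplexOfCompEqZero f g hfg.linearMap_comp_eq_zero).ShortExact :=
  ModuleCat.shortComplex_shortExact _ hfg hf hg

section Cov
variable {f : M →ₗ[R] N} {g : N →ₗ[R] P} (hf : Function.Injective f)
    (hfg : Function.Exact f g) (hg : Function.Surjective g)

variable (A) in
/-- The connecting map in the covariant long exact sequence. -/
noncomputable def EX.δ (i : ℕ) : EX R A P i →ₗ[R] EX R A M (i + 1) :=
  Abelian.Ext.postcompOfLinear (shortExact hf hfg hg).extClass R (ModuleCat.of R A) rfl

theorem EX.pre_δ (a : A →ₗ[R] B) (i : ℕ) (x : EX R B P i) :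
    EX.pre M a (i + 1) (EX.δ B hf hfg hg i x) = EX.δ A hf hfg hg i (EX.pre P a i x) :=
  (Abelian.Ext.comp_assoc _ _ _ (zero_add i) rfl (by omega)).symm

include hf hfg hg in
theorem EX.exact₂ (i : ℕ) : Function.Exact (EX.post A f i) (EX.post A g i) := by
  intro x
  constructor
  · intro h
    exact Abelian.Ext.covariant_sequence_exact₂ _ (shortExact hf hfg hg) x h
  · rintro ⟨y, rfl⟩
    rw [← EX.post_comp, hfg.linearMap_comp_eq_zero, EX.post_zero, LinearMap.zero_apply]

theorem EX.exact₃ (i : ℕ) : Function.Exact (EX.post A g i) (EX.δ A hf hfg hg i) := by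
  intro x
  constructor
  · intro h
    exact Abelian.Ext.covariant_sequence_exact₃ _ (shortExact hf hfg hg) x rfl h
  · rintro ⟨y, rfl⟩
    refine (Abelian.Ext.comp_assoc_of_second_deg_zero y _ _ rfl).trans ?_
    erw [(shortExact hf hfg hg).comp_extClass]
    exact Abelian.Ext.comp_zero _ _ _ _ _

theorem EX.exact₁ (i : ℕ) : Function.Exact (EX.δ A hf hfg hg i) (EX.post A f (i + 1)) := by
  intro x
  constructor
  · intro h
    exact Abelian.Ext.covariant_sequence_exact₁ _ (shortExact hf hfg hg) x h rfl
  · rintro ⟨y, rfl⟩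
    refine (Abelian.Ext.comp_assoc_of_third_deg_zero y _ _ rfl).trans ?_
    erw [(shortExact hf hfg hg).extClass_comp]
    exact Abelian.Ext.comp_zero _ _ _ _ _

end Cov

theorem EX.post_injective {f : M →ₗ[R] N} (hf : Function.Injective f) :
    Function.Injective (EX.post A f 0) := by
  intro x y h
  apply EX.homEquiv.injective
  have := congrArg EX.homEquiv h
  simp only [EX.homEquiv_post] at this
  ext a
  exact hf (LinearMap.congr_fun this a)

section Contra
variable {a : A →ₗ[R] B} {b : B →ₗ[R] C} (ha : Function.Injective a)
    (hab : Function.Exact a b) (hb : Function.Surjective b)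

variable (M) in
/-- The connecting map in the contravariant long exact sequence. -/
noncomputable def EX.ε (i : ℕ) : EX R A M i →ₗ[R] EX R C M (i + 1) :=
  Abelian.Ext.precompOfLinear (shortExact ha hab hb).extClass R (ModuleCat.of R M) (add_comm 1 i)

include ha hab hb in
theorem EX.coexact₂ (i : ℕ) : Function.Exact (EX.pre M b i) (EX.pre M a i) := by
  intro x
  constructor
  · intro h
    exact Abelian.Ext.contravariant_sequence_exact₂ (shortExact ha hab hb) _ x h
  · rintro ⟨y, rfl⟩
    rw [← EX.pre_comp, hab.linearMap_comp_eq_zero, EX.pre_zero, LinearMap.zero_apply]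

theorem EX.coexact₁ (i : ℕ) : Function.Exact (EX.pre M a i) (EX.ε M ha hab hb i) := by
  intro x
  constructor
  · intro h
    exact Abelian.Ext.contravariant_sequence_exact₁ (shortExact ha hab hb) _ x
      (add_comm 1 i) h
  · rintro ⟨y, rfl⟩
    refine (Abelian.Ext.comp_assoc _ _ y (add_zero 1) (zero_add i) (by omega)).symm.trans ?_
    erw [(shortExact ha hab hb).extClass_comp]
    exact Abelian.Ext.zero_comp (C := ModuleCat R) _ _ _ _ _

theorem EX.coexact₃ (i : ℕ) : Function.Exact (EX.ε M ha hab hb i) (EX.pre M b (i + 1)) := by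
  intro x
  constructor
  · intro h
    exact Abelian.Ext.contravariant_sequence_exact₃ (shortExact ha hab hb) _ x h
      (add_comm 1 i)
  · rintro ⟨y, rfl⟩
    refine (Abelian.Ext.comp_assoc _ _ y (zero_add 1) (add_comm 1 i) (by omega)).symm.trans ?_
    erw [(shortExact ha hab hb).comp_extClass]
    exact Abelian.Ext.zero_comp (C := ModuleCat R) _ _ _ _ _

end Contra

theorem EX.pre_injective {b : B →ₗ[R] C} (hb : Function.Surjective b) :
    Function.Injective (EX.pre M b 0) := by
  intro x y h
  apply EX.homEquiv.injective
  have := congrArg EX.homEquiv h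
  simp only [EX.homEquiv_pre] at this
  ext a
  obtain ⟨a, rfl⟩ := hb a
  exact LinearMap.congr_fun this a

/-- `Ext` transported along an isomorphism in the first variable. -/
noncomputable def EX.preEquiv (e : A ≃ₗ[R] B) (i : ℕ) : EX R B M i ≃ₗ[R] EX R A M i :=
  LinearEquiv.ofLinearMap (EX.pre M e.toLinearMap i) (EX.pre M e.symm.toLinearMap i)
    (by ext x; simp [← EX.pre_comp]) (by ext x; simp [← EX.pre_comp])

theorem EX.pre_sum {κ : Type} (s : Finset κ) (a : κ → A →ₗ[R] B) (i : ℕ) (x : EX R B M i) :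
    EX.pre M (∑ j ∈ s, a j) i x = ∑ j ∈ s, EX.pre M (a j) i x := by
  classical
  induction s using Finset.induction_on with
  | empty => simp
  | insert j s hj ih => simp [Finset.sum_insert hj, EX.pre_add, ih]

theorem EX.post_sum {κ : Type} (s : Finset κ) (f : κ → M →ₗ[R] N) (i : ℕ) (x : EX R A M i) :
    EX.post A (∑ j ∈ s, f j) i x = ∑ j ∈ s, EX.post A (f j) i x := by
  classical
  induction s using Finset.induction_on with
  | empty => simp
  | insert j s hj ih => simp [Finset.sum_insert hj, EX.post_add, ih]

end ModuleExt

end LocCoh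

namespace LocCoh

section Transition

variable {R : Type} [CommRing R]

/-- The quotient map `R ⧸ I → R ⧸ J` for `I ≤ J`. -/
def qmap {I J : Ideal R} (h : I ≤ J) : (R ⧸ I) →ₗ[R] (R ⧸ J) :=
  Submodule.mapQ I J LinearMap.id h

@[simp]
theorem qmap_mk {I J : Ideal R} (h : I ≤ J) (x : R) :
    qmap h (Ideal.Quotient.mk I x) = Ideal.Quotient.mk J x := rfl

theorem qmap_surjective {I J : Ideal R} (h : I ≤ J) : Function.Surjective (qmap h) := by
  intro x
  obtain ⟨x, rfl⟩ := Ideal.Quotient.mk_surjective x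
  exact ⟨Ideal.Quotient.mk I x, rfl⟩

theorem qmap_comp {I J K : Ideal R} (h : I ≤ J) (h' : J ≤ K) :
    qmap h' ∘ₗ qmap h = qmap (h.trans h') := by
  ext
  rfl

@[simp]
theorem qmap_self {I : Ideal R} (h : I ≤ I) : qmap h = LinearMap.id := by
  ext
  rfl

end Transition

section H

variable {R : Type} [CommRing R] (I : Ideal R)
  {M N P : Type} [AddCommGroup M] [Module R M] [AddCommGroup N] [Module R N]
  [AddCommGroup P] [Module R P]

variable (M) in
/-- The transition maps `Ext^i(R/I^m, M) → Ext^i(R/I^n, M)`. -/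
noncomputable def trans (i : ℕ) (m n : ℕ) (h : m ≤ n) :
    EX R (R ⧸ I ^ m) M i →ₗ[R] EX R (R ⧸ I ^ n) M i :=
  EX.pre M (qmap (Ideal.pow_le_pow_right h)) i

instance (i : ℕ) : DirectedSystem (fun n ↦ EX R (R ⧸ I ^ n) M i) (fun m n h ↦ trans I M i m n h) where
  map_self := fun n x ↦ by simp [trans]
  map_map := fun k j m h h' x ↦ by
    rw [trans, trans, trans, ← EX.pre_comp, qmap_comp]

variable (M) in
/-- Local cohomology as a direct limit of Ext modules. -/
abbrev LC (i : ℕ) : Type :=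
  Module.DirectLimit (fun n ↦ EX R (R ⧸ I ^ n) M i) (trans I M i)

namespace LC

variable (M) in
/-- The canonical map from a stage of the direct limit. -/
noncomputable def of (i n : ℕ) : EX R (R ⧸ I ^ n) M i →ₗ[R] LC I M i :=
  Module.DirectLimit.of R ℕ (fun n ↦ EX R (R ⧸ I ^ n) M i) (trans I M i) n

variable {I}

theorem of_trans {i m n : ℕ} (h : m ≤ n) (x : EX R (R ⧸ I ^ m) M i) :
    of I M i n (EX.pre M (qmap (Ideal.pow_le_pow_right h)) i x) = of I M i m x :=
  Module.DirectLimit.of_f (G := fun n ↦ EX R (R ⧸ I ^ n) M i) (f := trans I M i) (hij := h)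

theorem exists_of {i : ℕ} (x : LC I M i) : ∃ n y, of I M i n y = x :=
  Module.DirectLimit.exists_of x

theorem of_eq_zero {i n : ℕ} {x : EX R (R ⧸ I ^ n) M i} (h : of I M i n x = 0) :
    ∃ m, ∃ hm : n ≤ m, EX.pre M (qmap (Ideal.pow_le_pow_right hm)) i x = 0 :=
  Module.DirectLimit.of.zero_exact (G := fun n ↦ EX R (R ⧸ I ^ n) M i) (f := trans I M i) h

/-- The universal property. -/
noncomputable def lift {i : ℕ} (g : ∀ n, EX R (R ⧸ I ^ n) M i →ₗ[R] P)
    (hg : ∀ m n (h : m ≤ n) x, g n (EX.pre M (qmap (Ideal.pow_le_pow_right h)) i x) = g m x) :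
    LC I M i →ₗ[R] P :=
  Module.DirectLimit.lift R ℕ (fun n ↦ EX R (R ⧸ I ^ n) M i) (trans I M i) g hg

@[simp]
theorem lift_of {i : ℕ} (g : ∀ n, EX R (R ⧸ I ^ n) M i →ₗ[R] P)
    (hg : ∀ m n (h : m ≤ n) x, g n (EX.pre M (qmap (Ideal.pow_le_pow_right h)) i x) = g m x)
    (n : ℕ) (x : EX R (R ⧸ I ^ n) M i) : lift g hg (of I M i n x) = g n x :=
  Module.DirectLimit.lift_of _ _ _


theorem hom_ext {i : ℕ} {f g : LC I M i →ₗ[R] P}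
    (h : ∀ n x, f (of I M i n x) = g (of I M i n x)) : f = g :=
  Module.DirectLimit.hom_ext fun n ↦ LinearMap.ext fun x ↦ h n x

variable (I)

/-- Functoriality of local cohomology. -/
noncomputable def map (f : M →ₗ[R] N) (i : ℕ) : LC I M i →ₗ[R] LC I N i :=
  lift (fun n ↦ of I N i n ∘ₗ EX.post _ f i) fun m n h x ↦ by
    rw [LinearMap.comp_apply, LinearMap.comp_apply, ← EX.pre_post, of_trans h]

variable {I}

@[simp]
theorem map_of (f : M →ₗ[R] N) (i n : ℕ) (x : EX R (R ⧸ I ^ n) M i) :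
    map I f i (of I M i n x) = of I N i n (EX.post _ f i x) :=
  lift_of _ _ _ _

@[simp]
theorem map_id (i : ℕ) : map I (LinearMap.id : M →ₗ[R] M) i = LinearMap.id :=
  hom_ext fun n x ↦ by simp

theorem map_comp (f : M →ₗ[R] N) (g : N →ₗ[R] P) (i : ℕ) :
    map I (g ∘ₗ f) i = map I g i ∘ₗ map I f i :=
  hom_ext fun n x ↦ by simp [EX.post_comp]

theorem map_add (f g : M →ₗ[R] N) (i : ℕ) : map I (f + g) i = map I f i + map I g i :=
  hom_ext fun n x ↦ by simp [EX.post_add]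

theorem map_smul (r : R) (f : M →ₗ[R] N) (i : ℕ) : map I (r • f) i = r • map I f i :=
  hom_ext fun n x ↦ by simp [EX.post_smul]

@[simp]
theorem map_zero (i : ℕ) : map I (0 : M →ₗ[R] N) i = 0 :=
  hom_ext fun n x ↦ by simp

theorem map_sum {κ : Type} (s : Finset κ) (f : κ → M →ₗ[R] N) (i : ℕ) :
    map I (∑ j ∈ s, f j) i = ∑ j ∈ s, map I (f j) i :=
  hom_ext fun n x ↦ by simp [EX.post_sum]

/-- Local cohomology of isomorphic modules. -/
noncomputable def congr (e : M ≃ₗ[R] N) (i : ℕ) : LC I M i ≃ₗ[R] LC I N i :=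
  LinearEquiv.ofLinearMap (map I e.toLinearMap i) (map I e.symm.toLinearMap i)
    (by simp [← map_comp]) (by simp [← map_comp])

section LES

variable {f : M →ₗ[R] N} {g : N →ₗ[R] P} (hf : Function.Injective f)
    (hfg : Function.Exact f g) (hg : Function.Surjective g)

variable (I) in
/-- The connecting map of local cohomology. -/
noncomputable def δ (i : ℕ) : LC I P i →ₗ[R] LC I M (i + 1) :=
  lift (fun n ↦ of I M (i + 1) n ∘ₗ EX.δ _ hf hfg hg i) fun m n h x ↦ by
    rw [LinearMap.comp_apply, LinearMap.comp_apply, ← EX.pre_δ, of_trans h]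

@[simp]
theorem δ_of (i n : ℕ) (x : EX R (R ⧸ I ^ n) P i) :
    δ I hf hfg hg i (of I P i n x) = of I M (i + 1) n (EX.δ _ hf hfg hg i x) :=
  lift_of _ _ _ _

include hf hfg hg in
theorem exact₂ (i : ℕ) : Function.Exact (map I f i) (map I g i) := by
  intro x
  constructor
  · obtain ⟨n, x, rfl⟩ := exists_of x
    intro h
    rw [map_of] at h
    obtain ⟨m, hm, h⟩ := of_eq_zero h
    rw [EX.pre_post] at h
    obtain ⟨y, hy⟩ := (EX.exact₂ hf hfg hg i _).1 h
    exact ⟨of I M i m y, by rw [map_of, hy, of_trans hm]⟩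
  · rintro ⟨y, rfl⟩
    rw [← LinearMap.comp_apply, ← map_comp, hfg.linearMap_comp_eq_zero, map_zero,
      LinearMap.zero_apply]

theorem exact₃ (i : ℕ) : Function.Exact (map I g i) (δ I hf hfg hg i) := by
  intro x
  constructor
  · obtain ⟨n, x, rfl⟩ := exists_of x
    intro h
    rw [δ_of] at h
    obtain ⟨m, hm, h⟩ := of_eq_zero h
    rw [EX.pre_δ] at h
    obtain ⟨y, hy⟩ := (EX.exact₃ hf hfg hg i _).1 h
    exact ⟨of I N i m y, by rw [map_of, hy, of_trans hm]⟩
  · rintro ⟨y, rfl⟩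
    obtain ⟨n, y, rfl⟩ := exists_of y
    rw [map_of, δ_of, (EX.exact₃ hf hfg hg i).apply_apply_eq_zero, _root_.map_zero]

theorem exact₁ (i : ℕ) : Function.Exact (δ I hf hfg hg i) (map I f (i + 1)) := by
  intro x
  constructor
  · obtain ⟨n, x, rfl⟩ := exists_of x
    intro h
    rw [map_of] at h
    obtain ⟨m, hm, h⟩ := of_eq_zero h
    rw [EX.pre_post] at h
    obtain ⟨y, hy⟩ := (EX.exact₁ hf hfg hg i _).1 h
    exact ⟨of I P i m y, by rw [δ_of, hy, of_trans hm]⟩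
  · rintro ⟨y, rfl⟩
    obtain ⟨n, y, rfl⟩ := exists_of y
    rw [δ_of, map_of, (EX.exact₁ hf hfg hg i).apply_apply_eq_zero, _root_.map_zero]

end LES

theorem map_injective {f : M →ₗ[R] N} (hf : Function.Injective f) :
    Function.Injective (map I f 0) := by
  rw [injective_iff_map_eq_zero]
  intro x h
  obtain ⟨n, x, rfl⟩ := exists_of x
  rw [map_of] at h
  obtain ⟨m, hm, h⟩ := of_eq_zero h
  rw [EX.pre_post, ← _root_.map_zero (EX.post (R ⧸ I ^ m) f 0)] at h
  rw [← of_trans hm, EX.post_injective hf h, _root_.map_zero]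

theorem subsingleton_of_forall {i : ℕ} (h : ∀ n, Subsingleton (EX R (R ⧸ I ^ n) M i)) :
    Subsingleton (LC I M i) := by
  refine subsingleton_of_forall_eq 0 fun x ↦ ?_
  obtain ⟨n, x, rfl⟩ := exists_of x
  rw [(h n).elim x 0, _root_.map_zero]

/-- A retract (up to sums) of a module with vanishing local cohomology has vanishing
local cohomology. -/
theorem subsingleton_of_sum {κ : Type} (s : Finset κ) (a : κ → N →ₗ[R] M) (b : κ → M →ₗ[R] N)
    (hab : ∑ j ∈ s, b j ∘ₗ a j = LinearMap.id) {i : ℕ} (h : Subsingleton (LC I M i)) :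
    Subsingleton (LC I N i) := by
  refine subsingleton_of_forall_eq 0 fun x ↦ ?_
  have : map I (∑ j ∈ s, b j ∘ₗ a j) i x = x := by rw [hab, map_id, LinearMap.id_apply]
  rw [← this, map_sum, LinearMap.sum_apply]
  refine Finset.sum_eq_zero fun j _ ↦ ?_
  rw [map_comp, LinearMap.comp_apply, h.elim (map I (a j) i x) 0, _root_.map_zero]

end LC

end H

end LocCoh

namespace LocCoh

section Cls
variable {R : Type} [CommRing R] (L : ChainComplex (ModuleCat.{0} R)ᵒᵖ ℕ) (n : ℕ)

/-- The cocycles of a complex in the opposite category of modules. -/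
abbrev opZ : Submodule R (L.X n).unop := LinearMap.ker (L.d (n + 1) n).unop.hom

lemma d_opZ : L.d (n + 1) n ≫ (ModuleCat.ofHom (opZ L n).subtype).op = 0 := by
  apply Quiver.Hom.unop_inj
  ext x
  exact x.2

/-- The class of a cocycle. -/
noncomputable def opCls : opZ L n →ₗ[R] (L.homology n).unop :=
  (L.homologyι n ≫ L.descOpcycles (ModuleCat.ofHom (opZ L n).subtype).op (n + 1)
    (by simp) (d_opZ L n)).unop.hom

lemma opCls_surjective : Function.Surjective (opCls L n) := by
  rw [opCls, ← ModuleCat.epi_iff_surjective, unop_comp]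
  have : Epi (L.homologyι n).unop := inferInstance
  have h2 : Epi (L.descOpcycles (ModuleCat.ofHom (opZ L n).subtype).op (n + 1)
    (by simp) (d_opZ L n)).unop := by
    rw [ModuleCat.epi_iff_surjective]
    intro y
    have hinj : Function.Injective (L.pOpcycles n).unop.hom := by
      rw [← ModuleCat.mono_iff_injective]; infer_instance
    have hz : (L.pOpcycles n).unop.hom y ∈ opZ L n := by
      have := congrArg (fun f => f.unop.hom y) (L.d_pOpcycles (n+1) n)
      exact this
    refine ⟨⟨_, hz⟩, hinj ?_⟩
    have := congrArg (fun f => f.unop.hom (⟨_, hz⟩ : opZ L n)) (L.p_descOpcycles (ModuleCat.ofHom (opZ L n).subtype).op (n + 1)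
    (by simp) (d_opZ L n))
    exact this
  exact epi_comp _ _

lemma pOpcycles_descOpcycles_opZ (z : opZ L n) :
    (L.pOpcycles n).unop.hom ((L.descOpcycles (ModuleCat.ofHom (opZ L n).subtype).op (n + 1)
      (by simp) (d_opZ L n)).unop.hom z) = z.1 :=
  congrArg (fun f => f.unop.hom z) (L.p_descOpcycles (ModuleCat.ofHom (opZ L n).subtype).op (n + 1)
    (by simp) (d_opZ L n))

variable {L} in
lemma pOpcycles_unop_injective : Function.Injective (L.pOpcycles n).unop.hom := by
  rw [← ModuleCat.mono_iff_injective]; infer_instance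

lemma opCls_map {L L' : ChainComplex (ModuleCat.{0} R)ᵒᵖ ℕ} (φ : L ⟶ L') (n : ℕ)
    (z : opZ L' n) (h : (φ.f n).unop.hom z.1 ∈ opZ L n) :
    (HomologicalComplex.homologyMap φ n).unop.hom (opCls L' n z) =
      opCls L n ⟨_, h⟩ := by
  have h1 := congrArg (fun f => f.unop.hom ((L'.descOpcycles (ModuleCat.ofHom (opZ L' n).subtype).op
    (n + 1) (by simp) (d_opZ L' n)).unop.hom z)) (HomologicalComplex.homologyι_naturality φ n)
  refine h1.trans ?_
  refine congrArg (L.homologyι n).unop.hom ?_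
  apply pOpcycles_unop_injective
  refine Eq.trans ?_ (pOpcycles_descOpcycles_opZ L n ⟨_, h⟩).symm
  refine (congrArg (fun f => f.unop.hom ((L'.descOpcycles
    (ModuleCat.ofHom (opZ L' n).subtype).op
    (n + 1) (by simp) (d_opZ L' n)).unop.hom z)) (HomologicalComplex.p_opcyclesMap φ n)).trans ?_
  exact congrArg (φ.f n).unop.hom (pOpcycles_descOpcycles_opZ L' n z)

lemma opCls_eq_zero (m : ℕ) (z : opZ L (m + 1)) (hz : opCls L (m + 1) z = 0) :
    ∃ y, (L.d (m + 1) m).unop.hom y = z.1 := by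
  have hex := (ShortComplex.exact_of_f_is_kernel (ShortComplex.mk _ _
    (L.homologyι_comp_fromOpcycles (m + 1) m))
    (L.homologyIsKernel (m + 1) m (by simp))).unop
  rw [ShortComplex.moduleCat_exact_iff] at hex
  obtain ⟨y, hy⟩ := hex _ hz
  refine ⟨y, ?_⟩
  rw [← pOpcycles_descOpcycles_opZ]
  refine Eq.trans ?_ (congrArg (L.pOpcycles (m + 1)).unop.hom hy)
  exact congrArg (fun f => f.unop.hom y) (L.p_fromOpcycles (m + 1) m).symm

lemma opCls_d_eq_zero (m : ℕ) (z : opZ L (m + 1)) (y)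
    (h : (L.d (m + 1) m).unop.hom y = z.1) :
    opCls L (m + 1) z = 0 := by
  have h1 : (L.descOpcycles (ModuleCat.ofHom (opZ L (m + 1)).subtype).op (m + 1 + 1)
      (by simp) (d_opZ L (m + 1))).unop.hom z = (L.fromOpcycles (m + 1) m).unop.hom y := by
    apply pOpcycles_unop_injective
    rw [pOpcycles_descOpcycles_opZ, ← h]
    exact congrArg (fun f => f.unop.hom y) (L.p_fromOpcycles (m + 1) m).symm
  refine (congrArg (L.homologyι (m + 1)).unop.hom h1).trans ?_
  exact congrArg (fun f => f.unop.hom y) (L.homologyι_comp_fromOpcycles (m + 1) m)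

lemma opCls_zero_injective : Function.Injective (opCls L 0) := by
  intro z w h
  have hh : Function.Injective (L.homologyι 0).unop.hom := by
    rw [← ModuleCat.mono_iff_injective]; infer_instance
  have h1 := congrArg (L.pOpcycles 0).unop.hom (hh h)
  exact Subtype.ext ((pOpcycles_descOpcycles_opZ L 0 z).symm.trans
    (h1.trans (pOpcycles_descOpcycles_opZ L 0 w)))

end Cls
end LocCoh

namespace LocCoh

section Bridge
variable {R : Type} [CommRing R]

/-- The complex computing `Ext` out of the chosen projective resolution of `X`. -/
noncomputable abbrev homCpx (X Y : ModuleCat.{0} R) : ChainComplex (ModuleCat.{0} R)ᵒᵖ ℕ :=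
  (((linearYoneda R (ModuleCat.{0} R)).obj Y).rightOp.mapHomologicalComplex _).obj
    (projectiveResolution X).complex

variable (X Y : ModuleCat.{0} R) (n : ℕ)

lemma homCpx_mem (z : (projectiveResolution X).complex.X n ⟶ Y) :
    (z ∈ opZ (homCpx X Y) n) ↔ (projectiveResolution X).complex.d (n + 1) n ≫ z = 0 := Iff.rfl

/-- The comparison isomorphism with the derived functor `Ext`. -/
noncomputable def isoLDO : ((homCpx X Y).homology n).unop →ₗ[R]
    ((Ext R (ModuleCat.{0} R) n).obj (op X)).obj Y :=
  ((projectiveResolution X).isoLeftDerivedObj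
    ((linearYoneda R (ModuleCat.{0} R)).obj Y).rightOp n).hom.unop.hom

/-- The class in the derived functor `Ext` of a cocycle. -/
noncomputable def oldCls : opZ (homCpx X Y) n →ₗ[R]
    ((Ext R (ModuleCat.{0} R) n).obj (op X)).obj Y :=
  isoLDO X Y n ∘ₗ opCls (homCpx X Y) n

lemma isoLDO_bijective : Function.Bijective (isoLDO X Y n) :=
  (ConcreteCategory.isIso_iff_bijective _).1
    (inferInstanceAs (IsIso ((projectiveResolution X).isoLeftDerivedObj
    ((linearYoneda R (ModuleCat.{0} R)).obj Y).rightOp n).hom.unop))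

lemma oldCls_surjective : Function.Surjective (oldCls X Y n) :=
  (isoLDO_bijective X Y n).2.comp (opCls_surjective _ _)

lemma oldCls_zero_injective : Function.Injective (oldCls X Y 0) :=
  (isoLDO_bijective X Y 0).1.comp (opCls_zero_injective _)

lemma oldCls_eq_zero_iff (z : opZ (homCpx X Y) (n + 1)) : oldCls X Y (n + 1) z = 0 ↔
    ∃ y, (projectiveResolution X).complex.d (n + 1) n ≫ y =
      (z.1 : (projectiveResolution X).complex.X (n + 1) ⟶ Y) := by
  constructor
  · intro h
    exact opCls_eq_zero (homCpx X Y) n z ((isoLDO_bijective X Y (n + 1)).1 (h.trans (isoLDO X Y (n + 1)).map_zero.symm))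
  · rintro ⟨y, hy⟩
    refine (congrArg _ (opCls_d_eq_zero (homCpx X Y) n z y hy)).trans (isoLDO X Y (n + 1)).map_zero

lemma smul_extMk {X Y : ModuleCat.{0} R} (P : ProjectiveResolution X) {n : ℕ} (f : P.complex.X n ⟶ Y)
    (m : ℕ) (hm : n + 1 = m) (hf : P.complex.d m n ≫ f = 0) (r : R) :
    r • P.extMk f m hm hf = P.extMk (r • f) m hm (by simp [hf]) := by
  rw [Abelian.Ext.smul_eq_comp_mk₀, ProjectiveResolution.extMk_comp_mk₀]
  congr 1

/-- The class in `Abelian.Ext` of a cocycle. -/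
noncomputable def newCls : opZ (homCpx X Y) n →ₗ[R] Abelian.Ext X Y n where
  toFun z := (projectiveResolution X).extMk (Y := Y) z.1 (n + 1) rfl z.2
  map_add' _ _ := ((projectiveResolution X).add_extMk (Y := Y) _ _ _ _ _ _).symm
  map_smul' r x := (smul_extMk (Y := Y) (projectiveResolution X) _ _ rfl x.2 r).symm

lemma newCls_surjective : Function.Surjective (newCls X Y n) := by
  intro α
  obtain ⟨f, hf, rfl⟩ := (projectiveResolution X).extMk_surjective α (n + 1) rfl
  exact ⟨⟨f, hf⟩, rfl⟩

lemma newCls_eq_zero_iff (z : opZ (homCpx X Y) (n + 1)) : newCls X Y (n + 1) z = 0 ↔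
    ∃ y, (projectiveResolution X).complex.d (n + 1) n ≫ y =
      (z.1 : (projectiveResolution X).complex.X (n + 1) ⟶ Y) :=
  (projectiveResolution X).extMk_eq_zero_iff (Y := Y) z.1 _ rfl z.2 n rfl

/-- The comparison between the two versions of `Ext` in positive degrees. -/
noncomputable def oldNew : Abelian.Ext X Y (n + 1) ≃ₗ[R]
    ((Ext R (ModuleCat.{0} R) (n + 1)).obj (op X)).obj Y :=
  ((newCls X Y (n + 1)).quotKerEquivOfSurjective (newCls_surjective X Y _)).symm ≪≫ₗ
    Submodule.quotEquivOfEq _ _ (by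
      ext z; rw [LinearMap.mem_ker, LinearMap.mem_ker, newCls_eq_zero_iff, oldCls_eq_zero_iff]) ≪≫ₗ
    (oldCls X Y (n + 1)).quotKerEquivOfSurjective (oldCls_surjective X Y _)

lemma oldNew_newCls (z) : oldNew X Y n (newCls X Y (n + 1) z) = oldCls X Y (n + 1) z := by
  have : ((newCls X Y (n + 1)).quotKerEquivOfSurjective (newCls_surjective X Y _)).symm
      (newCls X Y (n + 1) z) = Submodule.Quotient.mk z := by
    rw [LinearEquiv.symm_apply_eq]; rfl
  rw [oldNew, LinearEquiv.trans_apply, LinearEquiv.trans_apply, this]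
  rfl

lemma subsingleton_old_zero (h : Subsingleton (((Ext R (ModuleCat.{0} R) 0).obj (op X)).obj Y)) :
    Subsingleton (Abelian.Ext X Y 0) := by
  have : Subsingleton (opZ (homCpx X Y) 0) := (oldCls_zero_injective X Y).subsingleton
  exact (newCls_surjective X Y 0).subsingleton

lemma subsingleton_of_old (i : ℕ) (h : Subsingleton (((Ext R (ModuleCat.{0} R) i).obj (op X)).obj Y)) :
    Subsingleton (Abelian.Ext X Y i) := by
  cases i with
  | zero => exact subsingleton_old_zero X Y h
  | succ n => exact (oldNew X Y n).toEquiv.subsingleton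

lemma isoLDO_naturality {X X' : ModuleCat.{0} R} (g : X ⟶ X') (Y) (n : ℕ)
    (φ : (projectiveResolution X).complex ⟶ (projectiveResolution X').complex)
    (h : φ.f 0 ≫ (projectiveResolution X').π.f 0 = (projectiveResolution X).π.f 0 ≫ g) (w) :
    (((Ext R (ModuleCat.{0} R) n).map g.op).app Y).hom (isoLDO X' Y n w) =
    isoLDO X Y n
      ((HomologicalComplex.homologyMap (((linearYoneda R (ModuleCat.{0} R)).obj
        Y).rightOp.mapHomologicalComplex _ |>.map φ) n).unop.hom w) := by
  exact congrArg (fun f => f.unop.hom w) (ProjectiveResolution.isoLeftDerivedObj_hom_naturality g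
    (projectiveResolution X) (projectiveResolution X') φ h
    ((linearYoneda R (ModuleCat.{0} R)).obj Y).rightOp n)

lemma oldNew_naturality {X X' : ModuleCat.{0} R} (g : X ⟶ X') (Y) (n : ℕ) (x) :
    (((Ext R (ModuleCat.{0} R) (n + 1)).map g.op).app Y).hom (oldNew X' Y n x) =
      oldNew X Y n ((Abelian.Ext.mk₀ g).comp x (zero_add _)) := by
  obtain ⟨z, rfl⟩ := newCls_surjective X' Y _ x
  let φ : ProjectiveResolution.Hom (projectiveResolution X) (projectiveResolution X') g :=
    { hom := ProjectiveResolution.lift g _ _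
      hom_f_zero_comp_π_f_zero := by
        have := ProjectiveResolution.lift_commutes g (projectiveResolution X) (projectiveResolution X')
        exact congrArg (fun f => HomologicalComplex.Hom.f f 0) this }
  have hz : φ.hom.f (n + 1) ≫ (z.1 : (projectiveResolution X').complex.X (n + 1) ⟶ Y) ∈
      opZ (homCpx X Y) (n + 1) := by
    rw [homCpx_mem]
    refine (φ.hom.comm_assoc _ _ _).symm.trans ?_
    have : (projectiveResolution X').complex.d (n + 1 + 1) (n + 1) ≫
      (z.1 : (projectiveResolution X').complex.X (n + 1) ⟶ Y) = 0 := z.2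
    rw [this, Limits.comp_zero]
  have h1 : (Abelian.Ext.mk₀ g).comp (newCls X' Y (n + 1) z) (zero_add _) =
      newCls X Y (n + 1) ⟨_, hz⟩ :=
    ProjectiveResolution.mk₀_comp_extMk (Y := Y) z.1 _ rfl z.2 φ
  rw [h1, oldNew_newCls, oldNew_newCls]
  refine (isoLDO_naturality g Y (n + 1) φ.hom (by simpa using φ.hom_f_zero_comp_π_f_zero) _).trans ?_
  refine congrArg (isoLDO X Y (n + 1)) ?_
  exact opCls_map ((((linearYoneda R (ModuleCat.{0} R)).obj Y).rightOp.mapHomologicalComplex _).map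
      φ.hom) (n + 1) z hz

end Bridge
end LocCoh

namespace LocCoh
section LCB
variable {R : Type} [CommRing R]

/-- Comparison between `extMod` and `EX` in positive degrees. -/
noncomputable def EX.extModEquiv (A M : Type) [AddCommGroup A] [Module R A] [AddCommGroup M]
    [Module R M] (i : ℕ) : EX R A M (i + 1) ≃ₗ[R] extMod R A M (i + 1) :=
  oldNew (ModuleCat.of R A) (ModuleCat.of R M) i

lemma EX.extModEquiv_naturality {A B : Type} [AddCommGroup A] [Module R A] [AddCommGroup B]
    [Module R B] (a : A →ₗ[R] B) (M : Type) [AddCommGroup M] [Module R M] (i : ℕ)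
    (x : EX R B M (i + 1)) :
    (((Ext R (ModuleCat.{0} R) (i + 1)).map (ModuleCat.ofHom a).op).app (ModuleCat.of R M)).hom
      (EX.extModEquiv B M i x) = EX.extModEquiv A M i (EX.pre M a (i + 1) x) :=
  oldNew_naturality (ModuleCat.ofHom a) (ModuleCat.of R M) i x

lemma EX.subsingleton_of_extMod (A M : Type) [AddCommGroup A] [Module R A] [AddCommGroup M]
    [Module R M] (i : ℕ) (h : Subsingleton (extMod R A M i)) : Subsingleton (EX R A M i) :=
  subsingleton_of_old _ _ i h

variable (I : Ideal R) (N : Type) [AddCommGroup N] [Module R N] (i : ℕ)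

/-- The diagram whose colimit defines local cohomology. -/
noncomputable abbrev lcD : (ℕᵒᵖ)ᵒᵖ ⥤ ModuleCat.{0} R ⥤ ModuleCat.{0} R :=
  localCohomology.diagram (localCohomology.idealPowersDiagram I) (i + 1)

/-- The colimit cocone defining local cohomology. -/
noncomputable abbrev lcCocone : Limits.Cocone (lcD I i ⋙ (evaluation _ _).obj (ModuleCat.of R N)) :=
  ((evaluation _ _).obj (ModuleCat.of R N)).mapCocone (Limits.colimit.cocone (lcD I i))

/-- The cocone defining local cohomology is colimiting. -/
noncomputable def lcIsColimit : Limits.IsColimit (lcCocone I N i) :=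
  Limits.isColimitOfPreserves _ (Limits.colimit.isColimit (lcD I i))

/-- The comparison at a level of the diagram. -/
noncomputable def lcLevel (n : ℕ) : EX R (R ⧸ I ^ n) N (i + 1) ≃ₗ[R]
    (lcD I i ⋙ (evaluation _ _).obj (ModuleCat.of R N)).obj (op (op n)) :=
  EX.extModEquiv (R ⧸ I ^ n) N i

lemma ringModIdeals_map {m n : ℕᵒᵖ} (h : m ⟶ n) :
    (localCohomology.ringModIdeals (localCohomology.idealPowersDiagram I)).map h =
      ModuleCat.ofHom (qmap (Ideal.pow_le_pow_right h.unop.down.down)) := rfl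

lemma lcD_map {m n : (ℕᵒᵖ)ᵒᵖ} (h : m ⟶ n) :
    (lcD I i).map h = (Ext R (ModuleCat.{0} R) (i + 1)).map (ModuleCat.ofHom
      (qmap (Ideal.pow_le_pow_right h.unop.unop.down.down : I ^ n.unop.unop ≤ I ^ m.unop.unop))).op :=
  congrArg (fun f ↦ (Ext R (ModuleCat.{0} R) (i + 1)).map (Quiver.Hom.op f))
    (ringModIdeals_map I h.unop)

variable {i} in
lemma lcLevel_naturality {m n : (ℕᵒᵖ)ᵒᵖ} (h : m ⟶ n) (x : EX R (R ⧸ I ^ m.unop.unop) N (i + 1)) :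
   ((lcD I i ⋙ (evaluation _ _).obj (ModuleCat.of R N)).map h).hom
    (lcLevel I N i m.unop.unop x) =
    lcLevel I N i n.unop.unop (EX.pre N (qmap (Ideal.pow_le_pow_right h.unop.unop.down.down)) (i + 1) x) :=
  (congrArg (fun f ↦ (f.app (ModuleCat.of R N)).hom (lcLevel I N i m.unop.unop x))
    (lcD_map I i h)).trans
    (EX.extModEquiv_naturality (qmap (Ideal.pow_le_pow_right h.unop.unop.down.down)) N i x)

/-- The comparison map from the concrete local cohomology. -/
noncomputable def lcTo : LC I N (i + 1) →ₗ[R] (lcCocone I N i).pt :=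
  LC.lift (fun n ↦ ((lcCocone I N i).ι.app (op (op n))).hom ∘ₗ (lcLevel I N i n).toLinearMap)
    fun m n h x ↦ by
      have h1 := congrArg (fun f ↦ f.hom (lcLevel I N i m x))
        ((lcCocone I N i).w (homOfLE h).op.op)
      have h2 := lcLevel_naturality I N (homOfLE h).op.op x
      refine Eq.trans ?_ h1
      exact congrArg ((lcCocone I N i).ι.app (op (op n))).hom h2.symm

/-- The concrete local cohomology as a cocone. -/
noncomputable def lcCocone' : Limits.Cocone (lcD I i ⋙ (evaluation _ _).obj (ModuleCat.of R N)) where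
  pt := ModuleCat.of R (LC I N (i + 1))
  ι :=
    { app := fun n ↦ ModuleCat.ofHom (LC.of I N (i + 1) n.unop.unop ∘ₗ
        (lcLevel I N i n.unop.unop).symm.toLinearMap)
      naturality := fun m n h ↦ by
        ext y
        obtain ⟨x, rfl⟩ := (lcLevel I N i m.unop.unop).surjective y
        have h2 := lcLevel_naturality I N h x
        have h3 : (lcLevel I N i n.unop.unop).symm (((lcD I i ⋙ (evaluation _ _).obj
            (ModuleCat.of R N)).map h).hom (lcLevel I N i m.unop.unop x)) = _ :=
          (congrArg _ h2).trans (LinearEquiv.symm_apply_apply _ _)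
        refine (congrArg (LC.of I N (i + 1) n.unop.unop) h3).trans ?_
        refine (LC.of_trans (I := I) (M := N) h.unop.unop.down.down x).trans ?_
        exact congrArg (LC.of I N (i + 1) m.unop.unop)
          (LinearEquiv.symm_apply_apply (lcLevel I N i m.unop.unop) x).symm }

/-- The comparison map to the concrete local cohomology. -/
noncomputable def lcFrom : (lcCocone I N i).pt →ₗ[R] LC I N (i + 1) :=
  ((lcIsColimit I N i).desc (lcCocone' I N i)).hom

lemma lcFrom_ι (n : (ℕᵒᵖ)ᵒᵖ) (y) : lcFrom I N i (((lcCocone I N i).ι.app n).hom y) =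
    LC.of I N (i + 1) n.unop.unop ((lcLevel I N i n.unop.unop).symm y) :=
  congrArg (fun f ↦ f.hom y) ((lcIsColimit I N i).fac (lcCocone' I N i) n)

lemma lcFrom_lcTo (x) : lcFrom I N i (lcTo I N i x) = x := by
  obtain ⟨n, x, rfl⟩ := LC.exists_of x
  rw [lcTo, LC.lift_of]
  refine (lcFrom_ι I N i (op (op n)) (lcLevel I N i n x)).trans ?_
  exact congrArg (LC.of I N (i + 1) n)
              (LinearEquiv.symm_apply_apply (lcLevel I N i n) x)

lemma lcTo_lcFrom : ModuleCat.ofHom (lcTo I N i ∘ₗ lcFrom I N i) = 𝟙 (lcCocone I N i).pt := by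
  apply (lcIsColimit I N i).hom_ext
  intro n
  ext y
  refine (congrArg (lcTo I N i) (lcFrom_ι I N i n y)).trans ?_
  refine (LC.lift_of _ _ _ _).trans ?_
  exact congrArg ((lcCocone I N i).ι.app n).hom
    (LinearEquiv.apply_symm_apply (lcLevel I N i n.unop.unop) y)

/-- Mathlib's local cohomology agrees with the concrete one in positive degrees. -/
noncomputable def lcEquiv : LC I N (i + 1) ≃ₗ[R] (localCohomology I (i + 1)).obj (ModuleCat.of R N) :=
  LinearEquiv.ofLinearMap (lcTo I N i) (lcFrom I N i)
    (LinearMap.ext fun y ↦ congrArg (fun f ↦ f.hom y) (lcTo_lcFrom I N i))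
    (LinearMap.ext (lcFrom_lcTo I N i))
end LCB
end LocCoh

namespace LocCoh

theorem EX.subsingleton_of_exact {R : Type} [CommRing R] {A B C M : Type} [AddCommGroup A]
    [Module R A] [AddCommGroup B]
    [Module R B] [AddCommGroup C] [Module R C] [AddCommGroup M] [Module R M]
    {a : A →ₗ[R] B} {b : B →ₗ[R] C} (ha : Function.Injective a) (hab : Function.Exact a b)
    (hb : Function.Surjective b) (i : ℕ) [Subsingleton (EX R A M i)] [Subsingleton (EX R C M i)] :
    Subsingleton (EX R B M i) := by
  refine ⟨fun x y ↦ ?_⟩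
  have h : ∀ z : EX R B M i, z = 0 := fun z ↦ by
    obtain ⟨w, rfl⟩ := (EX.coexact₂ (M := M) ha hab hb i z).1 (Subsingleton.elim _ _)
    rw [Subsingleton.elim w 0, map_zero]
  rw [h x, h y]

variable {R : Type} [CommRing R] [IsLocalRing R]

variable (R) in
theorem nonempty_equiv_residueField (L : Type) [AddCommGroup L] [Module R L]
    [IsSimpleModule R L] : Nonempty (L ≃ₗ[R] ResidueField R) := by
  obtain ⟨I, hI, ⟨e⟩⟩ := isSimpleModule_iff_quot_maximal.1 ‹IsSimpleModule R L›
  obtain rfl := IsLocalRing.eq_maximalIdeal hI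
  exact ⟨e⟩

instance : IsSimpleModule R (ResidueField R) :=
  isSimpleModule_iff_quot_maximal.2 ⟨maximalIdeal R, inferInstance, ⟨LinearEquiv.refl _ _⟩⟩

theorem EX.subsingleton_of_isFiniteLength {M : Type} [AddCommGroup M] [Module R M] {i : ℕ}
    (h : Subsingleton (EX R (ResidueField R) M i)) {L : Type} [AddCommGroup L] [Module R L]
    (hL : IsFiniteLength R L) : Subsingleton (EX R L M i) := by
  induction hL with
  | @of_subsingleton L _ _ _ =>
    refine ⟨fun x y ↦ ?_⟩
    rw [← EX.pre_id i x, ← EX.pre_id i y, Subsingleton.elim LinearMap.id (0 : L →ₗ[R] L),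
      EX.pre_zero]
    rfl
  | @of_simple_quotient L _ _ S _ _ ih =>
    obtain ⟨e⟩ := nonempty_equiv_residueField R (L ⧸ S)
    have : Subsingleton (EX R (L ⧸ S) M i) := (EX.preEquiv e i).toEquiv.symm.subsingleton
    exact EX.subsingleton_of_exact S.injective_subtype (LinearMap.exact_subtype_mkQ S)
      S.mkQ_surjective i

/-- The numerical conditions defining a canonical module. -/
def IsCan (R : Type) [CommRing R] [IsLocalRing R] (ω : Type) [AddCommGroup ω] [Module R ω]
    (d : ℕ) : Prop :=
  (∀ i, i ≠ d → Subsingleton (EX R (ResidueField R) ω i)) ∧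
    Nonempty (EX R (ResidueField R) ω d ≃ₗ[R] ResidueField R)

namespace IsCan
variable {ω : Type} [AddCommGroup ω] [Module R ω] {d : ℕ}

theorem subsingleton (h : IsCan R ω d) {L : Type} [AddCommGroup L] [Module R L]
    (hL : IsFiniteLength R L) {i : ℕ} (hi : i ≠ d) : Subsingleton (EX R L ω i) :=
  EX.subsingleton_of_isFiniteLength (h.1 i hi) hL

section
variable {A B C : Type} [AddCommGroup A] [Module R A] [AddCommGroup B]
  [Module R B] [AddCommGroup C] [Module R C]

theorem pre_surjective (h : IsCan R ω d) (hB : IsFiniteLength R B) {a : A →ₗ[R] B}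
    (ha : Function.Injective a) : Function.Surjective (EX.pre ω a d) := by
  intro x
  have hex : Function.Exact a (LinearMap.range a).mkQ := LinearMap.exact_map_mkQ_range a
  have hs := (LinearMap.range a).mkQ_surjective
  have := h.subsingleton (hB.of_surjective hs) (i := d + 1) (by omega)
  exact (EX.coexact₁ (M := ω) ha hex hs d x).1 (Subsingleton.elim _ _)

theorem pre_injective (h : IsCan R ω (d + 1)) (hB : IsFiniteLength R B) {b : B →ₗ[R] C}
    (hb : Function.Surjective b) : Function.Injective (EX.pre ω b (d + 1)) := by
  rw [injective_iff_map_eq_zero]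
  intro x hx
  have hex : Function.Exact (LinearMap.ker b).subtype b := LinearMap.exact_subtype_ker_map b
  have hs := (LinearMap.ker b).injective_subtype
  have := h.subsingleton (hB.of_injective hs) (i := d) (by omega)
  obtain ⟨w, rfl⟩ := (EX.coexact₃ (M := ω) hs hex hb d x).1 hx
  rw [Subsingleton.elim w 0, map_zero]
end

theorem length_eq (h : IsCan R ω (d + 1)) {L : Type} [AddCommGroup L] [Module R L]
    (hL : IsFiniteLength R L) : Module.length R (EX R L ω (d + 1)) = Module.length R L := by
  induction hL with
  | @of_subsingleton L _ _ _ =>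
    have : Subsingleton (EX R L ω (d + 1)) := by
      refine ⟨fun x y ↦ ?_⟩
      rw [← EX.pre_id _ x, ← EX.pre_id _ y, Subsingleton.elim LinearMap.id (0 : L →ₗ[R] L),
        EX.pre_zero]
      rfl
    rw [Module.length_eq_zero_iff.2 this, Module.length_eq_zero_iff.2 inferInstance]
  | @of_simple_quotient L _ _ S _ hS ih =>
    obtain ⟨e⟩ := nonempty_equiv_residueField R (L ⧸ S)
    have hL : IsFiniteLength R L := .of_simple_quotient hS
    have h1 := S.injective_subtype
    have h2 := LinearMap.exact_subtype_mkQ S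
    have h3 := S.mkQ_surjective
    obtain ⟨e'⟩ := h.2
    rw [Module.length_eq_add_of_exact _ _ h1 h3 h2, Module.length_eq_add_of_exact _ _
      (h.pre_injective hL h3) (h.pre_surjective hL h1) (EX.coexact₂ h1 h2 h3 (d + 1)), ih,
      ((EX.preEquiv e.symm (d + 1)).trans (e'.trans e.symm)).length_eq, add_comm]

end IsCan

section Dual
variable {E : Type} [AddCommGroup E] [Module R E] (hE : Module.Injective R E)
  (ι : ResidueField R →ₗ[R] E) (hι : Function.Injective ι)
  (hess : ∀ P : Submodule R E, P ≠ ⊥ → LinearMap.range ι ⊓ P ≠ ⊥)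

include hι hess in
theorem length_hom_residueField : Module.length R (ResidueField R →ₗ[R] E) = 1 := by
  let φ : ResidueField R →ₗ[R] (ResidueField R →ₗ[R] E) :=
    (LinearMap.compRight R ι) ∘ₗ LinearMap.mul R (ResidueField R)
  have hφ : ∀ c x, φ c x = ι (c * x) := fun _ _ ↦ rfl
  have h1 : Function.Injective φ := by
    intro a b hab
    have := congrArg (fun f ↦ f 1) hab
    simpa [hφ, hι.eq_iff] using this
  have h2 : Function.Surjective φ := by
    intro g
    by_cases hg : g = 0
    · exact ⟨0, by simp [hg]⟩
    obtain ⟨y, hy, hy0⟩ := Submodule.exists_mem_ne_zero_of_ne_bot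
      (hess (LinearMap.range g) (by rwa [ne_eq, LinearMap.range_eq_bot]))
    obtain ⟨⟨c, rfl⟩, ⟨b, hb⟩⟩ := hy
    have hb0 : b ≠ 0 := by rintro rfl; exact hy0 (by rw [← hb, map_zero])
    refine ⟨c / b, LinearMap.ext fun x ↦ ?_⟩
    obtain ⟨r, hr⟩ := IsLocalRing.residue_surjective (x / b)
    have hx : x = r • b := by
      rw [Algebra.smul_def]
      change x = residue R r * b
      rw [hr]; field_simp
    rw [hφ, hx, map_smul, hb, ← map_smul]
    congr 1
    rw [mul_smul_comm, div_mul_cancel₀ _ hb0]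
  rw [← (LinearEquiv.ofBijective φ ⟨h1, h2⟩).length_eq]
  exact Module.length_eq_one _ _

omit [IsLocalRing R] in
include hE in
theorem comp_surjective_of_injective {A B : Type} [AddCommGroup A] [Module R A] [AddCommGroup B]
    [Module R B] {a : A →ₗ[R] B} (ha : Function.Injective a) :
    Function.Surjective (LinearMap.lcomp R E a) := by
  intro g
  obtain ⟨h, hh⟩ := hE.out a ha g
  exact ⟨h, LinearMap.ext hh⟩

include hE hι hess in
theorem length_dual {L : Type} [AddCommGroup L] [Module R L]
    (hL : IsFiniteLength R L) : Module.length R (L →ₗ[R] E) = Module.length R L := by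
  induction hL with
  | @of_subsingleton L _ _ _ =>
    rw [Module.length_eq_zero_iff.2 inferInstance, Module.length_eq_zero_iff.2 inferInstance]
  | @of_simple_quotient L _ _ S _ hS ih =>
    obtain ⟨e⟩ := nonempty_equiv_residueField R (L ⧸ S)
    have h1 := S.injective_subtype
    have h2 := LinearMap.exact_subtype_mkQ S
    have h3 := S.mkQ_surjective
    rw [Module.length_eq_add_of_exact _ _ h1 h3 h2, Module.length_eq_add_of_exact
      (LinearMap.lcomp R E S.mkQ) (LinearMap.lcomp R E S.subtype)
      (LinearMap.lcomp_injective_of_surjective _ h3)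
      (comp_surjective_of_injective hE h1) (LinearMap.exact_lcomp_of_exact_of_surjective E h2 h3), ih,
      (e.congrLeft E R).length_eq, length_hom_residueField ι hι hess, Module.length_eq_one R (L ⧸ S), add_comm]

include hE hι in
theorem exists_dual_ne_zero {C : Type} [AddCommGroup C] [Module R C] {c : C} (hc : c ≠ 0) :
    ∃ f : C →ₗ[R] E, f c ≠ 0 := by
  let φ := LinearMap.toSpanSingleton R C c
  have hker : LinearMap.ker φ ≤ maximalIdeal R := by
    apply IsLocalRing.le_maximalIdeal
    rw [Ideal.ne_top_iff_one]
    simpa [φ] using hc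
  obtain ⟨h, hh⟩ := hE.out ((LinearMap.ker φ).liftQ φ le_rfl)
    (LinearMap.ker_eq_bot.1 (Submodule.ker_liftQ_eq_bot _ _ _ le_rfl))
    (ι ∘ₗ (LinearMap.ker φ).mapQ (maximalIdeal R) LinearMap.id hker)
  refine ⟨h, ?_⟩
  have h1 := hh (Submodule.Quotient.mk 1)
  simp only [Submodule.liftQ_apply, φ, LinearMap.toSpanSingleton_apply, one_smul] at h1
  rw [h1]
  intro h0
  exact one_ne_zero (α := ResidueField R) (hι (h0.trans (map_zero ι).symm))

include hE hι hess in
theorem isFiniteLength_of_dual {C : Type} [AddCommGroup C] [Module R C]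
    (h : IsFiniteLength R (C →ₗ[R] E)) : IsFiniteLength R C := by
  have h2 : IsFiniteLength R ((C →ₗ[R] E) →ₗ[R] E) := by
    rw [← Module.length_ne_top_iff, length_dual hE ι hι hess h, Module.length_ne_top_iff]
    exact h
  refine h2.of_injective (f := (LinearMap.id : (C →ₗ[R] E) →ₗ[R] (C →ₗ[R] E)).flip) ?_
  rw [injective_iff_map_eq_zero]
  intro c hc
  by_contra hc0
  obtain ⟨f, hf⟩ := exists_dual_ne_zero hE ι hι hc0
  exact hf (congrArg (fun g ↦ g f) hc)

include hess in
theorem exists_pow_smul_eq_zero [IsNoetherianRing R] (e : E) :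
    ∃ n : ℕ, ∀ r ∈ maximalIdeal R ^ n, r • e = 0 := by
  let M := Submodule.span R {e}
  let S := (LinearMap.range ι).comap M.subtype
  obtain ⟨k, hk⟩ := Ideal.exists_pow_inf_eq_pow_smul (maximalIdeal R) S
  have h1 := hk (k + 1) (by omega)
  have h2 : maximalIdeal R • S = ⊥ := by
    rw [eq_bot_iff, Submodule.smul_le]
    rintro r hr ⟨x, hx⟩ ⟨c, hc⟩
    have : r • c = 0 := by
      rw [Algebra.smul_def]
      have : algebraMap R (ResidueField R) r = 0 := (residue_eq_zero_iff _).2 hr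
      rw [this, zero_mul]
    rw [Submodule.mem_bot, Subtype.ext_iff]
    change r • x = 0
    have hc' : x = ι c := hc.symm
    rw [hc', ← map_smul, this, map_zero]
  have h3 : (maximalIdeal R ^ (k + 1) • (⊤ : Submodule R M)) ⊓ S = ⊥ := by
    rw [h1, Nat.add_sub_cancel_left, pow_one, eq_bot_iff, ← h2]
    exact Submodule.smul_mono le_rfl inf_le_right
  refine ⟨k + 1, fun r hr ↦ ?_⟩
  have h4 : (maximalIdeal R ^ (k + 1) • (⊤ : Submodule R M)).map M.subtype = ⊥ := by
    by_contra hne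
    obtain ⟨x, ⟨hx, ⟨y, hy, rfl⟩⟩, hx0⟩ := Submodule.exists_mem_ne_zero_of_ne_bot (hess _ hne)
    have : y ∈ (⊥ : Submodule R M) := h3 ▸ ⟨hy, hx⟩
    rw [Submodule.mem_bot] at this
    exact hx0 (by rw [this, map_zero])
  have h5 : r • e ∈ (maximalIdeal R ^ (k + 1) • (⊤ : Submodule R M)).map M.subtype :=
    ⟨r • ⟨e, Submodule.mem_span_singleton_self e⟩, Submodule.smul_mem_smul hr trivial, rfl⟩
  rwa [h4] at h5

end Dual
end LocCoh

namespace LocCoh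

theorem isWeaklyRegular_of_retract {R : Type} [CommRing R] (rs : List R) {M X : Type} [AddCommGroup M]
    [Module R M] [AddCommGroup X] [Module R X] (s : M →ₗ[R] X) (p : X →ₗ[R] M)
    (hps : p ∘ₗ s = LinearMap.id) (h : RingTheory.Sequence.IsWeaklyRegular X rs) :
    RingTheory.Sequence.IsWeaklyRegular M rs := by
  induction rs generalizing M X with
  | nil => exact .nil R M
  | cons r rs ih =>
    rw [RingTheory.Sequence.isWeaklyRegular_cons_iff] at h ⊢
    refine ⟨fun x y hxy ↦ ?_, ih (QuotSMulTop.map r s) (QuotSMulTop.map r p) ?_ h.2⟩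
    · have h1 : s x = s y := h.1 (by
        have := congrArg s hxy
        simpa using this)
      have h2 := congrArg p h1
      rwa [← LinearMap.comp_apply, ← LinearMap.comp_apply, hps] at h2
    · rw [← QuotSMulTop.map_comp, hps, QuotSMulTop.map_id]

theorem EX.subsingleton_prod {R : Type} [CommRing R] {A M N : Type} [AddCommGroup A] [Module R A] [AddCommGroup M] [Module R M]
    [AddCommGroup N] [Module R N] {i : ℕ} (h : Subsingleton (EX R A M i))
    (h' : Subsingleton (EX R A N i)) : Subsingleton (EX R A (M × N) i) := by
  have key : ∀ x : EX R A (M × N) i, x = 0 := fun x ↦ by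
    have hid : LinearMap.inl R M N ∘ₗ LinearMap.fst R M N +
        LinearMap.inr R M N ∘ₗ LinearMap.snd R M N = LinearMap.id := by ext <;> simp
    rw [← EX.post_id i x, ← hid, EX.post_add, LinearMap.add_apply, EX.post_comp, EX.post_comp,
      Subsingleton.elim (EX.post A (LinearMap.fst R M N) i x) 0,
      Subsingleton.elim (EX.post A (LinearMap.snd R M N) i x) 0, map_zero, map_zero, add_zero]
  exact ⟨fun x y ↦ by rw [key x, key y]⟩

variable {R : Type} [CommRing R] [IsLocalRing R]

theorem map_mk_maximalIdeal (J : Ideal R) [IsLocalRing (R ⧸ J)] :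
    (maximalIdeal R).map (Ideal.Quotient.mk J) = maximalIdeal (R ⧸ J) := by
  have := IsLocalHom.of_surjective (Ideal.Quotient.mk J) Ideal.Quotient.mk_surjective
  apply le_antisymm
  · exact (IsLocalRing.local_hom_TFAE (Ideal.Quotient.mk J)).out 0 2 |>.1 this
  · intro x hx
    obtain ⟨y, rfl⟩ := Ideal.Quotient.mk_surjective x
    refine Ideal.mem_map_of_mem _ ?_
    rw [mem_maximalIdeal] at hx ⊢
    exact fun hy ↦ hx (hy.map _)

variable [IsNoetherianRing R]

theorem isFiniteLength_quotient {J : Ideal R} {l : ℕ} (h : maximalIdeal R ^ l ≤ J) :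
    IsFiniteLength R (R ⧸ J) := by
  by_cases hJ : J = ⊤
  · have : Subsingleton (R ⧸ J) := Ideal.Quotient.subsingleton_iff.2 hJ
    exact .of_subsingleton
  · have := Ideal.Quotient.nontrivial_iff.2 hJ
    have : IsLocalRing (R ⧸ J) := .of_surjective' _ Ideal.Quotient.mk_surjective
    have : IsArtinianRing (R ⧸ J) := by
      rw [isArtinianRing_iff_isNilpotent_maximalIdeal]
      refine ⟨l, ?_⟩
      rw [← map_mk_maximalIdeal J, ← Ideal.map_pow, Ideal.zero_eq_bot, Ideal.map_eq_bot_iff_le_ker,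
        Ideal.mk_ker]
      exact h
    rw [isFiniteLength_iff_isNoetherian_isArtinian]
    exact ⟨inferInstance, isArtinian_of_surjective_algebraMap (R := R ⧸ J)
      Ideal.Quotient.mk_surjective⟩

theorem exists_pow_le_of_dim {J : Ideal R} (h : ringKrullDim (R ⧸ J) ≤ 0) :
    ∃ l, maximalIdeal R ^ l ≤ J := by
  have : IsArtinianRing (R ⧸ J) := by
    rw [isArtinianRing_iff_krullDimLE_zero]
    exact (Order.krullDimLE_iff 0 _).2 h
  exact exists_maximalIdeal_pow_le_of_isArtinianRing_quotient J

open RingTheory.Sequence in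
/-- A parameter ideal deep inside the maximal ideal, generated by a sequence of length `d`
which is regular on both `R` and `ω`. -/
structure Good (ω : Type) [AddCommGroup ω] [Module R ω] (d : ℕ) (rs : List R) : Prop where
  length_eq : rs.length = d
  mem : ∀ r ∈ rs, r ∈ maximalIdeal R
  regular : IsWeaklyRegular R rs
  regular' : IsWeaklyRegular ω rs
  exists_pow_le : ∃ l, maximalIdeal R ^ l ≤ Ideal.ofList rs

open RingTheory.Sequence in
theorem exists_good {d : ℕ} (hd : ringKrullDim R = d) {ω : Type} [AddCommGroup ω] [Module R ω]
    [Module.Finite R ω] (hR : ∀ i < d, Subsingleton (EX R (ResidueField R) R i))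
    (hω : ∀ i < d, Subsingleton (EX R (ResidueField R) ω i)) (n : ℕ) :
    ∃ rs : List R, Good ω d rs ∧ Ideal.ofList rs ≤ maximalIdeal R ^ n := by
  obtain ⟨rs, hlen, hmem, hreg⟩ := ModuleCat.exists_isRegular_of_exists_subsingleton_ext
    (maximalIdeal R ^ (n + 1)) d (ModuleCat.of R (R × ω)) (by
      rw [lt_top_iff_ne_top]
      intro h
      have h1 : ((1 : R), (0 : ω)) ∈ maximalIdeal R ^ (n + 1) • (⊤ : Submodule R (R × ω)) := by
        have : ((1 : R), (0 : ω)) ∈ (⊤ : Submodule R (R × ω)) := trivial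
        rwa [← h] at this
      have h2 := Submodule.mem_map_of_mem (f := LinearMap.fst R R ω) h1
      rw [Submodule.map_smul''] at h2
      have h3 : (1 : R) ∈ maximalIdeal R ^ (n + 1) := by
        have := Submodule.smul_mono le_rfl
          (le_top : Submodule.map (LinearMap.fst R R ω) ⊤ ≤ ⊤) h2
        simpa using this
      exact (Ideal.ne_top_iff_one _).1 (maximalIdeal.isMaximal R).ne_top
        (Ideal.pow_le_self (Nat.succ_ne_zero n) h3))
    (ModuleCat.of R (R ⧸ maximalIdeal R ^ (n + 1))) (by
      rw [Module.support_eq_zeroLocus, Ideal.annihilator_quotient])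
    (fun i hi ↦ EX.subsingleton_of_isFiniteLength (EX.subsingleton_prod (hR i hi) (hω i hi))
      (isFiniteLength_quotient le_rfl))
  have hle : ∀ r ∈ rs, r ∈ maximalIdeal R :=
    fun r hr ↦ Ideal.pow_le_self (Nat.succ_ne_zero n) (hmem r hr)
  have h1 : IsWeaklyRegular R rs := isWeaklyRegular_of_retract rs (LinearMap.inl R R ω)
    (LinearMap.fst R R ω) (LinearMap.fst_comp_inl ..) hreg.toIsWeaklyRegular
  have h2 : IsWeaklyRegular ω rs := isWeaklyRegular_of_retract rs (LinearMap.inr R R ω)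
    (LinearMap.snd R R ω) (LinearMap.snd_comp_inr ..) hreg.toIsWeaklyRegular
  have h3 : IsRegular R rs := (isRegular_iff_isWeaklyRegular_of_subset_maximalIdeal hle).2 h1
  refine ⟨rs, ⟨hlen, hle, h1, h2, ?_⟩, ?_⟩
  · refine exists_pow_le_of_dim ?_
    have := ringKrullDim_add_length_eq_ringKrullDim_of_isRegular rs h3
    rw [hlen, hd] at this
    generalize ringKrullDim (R ⧸ Ideal.ofList rs) = D at this
    induction D with
    | bot => exact bot_le
    | coe D =>
      norm_cast at this ⊢
      exact (ENat.add_left_injective_of_ne_top (ENat.natCast_ne_top d)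
        (this.trans (zero_add _).symm)).le
  · exact (Ideal.span_le.2 hmem).trans (Ideal.pow_le_pow_right (Nat.le_succ n))

end LocCoh

namespace LocCoh

theorem Good.subsingleton_EX {R : Type} [CommRing R] [IsNoetherianRing R] [IsLocalRing R]
    {ω : Type} [AddCommGroup ω] [Module R ω] {d : ℕ} {rs : List R} (h : Good ω d rs)
    (N : Type) [AddCommGroup N] [Module R N] {j : ℕ} (hj : d < j) :
    Subsingleton (EX R (R ⧸ Ideal.ofList rs) N j) := by
  have hreg := (IsLocalRing.isRegular_iff_isWeaklyRegular_of_subset_maximalIdeal h.mem).2 h.regular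
  have h1 := ModuleCat.projectiveDimension_quotient_eq_length.{0} rs hreg
  have h2 : HasProjectiveDimensionLT (ModuleCat.of R (Shrink.{0} (R ⧸ Ideal.ofList rs))) j := by
    rw [← projectiveDimension_lt_iff, h1, h.length_eq]
    exact_mod_cast hj
  have h3 : Subsingleton (EX R (Shrink.{0} (R ⧸ Ideal.ofList rs)) N j) :=
    ⟨fun x y ↦ (Abelian.Ext.eq_zero_of_hasProjectiveDimensionLT x j le_rfl).trans
      (Abelian.Ext.eq_zero_of_hasProjectiveDimensionLT y j le_rfl).symm⟩
  exact (EX.preEquiv (Shrink.linearEquiv R (R ⧸ Ideal.ofList rs)) j).toEquiv.subsingleton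

theorem EX.subsingleton_of_injective {R : Type} [CommRing R] {A Q : Type} [AddCommGroup A]
    [Module R A] [AddCommGroup Q] [Module R Q] (hQ : Module.Injective R Q) (i : ℕ) :
    Subsingleton (EX R A Q (i + 1)) := by
  have := (Module.injective_iff_injective_object R Q).1 hQ
  exact Abelian.Ext.subsingleton_of_injective (ModuleCat.of R A) (ModuleCat.of R Q) i

section Torsion
variable {R : Type} [CommRing R] (I : Ideal R)

/-- The submodule of elements killed by some power of `I`. -/
def tors (Q : Type) [AddCommGroup Q] [Module R Q] : Submodule R Q where
  carrier := {q | ∃ n : ℕ, ∀ r ∈ I ^ n, r • q = 0}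
  zero_mem' := ⟨0, fun r _ ↦ smul_zero r⟩
  add_mem' := by
    rintro a b ⟨m, hm⟩ ⟨n, hn⟩
    refine ⟨m + n, fun r hr ↦ ?_⟩
    rw [smul_add, hm r (Ideal.pow_le_pow_right (Nat.le_add_right m n) hr),
      hn r (Ideal.pow_le_pow_right (Nat.le_add_left n m) hr), add_zero]
  smul_mem' := by
    rintro c a ⟨m, hm⟩
    exact ⟨m, fun r hr ↦ by rw [smul_comm, hm r hr, smul_zero]⟩

variable {I}

theorem exists_pow_smul_eq_zero_of_finite {P : Type} [AddCommGroup P] [Module R P]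
    [Module.Finite R P] (hP : ∀ p : P, ∃ n : ℕ, ∀ r ∈ I ^ n, r • p = 0) :
    ∃ n : ℕ, ∀ r ∈ I ^ n, ∀ p : P, r • p = 0 := by
  choose f hf using hP
  obtain ⟨S, hS⟩ := (Module.Finite.fg_top : (⊤ : Submodule R P).FG)
  refine ⟨S.sup f, fun r hr p ↦ ?_⟩
  have hp : p ∈ Submodule.span R (S : Set P) := hS ▸ trivial
  induction hp using Submodule.span_induction with
  | mem x hx => exact hf x r (Ideal.pow_le_pow_right (Finset.le_sup hx) hr)
  | zero => exact smul_zero r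
  | add x y _ _ hx hy => rw [smul_add, hx, hy, add_zero]
  | smul c x _ hx => rw [smul_comm, hx, smul_zero]

theorem injective_tors [IsNoetherianRing R] {Q : Type} [AddCommGroup Q] [Module R Q]
    (hQ : Module.Injective R Q) : Module.Injective R (tors I Q) := by
  refine Module.Baer.injective fun J g ↦ ?_
  have ⟨l, hl⟩ := exists_pow_smul_eq_zero_of_finite (I := I) (P := LinearMap.range g) (by
    rintro ⟨⟨p, n, hp⟩, _⟩
    exact ⟨n, fun r hr ↦ Subtype.ext (Subtype.ext (hp r hr))⟩)
  obtain ⟨k, hk⟩ := Ideal.exists_pow_inf_eq_pow_smul I (M := R) J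
  let m : J →ₗ[R] R ⧸ I ^ (k + l) := Submodule.mkQ _ ∘ₗ J.subtype
  have hm : LinearMap.ker m ≤ LinearMap.ker g := by
    rintro ⟨x, hx⟩ hxm
    have h1 : x ∈ I ^ (k + l) := Ideal.Quotient.eq_zero_iff_mem.1 (by simpa [m] using hxm)
    have h2 : x ∈ I ^ (k + l) • (⊤ : Submodule R R) ⊓ J := ⟨by simpa using h1, hx⟩
    rw [hk _ (Nat.le_add_right k l), Nat.add_sub_cancel_left] at h2
    have h3 : x ∈ I ^ l • J := Submodule.smul_mono le_rfl inf_le_right h2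
    have h4 : I ^ l • J ≤ Submodule.map J.subtype (LinearMap.ker g) := by
      rw [Submodule.smul_le]
      intro r hr n hn
      refine ⟨r • ⟨n, hn⟩, ?_, rfl⟩
      rw [SetLike.mem_coe, LinearMap.mem_ker, map_smul]
      exact congrArg Subtype.val (hl r hr ⟨g ⟨n, hn⟩, LinearMap.mem_range_self ..⟩)
    obtain ⟨y, hy, hyx⟩ := h4 h3
    rwa [show (⟨x, hx⟩ : J) = y from Subtype.ext hyx.symm]
  have hinj : Function.Injective ((LinearMap.ker m).liftQ m le_rfl) := by
    rw [← LinearMap.ker_eq_bot, Submodule.ker_liftQ_eq_bot _ _ _ le_rfl]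
  obtain ⟨h, hh⟩ := hQ.out _ hinj ((tors I Q).subtype ∘ₗ (LinearMap.ker m).liftQ g hm)
  refine ⟨(h ∘ₗ Submodule.mkQ _).codRestrict _ fun x ↦ ⟨k + l, fun r hr ↦ ?_⟩, fun x hx ↦ ?_⟩
  · rw [← map_smul, LinearMap.comp_apply]
    have : Submodule.mkQ (I ^ (k + l)) (r • x) = 0 :=
      Ideal.Quotient.eq_zero_iff_mem.2 (Ideal.mul_mem_right x _ hr)
    rw [this, map_zero]
  · exact Subtype.ext (hh (Submodule.Quotient.mk ⟨x, hx⟩))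

namespace LC
variable {N P : Type} [AddCommGroup N] [Module R N] [AddCommGroup P] [Module R P]

variable (I N) in
/-- Evaluation at `1` from degree zero local cohomology to the module. -/
noncomputable def ev : LC I N 0 →ₗ[R] N :=
  lift (fun n ↦ LinearMap.applyₗ (1 : R ⧸ I ^ n) ∘ₗ EX.homEquiv.toLinearMap) fun m n h x ↦ by
    simp only [LinearMap.comp_apply, LinearEquiv.coe_coe, EX.homEquiv_pre, LinearMap.applyₗ_apply_apply]
    rfl

theorem ev_of (n : ℕ) (x : EX R (R ⧸ I ^ n) N 0) : ev I N (of I N 0 n x) = EX.homEquiv x 1 :=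
  lift_of _ _ _ _

theorem ev_injective : Function.Injective (ev I N) := by
  rw [injective_iff_map_eq_zero]
  intro x hx
  obtain ⟨n, y, rfl⟩ := exists_of x
  rw [ev_of] at hx
  have : EX.homEquiv y = 0 := by
    ext
    exact hx
  rw [(LinearEquiv.map_eq_zero_iff _).1 this, _root_.map_zero]

theorem ev_surjective (hN : tors I N = ⊤) : Function.Surjective (ev I N) := by
  intro t
  obtain ⟨n, hn⟩ : t ∈ tors I N := hN ▸ trivial
  refine ⟨of I N 0 n (EX.homEquiv.symm
    (Submodule.liftQ (I ^ n) (LinearMap.toSpanSingleton R N t) fun r hr ↦ by simpa using hn r hr)), ?_⟩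
  rw [ev_of, LinearEquiv.apply_symm_apply]
  exact one_smul R t

theorem ev_map (f : N →ₗ[R] P) (x : LC I N 0) : ev I P (map I f 0 x) = f (ev I N x) := by
  obtain ⟨n, y, rfl⟩ := exists_of x
  rw [map_of, ev_of, ev_of, EX.homEquiv_post]
  rfl

/-- Degree zero local cohomology of a torsion module is the module itself. -/
noncomputable def evEquiv (hN : tors I N = ⊤) : LC I N 0 ≃ₗ[R] N :=
  .ofBijective (ev I N) ⟨ev_injective, ev_surjective hN⟩

theorem tors_eq_top_of_surjective {f : N →ₗ[R] P} (hf : Function.Surjective f) (hN : tors I N = ⊤) :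
    tors I P = ⊤ := by
  rw [eq_top_iff]
  intro p _
  obtain ⟨x, rfl⟩ := hf p
  obtain ⟨n, hn⟩ : x ∈ tors I N := hN ▸ trivial
  exact ⟨n, fun r hr ↦ by rw [← _root_.map_smul, hn r hr, _root_.map_zero]⟩

theorem subsingleton_of_tors [IsNoetherianRing R] (i : ℕ) {T : Type} [AddCommGroup T] [Module R T]
    (hT : tors I T = ⊤) : Subsingleton (LC I T (i + 1)) := by
  obtain ⟨Q, hQ, f, hf⟩ : ∃ (Q : ModuleCat.{0} R) (_ : Module.Injective R Q) (f : T →ₗ[R] Q),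
      Function.Injective f := by
    let J := (EnoughInjectives.presentation (ModuleCat.of R T)).some
    exact ⟨J.J, (Module.injective_iff_injective_object R J.J).2 J.injective, J.f.hom,
      (ModuleCat.mono_iff_injective J.f).1 J.mono⟩
  let g : T →ₗ[R] tors I Q := f.codRestrict _ fun t ↦ by
    obtain ⟨n, hn⟩ : t ∈ tors I T := hT ▸ trivial
    exact ⟨n, fun r hr ↦ by rw [← _root_.map_smul, hn r hr, _root_.map_zero]⟩
  have hg : Function.Injective g := fun x y h ↦ hf (congrArg Subtype.val h)
  have hgp : Function.Exact g (LinearMap.range g).mkQ := LinearMap.exact_map_mkQ_range g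
  have hp := (LinearMap.range g).mkQ_surjective
  have htop : tors I (tors I Q) = ⊤ := by
    rw [eq_top_iff]
    rintro ⟨q, n, hn⟩ _
    exact ⟨n, fun r hr ↦ Subtype.ext (hn r hr)⟩
  have htop' := tors_eq_top_of_surjective hp htop
  have hz : ∀ i, Subsingleton (LC I (tors I Q) (i + 1)) := fun i ↦
    subsingleton_of_forall fun n ↦ EX.subsingleton_of_injective (injective_tors hQ) i
  have key : Function.Surjective (δ I hg hgp hp i) := fun x ↦
    (exact₁ hg hgp hp i x).1 (Subsingleton.elim _ _)
  cases i with
  | succ i =>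
    have := subsingleton_of_tors i htop'
    exact key.subsingleton
  | zero =>
    have h0 : ∀ x, δ I hg hgp hp 0 x = 0 := fun x ↦ by
      rw [exact₃ hg hgp hp 0 x]
      obtain ⟨q, hq⟩ := hp (ev I _ x)
      obtain ⟨w, rfl⟩ := ev_surjective htop q
      exact ⟨w, ev_injective (by rw [ev_map, hq])⟩
    refine ⟨fun x y ↦ ?_⟩
    obtain ⟨x, rfl⟩ := key x
    obtain ⟨y, rfl⟩ := key y
    rw [h0, h0]

end LC
end Torsion
end LocCoh

namespace LocCoh

namespace LC
variable {R : Type} [CommRing R] [IsLocalRing R]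

theorem subsingleton_of_residueField [IsNoetherianRing R] {N : Type} [AddCommGroup N] [Module R N]
    {i : ℕ} (h : Subsingleton (EX R (ResidueField R) N i)) :
    Subsingleton (LC (maximalIdeal R) N i) :=
  subsingleton_of_forall fun _ ↦ EX.subsingleton_of_isFiniteLength h (isFiniteLength_quotient le_rfl)

theorem of_eq_zero_of_pre [IsNoetherianRing R] {N : Type} [AddCommGroup N] [Module R N]
    {i n l : ℕ} {J : Ideal R} (hJ : J ≤ maximalIdeal R ^ n) (hl : maximalIdeal R ^ l ≤ J)
    (x : EX R (R ⧸ maximalIdeal R ^ n) N i) (hx : EX.pre N (qmap hJ) i x = 0) :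
    of (maximalIdeal R) N i n x = 0 := by
  have hmax : maximalIdeal R ^ (max l n) ≤ J :=
    (Ideal.pow_le_pow_right (le_max_left l n)).trans hl
  rw [← of_trans (le_max_right l n), ← qmap_comp hmax hJ, EX.pre_comp, hx, _root_.map_zero, _root_.map_zero]

theorem subsingleton_of_good [IsNoetherianRing R] {ω : Type} [AddCommGroup ω] [Module R ω] {d : ℕ}
    (hgood : ∀ n, ∃ rs : List R, Good ω d rs ∧ Ideal.ofList rs ≤ maximalIdeal R ^ n)
    (N : Type) [AddCommGroup N] [Module R N] {j : ℕ} (hj : d < j) :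
    Subsingleton (LC (maximalIdeal R) N j) := by
  have key : ∀ x : LC (maximalIdeal R) N j, x = 0 := fun x ↦ by
    obtain ⟨n, y, rfl⟩ := exists_of x
    obtain ⟨rs, hrs, hle⟩ := hgood n
    have := hrs.subsingleton_EX N hj
    exact of_eq_zero_of_pre hle hrs.exists_pow_le.choose_spec y (Subsingleton.elim _ _)
  exact ⟨fun x y ↦ (key x).trans (key y).symm⟩

end LC

theorem LC.subsingleton_pi {R : Type} [CommRing R] {I : Ideal R} {i : ℕ} {M : Type} [AddCommGroup M]
    [Module R M] (h : Subsingleton (LC I M i)) (n : ℕ) : Subsingleton (LC I (Fin n → M) i) := by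
  refine subsingleton_of_sum Finset.univ (fun j ↦ LinearMap.proj (φ := fun _ ↦ M) j)
    (fun j ↦ LinearMap.single R (fun _ ↦ M) j) ?_ h
  ext x j
  simp [Finset.sum_apply, Pi.single_apply]

theorem LC.subsingleton_pi_dual {R : Type} [CommRing R] {I : Ideal R} {i : ℕ} {M : Type} [AddCommGroup M]
    [Module R M] (h : Subsingleton (LC I M i)) (n : ℕ) :
    Subsingleton (LC I ((Fin n → R) →ₗ[R] M) i) := by
  have := subsingleton_pi h n
  exact (LC.congr (I := I) ((Pi.basisFun R (Fin n)).constr R) i).toEquiv.symm.subsingleton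

end LocCoh

namespace LocCoh
open RingTheory.Sequence

theorem EX.post_δ_naturality {R : Type} [CommRing R] (A : Type) {M N P M' N' P' : Type} [AddCommGroup A]
    [Module R A] [AddCommGroup M] [Module R M] [AddCommGroup N] [Module R N]
    [AddCommGroup P] [Module R P] [AddCommGroup M'] [Module R M'] [AddCommGroup N'] [Module R N']
    [AddCommGroup P'] [Module R P']
    {f : M →ₗ[R] N} {g : N →ₗ[R] P} (hf : Function.Injective f) (hfg : Function.Exact f g)
    (hg : Function.Surjective g) {f' : M' →ₗ[R] N'} {g' : N' →ₗ[R] P'} (hf' : Function.Injective f')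
    (hfg' : Function.Exact f' g') (hg' : Function.Surjective g')
    (u : M →ₗ[R] M') (v : N →ₗ[R] N') (w : P →ₗ[R] P') (h₁ : v ∘ₗ f = f' ∘ₗ u)
    (h₂ : w ∘ₗ g = g' ∘ₗ v) (i : ℕ) (x : EX R A P i) :
    EX.post A u (i + 1) (EX.δ A hf hfg hg i x) = EX.δ A hf' hfg' hg' i (EX.post A w i x) := by
  have key := ShortComplex.ShortExact.extClass_naturality (shortExact hf hfg hg)
    (shortExact hf' hfg' hg') ⟨ModuleCat.ofHom u, ModuleCat.ofHom v, ModuleCat.ofHom w,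
      by ext y; exact (LinearMap.congr_fun h₁ y).symm, by ext y; exact (LinearMap.congr_fun h₂ y).symm⟩
  let x' : Abelian.Ext (ModuleCat.of R A) (ModuleCat.of R P) i := x
  exact (Abelian.Ext.comp_assoc x' (shortExact hf hfg hg).extClass
      (Abelian.Ext.mk₀ (ModuleCat.ofHom u)) rfl (add_zero 1) (by omega)).trans
    ((congrArg (fun t ↦ x'.comp t rfl) key).trans
      (Abelian.Ext.comp_assoc x' (Abelian.Ext.mk₀ (ModuleCat.ofHom w))
        (shortExact hf' hfg' hg').extClass (add_zero i) (zero_add 1) (by omega)).symm)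

section
variable {R : Type} [CommRing R]

open scoped Pointwise in
theorem smul_exact_mkQ (r : R) (M : Type) [AddCommGroup M] [Module R M] :
    Function.Exact (LinearMap.lsmul R M r) (Submodule.mkQ (r • (⊤ : Submodule R M))) := by
  intro x
  rw [Submodule.mkQ_apply, Submodule.Quotient.mk_eq_zero]
  constructor
  · rintro ⟨y, -, rfl⟩
    exact ⟨y, rfl⟩
  · rintro ⟨y, rfl⟩
    exact ⟨y, trivial, rfl⟩

theorem EX.smul_eq_zero {A M : Type} [AddCommGroup A] [Module R A] [AddCommGroup M] [Module R M]
    {r : R} (hr : ∀ a : A, r • a = 0) {i : ℕ} (x : EX R A M i) : r • x = 0 := by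
  have h : r • (LinearMap.id : A →ₗ[R] A) = 0 := LinearMap.ext hr
  have h2 := LinearMap.congr_fun (EX.pre_smul (M := M) r (LinearMap.id : A →ₗ[R] A) i) x
  rw [h, EX.pre_zero, LinearMap.smul_apply, EX.pre_id] at h2
  exact h2.symm

theorem EX.post_lsmul {A M : Type} [AddCommGroup A] [Module R A] [AddCommGroup M] [Module R M]
    (r : R) {i : ℕ} (x : EX R A M i) : EX.post A (LinearMap.lsmul R M r) i x = r • x := by
  have h : LinearMap.lsmul R M r = r • LinearMap.id := rfl
  rw [h, EX.post_smul, LinearMap.smul_apply, EX.post_id]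

theorem EX.subsingleton_of_isWeaklyRegular {A : Type} [AddCommGroup A] [Module R A] {rs : List R}
    (hA : ∀ r ∈ rs, ∀ a : A, r • a = 0) {M : Type} [AddCommGroup M] [Module R M]
    (h : IsWeaklyRegular M rs) {j : ℕ} (hj : j < rs.length) : Subsingleton (EX R A M j) := by
  induction rs generalizing M j with
  | nil => simp at hj
  | cons r rs ih =>
    rw [isWeaklyRegular_cons_iff] at h
    have hr : ∀ i (x : EX R A M i), EX.post A (LinearMap.lsmul R M r) i x = 0 := fun i x ↦ by
      rw [EX.post_lsmul, EX.smul_eq_zero (hA r (by simp))]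
    suffices key : ∀ x : EX R A M j, x = 0 from ⟨fun x y ↦ (key x).trans (key y).symm⟩
    intro x
    have hinj : Function.Injective (LinearMap.lsmul R M r) := h.1
    cases j with
    | zero => exact EX.post_injective hinj ((hr 0 x).trans (map_zero _).symm)
    | succ j =>
      have := ih (fun s hs ↦ hA s (by simp [hs])) h.2 (by simpa using hj)
      obtain ⟨y, rfl⟩ := (EX.exact₁ hinj (smul_exact_mkQ r M) (Submodule.mkQ_surjective _) j x).1
        (hr _ x)
      rw [Subsingleton.elim y 0, map_zero]

open Submodule in
/-- Rees' isomorphism: `Ext` in degree the length of a regular sequence is computed by `Hom`. -/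
theorem EX.exists_homEquiv_of_isWeaklyRegular {A : Type} [AddCommGroup A] [Module R A] {rs : List R}
    (hA : ∀ r ∈ rs, ∀ a : A, r • a = 0) :
    ∃ θ : ∀ (M : Type) [AddCommGroup M] [Module R M], IsWeaklyRegular M rs →
        (EX R A M rs.length ≃ₗ[R] (A →ₗ[R] M ⧸ (Ideal.ofList rs • (⊤ : Submodule R M)))),
      ∀ (M M' : Type) [AddCommGroup M] [Module R M] [AddCommGroup M'] [Module R M']
        (h : IsWeaklyRegular M rs) (h' : IsWeaklyRegular M' rs) (f : M →ₗ[R] M')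
        (x : EX R A M rs.length),
        θ M' h' (EX.post A f _ x) =
          mapQ _ _ f (smul_top_le_comap_smul_top (Ideal.ofList rs) f) ∘ₗ θ M h x := by
  induction rs with
  | nil =>
    refine ⟨fun M _ _ _ ↦ EX.homEquiv.trans ((LinearEquiv.refl R A).arrowCongr
      (quotEquivOfEqBot _ (by simp)).symm), fun M M' _ _ _ _ h h' f x ↦ ?_⟩
    ext a
    have := EX.homEquiv_post f x
    simp only [List.length_nil] at this ⊢
    simp [this]
  | cons r rs ih =>
    obtain ⟨θ, hθ⟩ := ih fun s hs ↦ hA s (by simp [hs])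
    have hinj : ∀ (M : Type) [AddCommGroup M] [Module R M], IsWeaklyRegular M (r :: rs) →
        Function.Injective (LinearMap.lsmul R M r) := fun M _ _ h ↦
      ((isWeaklyRegular_cons_iff M r rs).1 h).1
    let Δ : ∀ (M : Type) [AddCommGroup M] [Module R M] (h : IsWeaklyRegular M (r :: rs)),
        EX R A (QuotSMulTop r M) rs.length ≃ₗ[R] EX R A M (rs.length + 1) := fun M _ _ h ↦
      LinearEquiv.ofBijective (EX.δ A (hinj M h) (smul_exact_mkQ r M) (mkQ_surjective _) rs.length) (by
        constructor
        · rw [injective_iff_map_eq_zero]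
          intro x hx
          obtain ⟨y, rfl⟩ := (EX.exact₃ (hinj M h) (smul_exact_mkQ r M) (mkQ_surjective _) _ x).1 hx
          have := EX.subsingleton_of_isWeaklyRegular hA h (j := rs.length) (by simp)
          rw [Subsingleton.elim y 0, map_zero]
        · intro x
          refine (EX.exact₁ (hinj M h) (smul_exact_mkQ r M) (mkQ_surjective _) _ x).1 ?_
          rw [EX.post_lsmul, EX.smul_eq_zero (hA r (by simp))])
    have hΔ : ∀ (M M' : Type) [AddCommGroup M] [Module R M] [AddCommGroup M'] [Module R M']
        (h : IsWeaklyRegular M (r :: rs)) (h' : IsWeaklyRegular M' (r :: rs)) (f : M →ₗ[R] M')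
        (x : EX R A (QuotSMulTop r M) rs.length),
        EX.post A f _ (Δ M h x) = Δ M' h' (EX.post A (QuotSMulTop.map r f) _ x) := by
      intro M M' _ _ _ _ h h' f x
      exact EX.post_δ_naturality A (hinj M h) (smul_exact_mkQ r M) (mkQ_surjective _)
        (hinj M' h') (smul_exact_mkQ r M') (mkQ_surjective _) f f (QuotSMulTop.map r f)
        (LinearMap.ext fun y ↦ map_smul f r y) (QuotSMulTop.map_comp_mkQ r f) _ x
    refine ⟨fun M _ _ h ↦ (Δ M h).symm.trans ((θ _ ((isWeaklyRegular_cons_iff M r rs).1 h).2).trans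
      ((LinearEquiv.refl R A).arrowCongr (quotOfListConsSMulTopEquivQuotSMulTopInner M r rs).symm)),
      fun M M' _ _ _ _ h h' f x ↦ ?_⟩
    obtain ⟨x, rfl⟩ := (Δ M h).surjective x
    have hn := quotOfListConsSMulTopEquivQuotSMulTopInner_naturality r rs f
    ext a
    have e : EX.post A f (r :: rs).length (Δ M h x) = Δ M' h' (EX.post A (QuotSMulTop.map r f) _ x) :=
      hΔ M M' h h' f x
    rw [e]
    simp only [LinearEquiv.trans_apply, LinearEquiv.symm_apply_apply, LinearMap.comp_apply,
      LinearEquiv.arrowCongr_apply, LinearEquiv.refl_symm, LinearEquiv.refl_apply]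
    rw [LinearEquiv.symm_apply_eq, hθ]
    have := LinearMap.congr_fun hn ((quotOfListConsSMulTopEquivQuotSMulTopInner M r rs).symm
      (θ _ ((isWeaklyRegular_cons_iff M r rs).1 h).2 x a))
    simp only [LinearMap.comp_apply, LinearEquiv.coe_coe, LinearEquiv.apply_symm_apply] at this ⊢
    exact this.symm
end
end LocCoh

namespace LocCoh

theorem surjective_of_length_eq {R : Type} [CommRing R] {A B : Type} [AddCommGroup A] [Module R A]
    [AddCommGroup B] [Module R B] {f : A →ₗ[R] B} (hf : Function.Injective f)
    (hA : IsFiniteLength R A) (h : Module.length R B = Module.length R A) :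
    Function.Surjective f := by
  have h1 := Module.length_eq_add_of_exact f (LinearMap.range f).mkQ hf
    (LinearMap.range f).mkQ_surjective (LinearMap.exact_map_mkQ_range f)
  rw [h] at h1
  have h2 := Module.length_ne_top_iff.2 hA
  have h3 : Module.length R (B ⧸ LinearMap.range f) = 0 :=
    ENat.add_right_injective_of_ne_top h2 (h1.symm.trans (add_zero _).symm)
  rw [Module.length_eq_zero_iff, Submodule.Quotient.subsingleton_iff] at h3
  exact LinearMap.range_eq_top.1 h3

namespace Good

theorem smul_mkQ {R : Type} [CommRing R] {rs : List R} (M : Type) [AddCommGroup M] [Module R M] {r : R} (hr : r ∈ Ideal.ofList rs)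
    (p : M ⧸ (Ideal.ofList rs • (⊤ : Submodule R M))) : r • p = 0 := by
  obtain ⟨m, rfl⟩ := Submodule.mkQ_surjective _ p
  rw [← map_smul, Submodule.mkQ_apply, Submodule.Quotient.mk_eq_zero]
  exact Submodule.smul_mem_smul hr trivial

theorem mem_ofList {R : Type} [CommRing R] {rs : List R} {r : R} (hr : r ∈ rs) : r ∈ Ideal.ofList rs := Ideal.subset_span hr

theorem smul_quotient {R : Type} [CommRing R] {J : Ideal R} {r : R} (hr : r ∈ J) (a : R ⧸ J) : r • a = 0 := by
  obtain ⟨m, rfl⟩ := Submodule.mkQ_surjective _ a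
  exact Ideal.Quotient.eq_zero_iff_mem.2 (J.mul_mem_right m hr)

end Good

variable {R : Type} [CommRing R] [IsNoetherianRing R] [IsLocalRing R]

theorem isFiniteLength_of_pow_smul {P : Type} [AddCommGroup P] [Module R P] [Module.Finite R P] {l : ℕ}
    (h : ∀ r ∈ maximalIdeal R ^ l, ∀ p : P, r • p = 0) : IsFiniteLength R P := by
  obtain ⟨n, f, hf⟩ := Module.Finite.exists_fin' R P
  obtain ⟨h1, h2⟩ := isFiniteLength_iff_isNoetherian_isArtinian.1
    (isFiniteLength_quotient (R := R) (le_refl (maximalIdeal R ^ l)))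
  have h3 : IsFiniteLength R (Fin n → R ⧸ maximalIdeal R ^ l) :=
    isFiniteLength_iff_isNoetherian_isArtinian.2 ⟨inferInstance, inferInstance⟩
  have hmem : ∀ i, ∀ r ∈ maximalIdeal R ^ l,
      r ∈ LinearMap.ker (LinearMap.toSpanSingleton R P (f (Pi.single i 1))) := fun i r hr ↦ by
    simpa using h r hr _
  let g : (Fin n → R ⧸ maximalIdeal R ^ l) →ₗ[R] P := LinearMap.lsum R _ R fun i ↦
    Submodule.liftQ _ (LinearMap.toSpanSingleton R P (f (Pi.single i 1))) (hmem i)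
  refine h3.of_surjective (f := g) fun p ↦ ?_
  obtain ⟨x, rfl⟩ := hf p
  refine ⟨fun i ↦ Submodule.Quotient.mk (x i), ?_⟩
  conv_rhs => rw [← LinearMap.sum_single_apply (fun _ ↦ R) x, map_sum]
  simp only [g, LinearMap.lsum_apply, LinearMap.sum_apply, LinearMap.comp_apply, LinearMap.proj_apply,
    Submodule.liftQ_apply, LinearMap.toSpanSingleton_apply]
  refine Finset.sum_congr rfl fun i _ ↦ ?_
  rw [← map_smul, ← Pi.single_smul, smul_eq_mul, mul_one]

namespace Good
variable {ω : Type} [AddCommGroup ω] [Module R ω] {d : ℕ} {rs : List R}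

theorem isFiniteLength (h : Good ω d rs) : IsFiniteLength R (R ⧸ Ideal.ofList rs) :=
  isFiniteLength_quotient h.exists_pow_le.choose_spec

omit [IsNoetherianRing R] in
/-- `Ext` from a module killed by the sequence into the canonical module. -/
theorem nonempty_equiv (h : Good ω d rs) (A : Type) [AddCommGroup A] [Module R A]
    (hA : ∀ r ∈ Ideal.ofList rs, ∀ a : A, r • a = 0) :
    Nonempty (EX R A ω d ≃ₗ[R] (A →ₗ[R] ω ⧸ (Ideal.ofList rs • (⊤ : Submodule R ω)))) := by
  obtain ⟨θ, -⟩ := EX.exists_homEquiv_of_isWeaklyRegular (A := A) fun r hr ↦ hA r (mem_ofList hr)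
  have := θ ω h.regular'
  rw [h.length_eq] at this
  exact ⟨this⟩

variable [Module.Finite R ω]

theorem isFiniteLength' (h : Good ω d rs) :
    IsFiniteLength R (ω ⧸ (Ideal.ofList rs • (⊤ : Submodule R ω))) :=
  isFiniteLength_of_pow_smul fun _ hr ↦ smul_mkQ ω (h.exists_pow_le.choose_spec hr)

variable (h : Good ω (d + 1) rs) (hc : IsCan R ω (d + 1))
include h hc

omit [Module.Finite R ω] in
theorem mem_of_smul_eq_zero {r : R}
    (hr : ∀ p : ω ⧸ (Ideal.ofList rs • (⊤ : Submodule R ω)), r • p = 0) : r ∈ Ideal.ofList rs := by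
  obtain ⟨e⟩ := h.nonempty_equiv (R ⧸ Ideal.ofList rs) fun r hr a ↦ smul_quotient hr a
  have h1 : ∀ x : EX R (R ⧸ Ideal.ofList rs) ω (d + 1), r • x = 0 := fun x ↦ by
    apply e.injective
    rw [map_smul, map_zero]
    exact LinearMap.ext fun a ↦ hr _
  let m : (R ⧸ Ideal.ofList rs) →ₗ[R] R ⧸ Ideal.ofList rs := r • LinearMap.id
  have hfl := h.isFiniteLength.of_injective (LinearMap.range m).injective_subtype
  have h2 : Subsingleton (EX R (LinearMap.range m) ω (d + 1)) := by
    suffices key : ∀ y : EX R (LinearMap.range m) ω (d + 1), y = 0 from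
      ⟨fun x y ↦ (key x).trans (key y).symm⟩
    intro y
    obtain ⟨x, rfl⟩ := hc.pre_surjective h.isFiniteLength (LinearMap.range m).injective_subtype y
    apply hc.pre_injective h.isFiniteLength m.surjective_rangeRestrict
    rw [← EX.pre_comp, map_zero]
    have : (LinearMap.range m).subtype ∘ₗ m.rangeRestrict = r • LinearMap.id := rfl
    rw [this, EX.pre_smul, LinearMap.smul_apply, EX.pre_id, h1]
  have h3 : Module.length R (LinearMap.range m) = 0 := by
    rw [← hc.length_eq hfl, Module.length_eq_zero_iff]
    exact h2
  rw [Module.length_eq_zero_iff] at h3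
  have h4 : m 1 = 0 := congrArg Subtype.val
    (Subsingleton.elim (⟨m 1, LinearMap.mem_range_self ..⟩ : LinearMap.range m) 0)
  have h5 : (Submodule.Quotient.mk (r • (1 : R)) : R ⧸ Ideal.ofList rs) = 0 := h4
  rw [smul_eq_mul, mul_one] at h5
  exact Ideal.Quotient.eq_zero_iff_mem.1 h5

/-- Endomorphisms of the reduced canonical module are scalars. -/
theorem exists_smul_eq (u : Module.End R (ω ⧸ (Ideal.ofList rs • (⊤ : Submodule R ω)))) :
    ∃ c : R, ∀ p, u p = c • p := by
  obtain ⟨e⟩ := h.nonempty_equiv (R ⧸ Ideal.ofList rs) fun r hr a ↦ smul_quotient hr a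
  obtain ⟨e'⟩ := h.nonempty_equiv (ω ⧸ (Ideal.ofList rs • (⊤ : Submodule R ω))) fun r hr a ↦
    smul_mkQ ω hr a
  let E := ω ⧸ (Ideal.ofList rs • (⊤ : Submodule R ω))
  let lin : R →ₗ[R] Module.End R E := LinearMap.toSpanSingleton R _ LinearMap.id
  let g : (R ⧸ Ideal.ofList rs) →ₗ[R] Module.End R E := Submodule.liftQ _ lin fun r hr ↦
    LinearMap.ext fun p ↦ smul_mkQ ω hr p
  have hg : Function.Injective g := by
    rw [← LinearMap.ker_eq_bot]
    refine Submodule.ker_liftQ_eq_bot _ _ _ fun r hr ↦ ?_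
    exact h.mem_of_smul_eq_zero hc fun p ↦ LinearMap.congr_fun hr p
  let q : ((R ⧸ Ideal.ofList rs) →ₗ[R] E) ≃ₗ[R] E :=
    { LinearMap.applyₗ (1 : R ⧸ Ideal.ofList rs) with
      invFun := fun p ↦ Submodule.liftQ _ (LinearMap.toSpanSingleton R _ p) fun r hr ↦ smul_mkQ ω hr p
      left_inv := fun f ↦ by
        ext
        exact one_smul R _
      right_inv := fun p ↦ one_smul R p }
  have hlen : Module.length R (Module.End R E) = Module.length R (R ⧸ Ideal.ofList rs) := by
    rw [← hc.length_eq h.isFiniteLength, e.length_eq, q.length_eq]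
    exact e'.length_eq.symm.trans (hc.length_eq h.isFiniteLength')
  obtain ⟨c, hcu⟩ := surjective_of_length_eq hg h.isFiniteLength hlen u
  obtain ⟨c, rfl⟩ := Submodule.mkQ_surjective _ c
  exact ⟨c, fun p ↦ by rw [← hcu]; rfl⟩

end Good
end LocCoh

namespace LocCoh

theorem exists_smul_ne_zero_of_pow {R : Type} [CommRing R] {I : Ideal R} {P : Type} [AddCommGroup P]
    [Module R P] {y : P} (hy : y ≠ 0) {n : ℕ} (h : ∀ r ∈ I ^ n, r • y = 0) :
    ∃ r : R, r • y ≠ 0 ∧ ∀ s ∈ I, s • r • y = 0 := by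
  induction n with
  | zero => exact absurd (by simpa using h 1 (by simp)) hy
  | succ n ih =>
    by_cases hn : ∀ r ∈ I ^ n, r • y = 0
    · exact ih hn
    · push Not at hn
      obtain ⟨r, hr, hry⟩ := hn
      refine ⟨r, hry, fun s hs ↦ ?_⟩
      rw [smul_smul]
      exact h _ (by rw [pow_succ']; exact Ideal.mul_mem_mul hs hr)

variable {R : Type} [CommRing R] [IsNoetherianRing R] [IsLocalRing R]
  {ω : Type} [AddCommGroup ω] [Module R ω] {d : ℕ}

theorem IsCan.exists_pre_qmap (hc : IsCan R ω (d + 1)) {I J : Ideal R} (h : I ≤ J)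
    (hI : IsFiniteLength R (R ⧸ I)) (y : EX R (R ⧸ I) ω (d + 1)) (hy : ∀ r ∈ J, r • y = 0) :
    ∃ z, EX.pre ω (qmap h) (d + 1) z = y := by
  have hex := EX.coexact₂ (M := ω) (LinearMap.ker (qmap h)).injective_subtype
    (LinearMap.exact_subtype_ker_map (qmap h)) (qmap_surjective h) (d + 1)
  refine (hex y).1 ?_
  obtain ⟨s, t, ht⟩ := Submodule.fg_iff_exists_fin_generating_family.1 (IsNoetherian.noetherian J)
  have htJ : ∀ i, t i ∈ J := fun i ↦ ht ▸ Submodule.subset_span ⟨i, rfl⟩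
  let b₀ : (Fin s → R ⧸ I) →ₗ[R] R ⧸ I := ∑ i, t i • LinearMap.proj i
  have hb₀ : ∀ x, b₀ x ∈ LinearMap.ker (qmap h) := fun x ↦ by
    rw [LinearMap.mem_ker]
    simp only [b₀, LinearMap.sum_apply, LinearMap.smul_apply, map_sum, map_smul]
    exact Finset.sum_eq_zero fun i _ ↦ Good.smul_quotient (htJ i) _
  let b : (Fin s → R ⧸ I) →ₗ[R] LinearMap.ker (qmap h) := b₀.codRestrict _ hb₀
  have hb : Function.Surjective b := by
    rintro ⟨x, hx⟩
    obtain ⟨x, rfl⟩ := Submodule.mkQ_surjective _ x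
    have hxJ : x ∈ J := Ideal.Quotient.eq_zero_iff_mem.1 hx
    rw [← ht, Submodule.mem_span_range_iff_exists_fun] at hxJ
    obtain ⟨c, rfl⟩ := hxJ
    refine ⟨fun i ↦ Submodule.mkQ _ (c i), Subtype.ext ?_⟩
    simp only [b, b₀, LinearMap.codRestrict_apply, LinearMap.sum_apply, LinearMap.smul_apply,
      LinearMap.proj_apply, map_sum, smul_eq_mul]
    refine Finset.sum_congr rfl fun i _ ↦ ?_
    rw [← map_smul, smul_eq_mul, mul_comm]
  obtain ⟨h1, h2⟩ := isFiniteLength_iff_isNoetherian_isArtinian.1 hI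
  have h3 : IsFiniteLength R (Fin s → R ⧸ I) :=
    isFiniteLength_iff_isNoetherian_isArtinian.2 ⟨inferInstance, inferInstance⟩
  apply hc.pre_injective h3 hb
  rw [← EX.pre_comp, map_zero]
  have : (LinearMap.ker (qmap h)).subtype ∘ₗ b = b₀ := rfl
  rw [this, EX.pre_sum]
  refine Finset.sum_eq_zero fun i _ ↦ ?_
  rw [EX.pre_smul, LinearMap.smul_apply, ← map_smul, hy _ (htJ i), map_zero]

theorem IsCan.of_injective (hc : IsCan R ω (d + 1)) (n : ℕ) :
    Function.Injective (LC.of (maximalIdeal R) ω (d + 1) n) := by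
  rw [injective_iff_map_eq_zero]
  intro x hx
  obtain ⟨m, hm, h⟩ := LC.of_eq_zero hx
  exact hc.pre_injective (isFiniteLength_quotient le_rfl) (qmap_surjective _) (h.trans (map_zero _).symm)

/-- The top local cohomology of the canonical module is the injective hull of the residue field. -/
theorem IsCan.nonempty_equiv (hc : IsCan R ω (d + 1)) {E : Type} [AddCommGroup E] [Module R E]
    (hE : Module.Injective R E) (ι : ResidueField R →ₗ[R] E) (hι : Function.Injective ι)
    (hess : ∀ P : Submodule R E, P ≠ ⊥ → LinearMap.range ι ⊓ P ≠ ⊥) :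
    Nonempty (LC (maximalIdeal R) ω (d + 1) ≃ₗ[R] E) := by
  obtain ⟨e₀⟩ := hc.2
  have e₁ : (R ⧸ maximalIdeal R ^ 1) ≃ₗ[R] ResidueField R :=
    Submodule.quotEquivOfEq _ _ (pow_one _)
  let g₁ : EX R (R ⧸ maximalIdeal R ^ 1) ω (d + 1) →ₗ[R] E :=
    ι ∘ₗ e₀.toLinearMap ∘ₗ (EX.preEquiv e₁.symm (d + 1)).toLinearMap
  have hg₁ : Function.Injective g₁ :=
    hι.comp (e₀.injective.comp (EX.preEquiv e₁.symm (d + 1)).injective)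
  obtain ⟨g, hg⟩ := comp_surjective_of_injective hE (hc.of_injective 1) g₁
  have hg' : ∀ x, g (LC.of _ ω (d + 1) 1 x) = g₁ x := fun x ↦ LinearMap.congr_fun hg x
  have hgn : ∀ n, Function.Injective (g ∘ₗ LC.of (maximalIdeal R) ω (d + 1) n) := by
    intro n
    rw [injective_iff_map_eq_zero]
    intro y hy
    by_contra hy0
    have hn : ∀ r ∈ maximalIdeal R ^ n, r • y = 0 := fun r hr ↦
      EX.smul_eq_zero (fun a ↦ Good.smul_quotient hr a) y
    obtain ⟨r, hr0, hr⟩ := exists_smul_ne_zero_of_pow hy0 hn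
    rcases n with - | n
    · exact hy0 (by simpa using hn 1 (by simp))
    obtain ⟨z, hz⟩ := hc.exists_pre_qmap (Ideal.pow_le_pow_right (by omega : 1 ≤ n + 1))
      (isFiniteLength_quotient le_rfl) (r • y) fun s hs ↦ hr s (by simpa using hs)
    have h1 : g₁ z = 0 := by
      rw [← hg', ← LC.of_trans (by omega : 1 ≤ n + 1), hz, map_smul, map_smul]
      exact (congrArg (r • ·) hy).trans (smul_zero r)
    rw [hg₁ (h1.trans (map_zero g₁).symm), map_zero] at hz
    exact hr0 hz.symm
  refine ⟨LinearEquiv.ofBijective g ⟨?_, ?_⟩⟩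
  · rw [injective_iff_map_eq_zero]
    intro v hv
    obtain ⟨n, y, rfl⟩ := LC.exists_of v
    rw [hgn n (show (g ∘ₗ LC.of (maximalIdeal R) ω (d + 1) n) y = _ from hv.trans (map_zero _).symm),
      map_zero]
  · intro e
    obtain ⟨n, hn⟩ := exists_pow_smul_eq_zero ι hess e
    have hfl : IsFiniteLength R (R ⧸ maximalIdeal R ^ n) := isFiniteLength_quotient le_rfl
    let g' := g ∘ₗ LC.of (maximalIdeal R) ω (d + 1) n
    have hy : ∀ y, maximalIdeal R ^ n ≤ LinearMap.ker (LinearMap.toSpanSingleton R E (g' y)) :=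
      fun y r hr ↦ by
        rw [LinearMap.mem_ker, LinearMap.toSpanSingleton_apply, ← map_smul,
          EX.smul_eq_zero (fun a ↦ Good.smul_quotient hr a) y, map_zero]
    let gn : EX R (R ⧸ maximalIdeal R ^ n) ω (d + 1) →ₗ[R] (R ⧸ maximalIdeal R ^ n →ₗ[R] E) :=
      { toFun := fun y ↦ Submodule.liftQ _ (LinearMap.toSpanSingleton R E (g' y)) (hy y)
        map_add' := fun y z ↦ by
          ext
          change (1 : R) • g' (y + z) = (1 : R) • g' y + (1 : R) • g' z
          rw [map_add, smul_add]
        map_smul' := fun r y ↦ by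
          ext
          change (1 : R) • g' (r • y) = r • (1 : R) • g' y
          rw [one_smul, one_smul, map_smul] }
    have hgn1 : ∀ y, gn y (Submodule.Quotient.mk 1) = g' y := fun y ↦ one_smul R (g' y)
    have hinj : Function.Injective gn := by
      rw [injective_iff_map_eq_zero]
      intro y hy
      refine hgn n (Eq.trans ?_ (map_zero _).symm)
      exact (hgn1 y).symm.trans (by rw [hy]; rfl)
    obtain ⟨y, hye⟩ := surjective_of_length_eq hinj (by
        rw [← Module.length_ne_top_iff, hc.length_eq hfl, Module.length_ne_top_iff]
        exact hfl) (by rw [length_dual hE ι hι hess hfl, hc.length_eq hfl])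
      (Submodule.liftQ _ (LinearMap.toSpanSingleton R E e) fun r hr ↦ hn r hr)
    refine ⟨LC.of _ ω (d + 1) n y, ?_⟩
    have h1 := hgn1 y
    rw [hye] at h1
    exact h1.symm.trans (one_smul R e)

end LocCoh

namespace LocCoh

theorem exists_factor_of_injective {R : Type} [CommRing R] {V : Type} [AddCommGroup V] [Module R V]
    (hV : Module.Injective R V) {A B : Type} [AddCommGroup A] [Module R A] [AddCommGroup B] [Module R B]
    (f : A →ₗ[R] B) (u : A →ₗ[R] V) (h : LinearMap.ker f ≤ LinearMap.ker u) :
    ∃ v : B →ₗ[R] V, ∀ a, v (f a) = u a := by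
  obtain ⟨v, hv⟩ := hV.out ((LinearMap.ker f).liftQ f le_rfl)
    (LinearMap.ker_eq_bot.1 (Submodule.ker_liftQ_eq_bot _ _ _ le_rfl)) ((LinearMap.ker f).liftQ u h)
  exact ⟨v, fun a ↦ hv (Submodule.Quotient.mk a)⟩

namespace LC
variable {R : Type} [CommRing R] {I : Ideal R} {ω : Type} [AddCommGroup ω] [Module R ω] {d : ℕ}
  {M N : Type} [AddCommGroup M] [Module R M] [AddCommGroup N] [Module R N]

variable (I ω N d) in
/-- The pairing of local cohomology with the dual into `ω`. -/
noncomputable def dual : LC I N d →ₗ[R] (N →ₗ[R] ω) →ₗ[R] LC I ω d :=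
  LinearMap.mk₂ R (fun h f ↦ map I f d h) (fun _ _ _ ↦ _root_.map_add _ _ _)
    (fun _ _ _ ↦ _root_.map_smul _ _ _) (fun h f g ↦ by rw [map_add, LinearMap.add_apply])
    (fun c h f ↦ by rw [map_smul, LinearMap.smul_apply])

@[simp] theorem dual_apply (h : LC I N d) (f : N →ₗ[R] ω) : dual I ω d N h f = map I f d h := rfl

theorem dual_map (a : M →ₗ[R] N) (h : LC I M d) (f : N →ₗ[R] ω) :
    dual I ω d N (map I a d h) f = dual I ω d M h (f ∘ₗ a) := by
  rw [dual_apply, dual_apply, map_comp]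
  rfl

theorem sum_map_single_proj (n : ℕ) (f : (Fin n → R) →ₗ[R] N) :
    ∑ j, (f ∘ₗ LinearMap.single R (fun _ ↦ R) j) ∘ₗ LinearMap.proj (φ := fun _ ↦ R) j = f := by
  ext i
  simp [Pi.single_apply, apply_ite]

theorem dual_pi_bijective (h : Function.Bijective (dual I ω d R)) (n : ℕ) :
    Function.Bijective (dual I ω d (Fin n → R)) := by
  constructor
  · rw [injective_iff_map_eq_zero]
    intro x hx
    have h1 : ∀ j, map I (LinearMap.proj (R := R) (φ := fun _ : Fin n ↦ R) j) d x = 0 := fun j ↦ by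
      apply h.1
      rw [_root_.map_zero]
      ext f
      rw [dual_map, hx]
      rfl
    have h2 := congrArg (fun g ↦ map I g d x) (sum_map_single_proj n (LinearMap.id : (Fin n → R) →ₗ[R] _))
    simp only [map_id, map_sum, LinearMap.id_apply] at h2
    rw [← h2, LinearMap.sum_apply]
    refine Finset.sum_eq_zero fun j _ ↦ ?_
    rw [map_comp, LinearMap.comp_apply, h1, _root_.map_zero]
  · intro u
    choose y hy using fun j ↦ h.2 (u ∘ₗ LinearMap.lcomp R ω (LinearMap.proj (φ := fun _ : Fin n ↦ R) j))
    refine ⟨∑ j, map I (LinearMap.single R (fun _ ↦ R) j) d (y j), LinearMap.ext fun f ↦ ?_⟩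
    rw [_root_.map_sum, LinearMap.sum_apply]
    conv_rhs => rw [← sum_map_single_proj n f, _root_.map_sum]
    refine Finset.sum_congr rfl fun j _ ↦ ?_
    rw [dual_map, hy]
    rfl

section
variable (hd : ∀ (N : Type) [AddCommGroup N] [Module R N], Subsingleton (LC I N (d + 1)))
  (hV : Module.Injective R (LC I ω d)) (h : Function.Bijective (dual I ω d R))
include hV h

theorem dual_surjective [Module.Finite R N] : Function.Surjective (dual I ω d N) := by
  obtain ⟨n, p, hp⟩ := Module.Finite.exists_fin' R N
  intro u
  obtain ⟨v, hv⟩ := hV.out (LinearMap.lcomp R ω p) (LinearMap.lcomp_injective_of_surjective _ hp) u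
  obtain ⟨x, rfl⟩ := (dual_pi_bijective h n).2 v
  exact ⟨map I p d x, LinearMap.ext fun f ↦ (dual_map _ _ _).trans (hv f)⟩

include hd

theorem dual_bijective [IsNoetherianRing R] [Module.Finite R N] : Function.Bijective (dual I ω d N) := by
  refine ⟨?_, dual_surjective hV h⟩
  obtain ⟨n, p, hp⟩ := Module.Finite.exists_fin' R N
  have hs := (LinearMap.ker p).injective_subtype
  have hex := LinearMap.exact_subtype_ker_map p
  rw [injective_iff_map_eq_zero]
  intro x hx
  have := hd (LinearMap.ker p)
  obtain ⟨y, rfl⟩ := (exact₃ (I := I) hs hex hp d x).1 (Subsingleton.elim _ _)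
  obtain ⟨v, hv⟩ := exists_factor_of_injective hV (LinearMap.lcomp R ω (LinearMap.ker p).subtype)
    (dual I ω d _ y) fun f hf ↦ by
      obtain ⟨g, rfl⟩ := (LinearMap.exact_lcomp_of_exact_of_surjective ω hex hp f).1 hf
      rw [LinearMap.mem_ker, LinearMap.lcomp_apply', ← dual_map, hx]
      rfl
  obtain ⟨z, rfl⟩ := dual_surjective hV h v
  have : y = map I (LinearMap.ker p).subtype d z := by
    apply (dual_pi_bijective h n).1
    ext f
    rw [dual_map, ← hv]
    rfl
  rw [this]
  exact (exact₂ (I := I) hs hex hp d _).2 ⟨z, rfl⟩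
end
end LC

theorem quotient_hom_ext {R : Type} [CommRing R] {J : Ideal R} {P : Type} [AddCommGroup P] [Module R P]
    {f g : (R ⧸ J) →ₗ[R] P} (h : f (Submodule.Quotient.mk 1) = g (Submodule.Quotient.mk 1)) : f = g :=
  Submodule.linearMap_qext _ (LinearMap.ext_ring h)

variable {R : Type} [CommRing R] [IsNoetherianRing R] [IsLocalRing R]
  {ω : Type} [AddCommGroup ω] [Module R ω] {d : ℕ} {rs : List R}

omit [IsNoetherianRing R] in
theorem Good.exists_equiv (h : Good ω d rs) :
    ∃ (θ : EX R (R ⧸ Ideal.ofList rs) R d ≃ₗ[R]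
        (R ⧸ Ideal.ofList rs →ₗ[R] R ⧸ (Ideal.ofList rs • (⊤ : Submodule R R))))
      (θ' : EX R (R ⧸ Ideal.ofList rs) ω d ≃ₗ[R]
        (R ⧸ Ideal.ofList rs →ₗ[R] ω ⧸ (Ideal.ofList rs • (⊤ : Submodule R ω)))),
      ∀ f x, θ' (EX.post _ f d x) =
        Submodule.mapQ _ _ f (Submodule.smul_top_le_comap_smul_top (Ideal.ofList rs) f) ∘ₗ θ x := by
  obtain ⟨θ, hθ⟩ := EX.exists_homEquiv_of_isWeaklyRegular (A := R ⧸ Ideal.ofList rs) fun r hr a ↦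
    Good.smul_quotient (mem_ofList hr) a
  obtain rfl := h.length_eq
  exact ⟨θ R h.regular, θ ω h.regular', fun f x ↦ hθ R ω _ _ f x⟩

variable [Module.Finite R ω] (hc : IsCan R ω (d + 1))
include hc

omit [Module.Finite R ω] in
theorem Good.eq_zero_of_post (h : Good ω (d + 1) rs) {y : EX R (R ⧸ Ideal.ofList rs) R (d + 1)}
    (hy : ∀ f : R →ₗ[R] ω, EX.post _ f (d + 1) y = 0) : y = 0 := by
  obtain ⟨θ, θ', hθ⟩ := h.exists_equiv
  apply θ.injective
  rw [map_zero]
  apply quotient_hom_ext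
  obtain ⟨c, hcy⟩ := Submodule.mkQ_surjective _ (θ y (Submodule.Quotient.mk 1))
  have hcJ : c ∈ Ideal.ofList rs := h.mem_of_smul_eq_zero hc fun p ↦ by
    obtain ⟨w, rfl⟩ := Submodule.mkQ_surjective _ p
    have h1 := LinearMap.congr_fun (hθ (LinearMap.toSpanSingleton R ω w) y) (Submodule.Quotient.mk 1)
    rw [hy, map_zero, LinearMap.comp_apply, ← hcy] at h1
    exact h1.symm
  rw [← hcy, Submodule.mkQ_apply]
  refine (Submodule.Quotient.mk_eq_zero _).2 ?_
  simpa using hcJ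

theorem Good.exists_post_eq (h : Good ω (d + 1) rs)
    (u : (R →ₗ[R] ω) →ₗ[R] EX R (R ⧸ Ideal.ofList rs) ω (d + 1)) :
    ∃ y : EX R (R ⧸ Ideal.ofList rs) R (d + 1), ∀ f, EX.post _ f (d + 1) y = u f := by
  obtain ⟨θ, θ', hθ⟩ := h.exists_equiv
  let u' : ω →ₗ[R] ω ⧸ (Ideal.ofList rs • (⊤ : Submodule R ω)) :=
    LinearMap.applyₗ (Submodule.Quotient.mk 1) ∘ₗ θ'.toLinearMap ∘ₗ u ∘ₗ
      (LinearMap.ringLmapEquivSelf R R ω).symm.toLinearMap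
  have hu' : Ideal.ofList rs • (⊤ : Submodule R ω) ≤ LinearMap.ker u' := by
    rw [Submodule.smul_le]
    intro r hr w _
    rw [LinearMap.mem_ker, map_smul, Good.smul_mkQ ω hr]
  obtain ⟨c, hcu⟩ := h.exists_smul_eq hc (Submodule.liftQ _ u' hu')
  refine ⟨θ.symm (Submodule.liftQ _ (LinearMap.toSpanSingleton R _ (Submodule.Quotient.mk c))
    fun r hr ↦ Good.smul_mkQ R hr _), fun f ↦ ?_⟩
  apply θ'.injective
  apply quotient_hom_ext
  rw [hθ, LinearEquiv.apply_symm_apply]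
  have h1 : (LinearMap.ringLmapEquivSelf R R ω).symm (f 1) = f := by
    ext
    simp
  have h2 : u' (f 1) = c • Submodule.Quotient.mk (f 1) := hcu (Submodule.Quotient.mk (f 1))
  have h3 : u' (f 1) = θ' (u f) (Submodule.Quotient.mk 1) := by
    conv_rhs => rw [← h1]
    rfl
  rw [← h3, h2]
  change Submodule.mapQ _ _ f (Submodule.smul_top_le_comap_smul_top (Ideal.ofList rs) f) ((1 : R) • (Submodule.Quotient.mk c :
    R ⧸ (Ideal.ofList rs • (⊤ : Submodule R R)))) = _
  rw [one_smul, Submodule.mapQ_apply, ← Submodule.Quotient.mk_smul, ← map_smul, smul_eq_mul, mul_one]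

theorem LC.dual_self_bijective
    (hgood : ∀ n, ∃ rs : List R, Good ω (d + 1) rs ∧ Ideal.ofList rs ≤ maximalIdeal R ^ n) :
    Function.Bijective (LC.dual (maximalIdeal R) ω (d + 1) R) := by
  constructor
  · rw [injective_iff_map_eq_zero]
    intro x hx
    obtain ⟨n, y, rfl⟩ := LC.exists_of x
    obtain ⟨rs, hrs, hle⟩ := hgood n
    refine LC.of_eq_zero_of_pre hle hrs.exists_pow_le.choose_spec y
      (hrs.eq_zero_of_post hc fun f ↦ ?_)
    have h1 := LinearMap.congr_fun hx f
    rw [LC.dual_apply, LC.map_of] at h1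
    rw [← EX.pre_post, hc.of_injective n (h1.trans (_root_.map_zero _).symm), _root_.map_zero]
  · intro u
    have hmono : Monotone fun n ↦ LinearMap.range (LC.of (maximalIdeal R) ω (d + 1) n) := by
      rintro m n hmn _ ⟨x, rfl⟩
      exact ⟨_, LC.of_trans hmn x⟩
    obtain ⟨s, t, ht⟩ := Submodule.fg_iff_exists_fin_generating_family.1
      (IsNoetherian.noetherian (⊤ : Submodule R (R →ₗ[R] ω)))
    choose k y hy using fun i ↦ LC.exists_of (u (t i))
    let n := Finset.univ.sup k
    have hn : ∀ f, u f ∈ LinearMap.range (LC.of (maximalIdeal R) ω (d + 1) n) := by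
      suffices (⊤ : Submodule R (R →ₗ[R] ω)) ≤
        (LinearMap.range (LC.of (maximalIdeal R) ω (d + 1) n)).comap u from fun f ↦ this trivial
      rw [← ht, Submodule.span_le]
      rintro _ ⟨i, rfl⟩
      exact hmono (Finset.le_sup (Finset.mem_univ i)) ⟨y i, hy i⟩
    let e := LinearEquiv.ofInjective _ (hc.of_injective n)
    let un : (R →ₗ[R] ω) →ₗ[R] EX R (R ⧸ maximalIdeal R ^ n) ω (d + 1) :=
      e.symm.toLinearMap ∘ₗ u.codRestrict _ hn
    have hun : ∀ f, LC.of (maximalIdeal R) ω (d + 1) n (un f) = u f := fun f ↦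
      congrArg Subtype.val (e.apply_symm_apply ⟨u f, hn f⟩)
    obtain ⟨rs, hrs, hle⟩ := hgood n
    obtain ⟨l, hl⟩ := hrs.exists_pow_le
    obtain ⟨x, hx⟩ := hrs.exists_post_eq hc (EX.pre ω (qmap hle) (d + 1) ∘ₗ un)
    have hl' : maximalIdeal R ^ max l n ≤ Ideal.ofList rs :=
      (Ideal.pow_le_pow_right (le_max_left l n)).trans hl
    refine ⟨LC.of _ R (d + 1) (max l n) (EX.pre R (qmap hl') (d + 1) x), LinearMap.ext fun f ↦ ?_⟩
    rw [LC.dual_apply, LC.map_of, ← EX.pre_post, hx, LinearMap.comp_apply, ← EX.pre_comp, qmap_comp,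
      LC.of_trans (le_max_right l n), hun]

end LocCoh

namespace LocCoh

theorem nonempty_equiv_of_exact {R : Type} [CommRing R] {A X Y A' X' Y' : Type} [AddCommGroup A]
    [Module R A] [AddCommGroup X] [Module R X] [AddCommGroup Y] [Module R Y] [AddCommGroup A']
    [Module R A'] [AddCommGroup X'] [Module R X'] [AddCommGroup Y'] [Module R Y']
    {i : A →ₗ[R] X} {g : X →ₗ[R] Y} {i' : A' →ₗ[R] X'} {g' : X' →ₗ[R] Y'}
    (hi : Function.Injective i) (hig : Function.Exact i g)
    (hi' : Function.Injective i') (hig' : Function.Exact i' g')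
    (φ : X ≃ₗ[R] X') {ψ : Y →ₗ[R] Y'} (hψ : Function.Injective ψ)
    (h : ∀ x, ψ (g x) = g' (φ x)) : Nonempty (A ≃ₗ[R] A') := by
  have h1 : (LinearMap.range i).map φ.toLinearMap = LinearMap.range i' := by
    ext x
    constructor
    · rintro ⟨_, ⟨a, rfl⟩, rfl⟩
      exact (hig' _).1 ((h _).symm.trans (by rw [hig.apply_apply_eq_zero, map_zero]))
    · rintro ⟨a, rfl⟩
      refine ⟨φ.symm (i' a), (hig _).1 (hψ ?_), φ.apply_symm_apply _⟩
      rw [h, LinearEquiv.apply_symm_apply, hig'.apply_apply_eq_zero, map_zero]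
  exact ⟨(LinearEquiv.ofInjective i hi).trans ((φ.submoduleMap _).trans
    ((LinearEquiv.ofEq _ _ h1).trans (LinearEquiv.ofInjective i' hi').symm))⟩

theorem exact_rangeRestrict {R : Type} [CommRing R] {A B C : Type} [AddCommGroup A]
    [Module R A] [AddCommGroup B] [Module R B] [AddCommGroup C] [Module R C]
    {f : A →ₗ[R] B} {g : B →ₗ[R] C} (h : Function.Exact f g) : Function.Exact f g.rangeRestrict := by
  intro x
  rw [← h x, Subtype.ext_iff]
  rfl

namespace LC

section
variable {R : Type} [CommRing R] {I : Ideal R}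
  {M N P : Type} [AddCommGroup M] [Module R M] [AddCommGroup N] [Module R N] [AddCommGroup P] [Module R P]
  {f : M →ₗ[R] N} {g : N →ₗ[R] P} (hf : Function.Injective f)
  (hfg : Function.Exact f g) (hg : Function.Surjective g) {i : ℕ}
include hf hfg hg

theorem δ_injective (h : Subsingleton (LC I N i)) : Function.Injective (δ I hf hfg hg i) := by
  rw [injective_iff_map_eq_zero]
  intro x hx
  obtain ⟨y, rfl⟩ := (exact₃ (I := I) hf hfg hg i x).1 hx
  rw [Subsingleton.elim y 0, _root_.map_zero]

theorem nonempty_δ_equiv (h : Subsingleton (LC I N i)) (h' : Subsingleton (LC I N (i + 1))) :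
    Nonempty (LC I P i ≃ₗ[R] LC I M (i + 1)) :=
  ⟨LinearEquiv.ofBijective (δ I hf hfg hg i) ⟨δ_injective hf hfg hg h, fun x ↦
    (exact₁ (I := I) hf hfg hg i x).1 (Subsingleton.elim _ _)⟩⟩

theorem nonempty_map_equiv (h : Subsingleton (LC I P i)) (h' : Subsingleton (LC I P (i + 1))) :
    Nonempty (LC I M (i + 1) ≃ₗ[R] LC I N (i + 1)) := by
  refine ⟨LinearEquiv.ofBijective (map I f (i + 1)) ⟨?_, fun x ↦
    (exact₂ (I := I) hf hfg hg (i + 1) x).1 (Subsingleton.elim _ _)⟩⟩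
  rw [injective_iff_map_eq_zero]
  intro x hx
  obtain ⟨y, rfl⟩ := (exact₁ (I := I) hf hfg hg i x).1 hx
  rw [Subsingleton.elim y 0, _root_.map_zero]

end

section
variable {R : Type} [CommRing R] [IsNoetherianRing R] {I : Ideal R} {ω : Type} [AddCommGroup ω] [Module R ω]

omit [IsNoetherianRing R] in
theorem subsingleton_dual_zero (h : Subsingleton (LC I ω 0)) (M : Type) [AddCommGroup M] [Module R M]
    [Module.Finite R M] : Subsingleton (LC I (M →ₗ[R] ω) 0) := by
  obtain ⟨n, p, hp⟩ := Module.Finite.exists_fin' R M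
  have := subsingleton_pi_dual h n
  exact (map_injective (I := I) (LinearMap.lcomp_injective_of_surjective (N := ω) p hp)).subsingleton

theorem subsingleton_dual_one (h : Subsingleton (LC I ω 0)) (h' : Subsingleton (LC I ω 1))
    (M : Type) [AddCommGroup M] [Module R M] [Module.Finite R M] :
    Subsingleton (LC I (M →ₗ[R] ω) 1) := by
  obtain ⟨n, p, hp⟩ := Module.Finite.exists_fin' R M
  have h1 := subsingleton_pi_dual h' n
  have h2 := subsingleton_dual_zero h (LinearMap.ker p)
  let q := LinearMap.lcomp R ω (LinearMap.ker p).subtype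
  have h3 : Subsingleton (LC I (LinearMap.range q) 0) :=
    (map_injective (I := I) (LinearMap.range q).injective_subtype).subsingleton
  have hex : Function.Exact (LinearMap.lcomp R ω p) q.rangeRestrict :=
    exact_rangeRestrict (LinearMap.exact_lcomp_of_exact_of_surjective ω
      (LinearMap.exact_subtype_ker_map p) hp)
  have key : ∀ x : LC I (M →ₗ[R] ω) 1, x = 0 := fun x ↦ by
    obtain ⟨y, rfl⟩ := (exact₁ (I := I) (LinearMap.lcomp_injective_of_surjective _ hp) hex
      q.surjective_rangeRestrict 0 x).1 (Subsingleton.elim _ _)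
    rw [Subsingleton.elim y 0, _root_.map_zero]
  exact ⟨fun x y ↦ (key x).trans (key y).symm⟩

end
end LC

theorem tors_eq_top_of_isFiniteLength {R : Type} [CommRing R] [IsLocalRing R] {L : Type}
    [AddCommGroup L] [Module R L] (hL : IsFiniteLength R L) : tors (maximalIdeal R) L = ⊤ := by
  suffices ∃ n, ∀ r ∈ maximalIdeal R ^ n, ∀ x : L, r • x = 0 by
    obtain ⟨n, hn⟩ := this
    exact eq_top_iff.2 fun x _ ↦ ⟨n, fun r hr ↦ hn r hr x⟩
  induction hL with
  | of_subsingleton => exact ⟨0, fun r _ x ↦ Subsingleton.elim _ _⟩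
  | @of_simple_quotient M _ _ N _ _ ih =>
    obtain ⟨n, hn⟩ := ih
    obtain ⟨e⟩ := nonempty_equiv_residueField R (M ⧸ N)
    refine ⟨n + 1, fun r hr x ↦ ?_⟩
    rw [pow_succ] at hr
    refine Submodule.mul_induction_on hr (fun a ha b hb ↦ ?_) fun a b ha hb ↦ ?_
    · have h1 : b • x ∈ N := by
        rw [← Submodule.Quotient.mk_eq_zero, Submodule.Quotient.mk_smul]
        apply e.injective
        rw [map_smul, map_zero]
        exact Good.smul_quotient hb _
      rw [mul_smul]
      exact congrArg Subtype.val (hn a ha ⟨b • x, h1⟩)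
    · rw [add_smul, ha, hb, add_zero]

namespace LC
variable {R : Type} [CommRing R] [IsNoetherianRing R] [IsLocalRing R]
  {ω : Type} [AddCommGroup ω] [Module R ω] {D : ℕ}
  {E : Type} [AddCommGroup E] [Module R E] (hE : Module.Injective R E)
  (ι : ResidueField R →ₗ[R] E) (hι : Function.Injective ι)
  (hess : ∀ P : Submodule R E, P ≠ ⊥ → LinearMap.range ι ⊓ P ≠ ⊥)
  (e : LC (maximalIdeal R) ω (D + 1) ≃ₗ[R] E)
  (hdual : ∀ (N : Type) [AddCommGroup N] [Module R N] [Module.Finite R N],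
    Function.Bijective (dual (maximalIdeal R) ω (D + 1) N))
  (hR : ∀ i ≤ D, Subsingleton (LC (maximalIdeal R) R i))
  (hω : ∀ i ≤ D, Subsingleton (LC (maximalIdeal R) ω i))

include e hdual in
/-- Duality one degree below the top. -/
theorem nonempty_equiv_coker {F N : Type} [AddCommGroup F] [Module R F] [Module.Finite R F]
    [AddCommGroup N] [Module R N] [Module.Finite R N] (hF : Subsingleton (LC (maximalIdeal R) F D))
    {p : F →ₗ[R] N} (hp : Function.Surjective p) :
    Nonempty (LC (maximalIdeal R) N D ≃ₗ[R]
      (((LinearMap.ker p →ₗ[R] ω) ⧸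
        LinearMap.range (LinearMap.lcomp R ω (LinearMap.ker p).subtype)) →ₗ[R] E)) := by
  let q := LinearMap.lcomp R ω (LinearMap.ker p).subtype
  have hs := (LinearMap.ker p).injective_subtype
  have hex := LinearMap.exact_subtype_ker_map p
  have hq := (LinearMap.range q).mkQ_surjective
  obtain ⟨e'⟩ := nonempty_equiv_of_exact (δ_injective hs hex hp hF) (exact₁ (I := maximalIdeal R) hs hex hp D)
    (LinearMap.lcomp_injective_of_surjective (N := LC (maximalIdeal R) ω (D + 1)) _ hq)
    (LinearMap.exact_lcomp_of_exact_of_surjective _ (LinearMap.exact_map_mkQ_range q) hq)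
    (LinearEquiv.ofBijective _ (hdual (LinearMap.ker p))) (hdual F).1 fun x ↦ by
      ext f
      rw [dual_map]
      rfl
  exact ⟨e'.trans ((LinearEquiv.refl R _).arrowCongr e)⟩

include hE ι hι hess e hdual hR hω in
theorem nonempty_equiv_dual (s : ℕ) {t : ℕ} (hst : D = t + s) (hsD : s + 2 ≤ D) (N : Type)
    [AddCommGroup N] [Module R N] [Module.Finite R N]
    (hN : ∀ j, t ≤ j → j ≤ D → IsFiniteLength R (LC (maximalIdeal R) N j)) :
    Nonempty (LC (maximalIdeal R) N t ≃ₗ[R] (LC (maximalIdeal R) (N →ₗ[R] ω) (s + 2) →ₗ[R] E)) := by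
  induction s using Nat.strong_induction_on generalizing t N with
  | _ s ih =>
  obtain ⟨n, p, hp⟩ := Module.Finite.exists_fin' R N
  have hF : ∀ i ≤ D, Subsingleton (LC (maximalIdeal R) (Fin n → R) i) := fun i hi ↦
    subsingleton_pi (hR i hi) n
  have hF' : ∀ i ≤ D, Subsingleton (LC (maximalIdeal R) ((Fin n → R) →ₗ[R] ω) i) := fun i hi ↦
    subsingleton_pi_dual (hω i hi) n
  let q := LinearMap.lcomp R ω (LinearMap.ker p).subtype
  have hs := (LinearMap.ker p).injective_subtype
  have hex := LinearMap.exact_subtype_ker_map p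
  have hex' : Function.Exact (LinearMap.lcomp R ω p) q.rangeRestrict :=
    exact_rangeRestrict (LinearMap.exact_lcomp_of_exact_of_surjective ω hex hp)
  have hB := (LinearMap.range q).injective_subtype
  have hBC := LinearMap.exact_subtype_mkQ (LinearMap.range q)
  have hC := (LinearMap.range q).mkQ_surjective
  obtain ⟨e₁⟩ := nonempty_equiv_coker e hdual (hF D le_rfl) hp
  have hCt := tors_eq_top_of_isFiniteLength (isFiniteLength_of_dual hE ι hι hess
    ((hN D (by omega) le_rfl).of_injective e₁.symm.injective))
  obtain ⟨e₂⟩ := nonempty_δ_equiv (I := maximalIdeal R) (LinearMap.lcomp_injective_of_surjective _ hp)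
    hex' q.surjective_rangeRestrict (i := s + 1) (hF' _ (by omega)) (hF' _ (by omega))
  rcases s with - | s
  · obtain rfl : D = t := hst
    obtain ⟨e₃⟩ := nonempty_δ_equiv hB hBC hC
      (subsingleton_dual_zero (hω 0 (by omega)) (LinearMap.ker p))
      (subsingleton_dual_one (hω 0 (by omega)) (hω 1 (by omega)) (LinearMap.ker p))
    exact ⟨e₁.trans ((((evEquiv hCt).symm.trans e₃).trans e₂).arrowCongr (LinearEquiv.refl R E))⟩
  · obtain ⟨e₃⟩ := nonempty_map_equiv hB hBC hC (subsingleton_of_tors s hCt)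
      (subsingleton_of_tors (s + 1) hCt)
    have hδ : ∀ j, j + 1 ≤ D → Nonempty (LC (maximalIdeal R) N j ≃ₗ[R]
        LC (maximalIdeal R) (LinearMap.ker p) (j + 1)) := fun j hj ↦
      nonempty_δ_equiv hs hex hp (hF _ (by omega)) (hF _ hj)
    obtain ⟨e₄⟩ := hδ t (by omega)
    obtain ⟨e₅⟩ := ih s (by omega) (t := t + 1) (by omega) (by omega) (LinearMap.ker p)
      fun j htj hj ↦ by
        obtain ⟨j, rfl⟩ : ∃ i, j = i + 1 := ⟨j - 1, by omega⟩
        obtain ⟨e₆⟩ := hδ j hj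
        exact (hN j (by omega) (by omega)).of_surjective e₆.surjective
    exact ⟨(e₄.trans e₅).trans ((e₃.symm.trans e₂).arrowCongr (LinearEquiv.refl R E))⟩

end LC

end LocCoh

/-- Over a Cohen-Macaulay Noetherian local ring of dimension `d` with
canonical module `ω`, if `N` is a finitely generated generalized Cohen-Macaulay module of
dimension `d` and `N^∨ = Hom_R(N, ω)`, then for `2 ≤ r ≤ d-1`,
`H^{d-r+1}_𝔪(N) ≅ Hom_R(H^r_𝔪(N^∨), E(k))`, where `E(k)` is an injective hull of the residue
field. -/
theorem statement13 (R : Type) [CommRing R] [IsNoetherianRing R] [IsLocalRing R]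
    (d : ℕ) (hR : isCMLocalRing R d)
    (ω : Type) [AddCommGroup ω] [Module R ω] (hω : isCanonicalModule R d ω)
    (N : Type) [AddCommGroup N] [Module R N] [Module.Finite R N]
    (hdimN : mdim R N = (d : ℕ))
    (hgCM : ∀ i : ℕ, i ≠ d → IsFiniteLength R (lcMod R i N))
    (E : Type) [AddCommGroup E] [Module R E] (hE : Module.Injective R E)
    (ι : ResidueField R →ₗ[R] E) (hι : Function.Injective ι)
    (hess : ∀ P : Submodule R E, P ≠ ⊥ → LinearMap.range ι ⊓ P ≠ ⊥) :
    ∀ r : ℕ, 2 ≤ r → r ≤ d - 1 →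
      Nonempty ((lcMod R (d - r + 1) N) ≃ₗ[R] ((lcMod R r (N →ₗ[R] ω)) →ₗ[R] E)) := by
  obtain ⟨hdim, hdepth⟩ := hR
  obtain ⟨hωfin, hωext, ⟨eω⟩⟩ := hω
  intro r hr hrd
  obtain ⟨D, rfl⟩ : ∃ D, d = D + 1 := ⟨d - 1, by omega⟩
  have hREX : ∀ i < D + 1, Subsingleton (LocCoh.EX R (ResidueField R) R i) := fun i hi ↦
    LocCoh.EX.subsingleton_of_extMod _ _ i (by
      by_contra h
      have h1 : rdepth R R ≤ i := sInf_le ⟨i, not_subsingleton_iff_nontrivial.1 h, rfl⟩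
      rw [hdepth, Nat.cast_le] at h1
      omega)
  have hc : LocCoh.IsCan R ω (D + 1) :=
    ⟨fun i hi ↦ LocCoh.EX.subsingleton_of_extMod _ _ i (hωext i hi),
      ⟨(LocCoh.EX.extModEquiv _ _ D).trans eω⟩⟩
  have hgood := LocCoh.exists_good hdim hREX fun i hi ↦ hc.1 i hi.ne
  obtain ⟨e⟩ := hc.nonempty_equiv hE ι hι hess
  have hV : Module.Injective R (LocCoh.LC (maximalIdeal R) ω (D + 1)) :=
    ⟨fun X Y _ _ _ _ f hf g ↦ by
      obtain ⟨h, hh⟩ := hE.out f hf (e.toLinearMap ∘ₗ g)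
      exact ⟨e.symm.toLinearMap ∘ₗ h, fun x ↦ e.injective (by simpa using hh x)⟩⟩
  have hdual := LocCoh.LC.dual_self_bijective hc hgood
  obtain ⟨e'⟩ := LocCoh.LC.nonempty_equiv_dual hE ι hι hess e
    (fun N _ _ _ ↦ LocCoh.LC.dual_bijective
      (fun N _ _ ↦ LocCoh.LC.subsingleton_of_good hgood N (Nat.lt_succ_self _)) hV hdual)
    (fun i hi ↦ LocCoh.LC.subsingleton_of_residueField (hREX i (by omega)))
    (fun i hi ↦ LocCoh.LC.subsingleton_of_residueField (hc.1 i (by omega)))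
    (r - 2) (t := D - r + 2) (by omega) (by omega) N fun j hj hjD ↦ by
      obtain ⟨j, rfl⟩ : ∃ i, j = i + 1 := ⟨j - 1, by omega⟩
      exact (hgCM (j + 1) (by omega)).of_surjective
        (LocCoh.lcEquiv (maximalIdeal R) N j).symm.surjective
  obtain ⟨s, rfl⟩ : ∃ s, r = s + 2 := ⟨r - 2, by omega⟩
  have h1 : D + 1 - (s + 2) + 1 = D - (s + 2) + 1 + 1 := by omega
  rw [h1]
  exact ⟨((LocCoh.lcEquiv (maximalIdeal R) N _).symm.trans e').trans
    ((LocCoh.lcEquiv (maximalIdeal R) (N →ₗ[R] ω) _).arrowCongr (LinearEquiv.refl R E))⟩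
end

section
/- Let (R, 𝔪, k) be a Cohen-Macaulay Noetherian local ring with a canonical module ω_R, and let M be a finitely generated R-module with Tor_i^R(M, ω_R) = 0 for all i > 0. Then Ext^i_R(M, R) ≅ Ext^i_R(M ⊗_R ω_R, ω_R) for all i ≥ 0. -/
open CategoryTheory Opposite IsLocalRing

universe u v w t

namespace CategoryTheory.ProjectiveResolution

variable {C : Type u} [Category.{v} C] [Abelian C] [HasExt.{w} C] {X Y : C}
  (P : ProjectiveResolution X)

lemma extMk_zero_eq_zero_iff (f : P.complex.X 0 ⟶ Y) (hf : P.complex.d 1 0 ≫ f = 0) :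
    P.extMk f 1 rfl hf = 0 ↔ f = 0 := by
  refine ⟨fun h ↦ ?_, fun h ↦ by simp [h]⟩
  rw [← P.extEquivCohomologyClass.apply_eq_iff_eq, extEquivCohomologyClass_extMk,
    extEquivCohomologyClass_zero, CochainComplex.HomComplex.CohomologyClass.mk_eq_zero_iff,
    CochainComplex.HomComplex.Cocycle.toSingleMk_mem_coboundaries_iff _ _ _ _ _ 1 (by lia)] at h
  obtain ⟨g, hg⟩ := h
  have hz : Limits.IsZero (P.cochainComplex.X 1) :=
    CochainComplex.isZero_of_isStrictlyLE _ 0 1 (by lia)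
  rw [hz.eq_zero_of_src g, Limits.comp_zero] at hg
  rw [← cancel_epi (P.cochainComplexXIso (-(0 : ℕ)) 0 rfl).hom, ← hg, Limits.comp_zero]

variable {R : Type t} [Ring R] [Linear R C]

lemma smul_extMk {n : ℕ} (r : R) (f : P.complex.X n ⟶ Y) (m : ℕ) (hm : n + 1 = m)
    (hf : P.complex.d m n ≫ f = 0) :
    r • P.extMk f m hm hf = P.extMk (r • f) m hm (by simp [hf]) := by
  rw [Abelian.Ext.smul_eq_comp_mk₀, extMk_comp_mk₀]
  simp

variable (R Y) in
/-- The map sending a cocycle of `Hom(P, Y)` to its class in `Ext X Y n`. -/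
noncomputable def cocycleToExt (n : ℕ) :
    LinearMap.ker (Linear.leftComp R Y (P.complex.d (n + 1) n)) →ₗ[R] Abelian.Ext X Y n where
  toFun f := P.extMk f.1 (n + 1) rfl f.2
  map_add' _ _ := (P.add_extMk _ _ _ _ _ _).symm
  map_smul' _ _ := (P.smul_extMk _ _ _ _ _).symm

lemma cocycleToExt_surjective (n : ℕ) : Function.Surjective (P.cocycleToExt Y R n) := by
  intro α
  obtain ⟨f, hf, rfl⟩ := P.extMk_surjective α (n + 1) rfl
  exact ⟨⟨f, hf⟩, rfl⟩

end CategoryTheory.ProjectiveResolution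

section

variable {C : Type u} [Category.{v} C] [Abelian C] [HasExt.{w} C]
  [EnoughProjectives C] {R : Type v} [Ring R] [Linear R C]

/-- The derived functor `Ext R C n` agrees with the `Ext`-groups of the derived category. -/
lemma nonempty_ext_linearEquiv (X Y : C) (n : ℕ) :
    Nonempty (((Ext R C n).obj (op X)).obj Y ≃ₗ[R] Abelian.Ext.{w} X Y n) := by
  let P := projectiveResolution X
  let K := P.complex.linearYonedaObj R Y
  obtain ⟨j, hj⟩ : ∃ j, (ComplexShape.up ℕ).prev n = j := ⟨_, rfl⟩
  let S := K.sc' j n (n + 1)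
  let e : K.homology n ≅ S.homology :=
    ShortComplex.homologyMapIso (K.isoSc' _ n (n + 1) hj (CochainComplex.next ℕ n))
  let φ : LinearMap.ker S.g.hom →ₗ[R] Abelian.Ext.{w} X Y n := P.cocycleToExt Y R n
  have hφ : Function.Surjective φ := P.cocycleToExt_surjective n
  have hrange : LinearMap.range S.moduleCatToCycles = LinearMap.ker φ := by
    ext ⟨f, hf⟩
    rw [LinearMap.mem_ker]
    cases n with
    | zero =>
      have hS : S.f = 0 := K.shape _ _ (by simp)
      refine Iff.trans ?_ (P.extMk_zero_eq_zero_iff f hf).symm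
      constructor
      · rintro ⟨g, hg⟩
        exact (congrArg Subtype.val hg).symm.trans (congrArg (fun t ↦ t.hom g) hS)
      · intro h
        exact ⟨0, (map_zero _).trans (Subtype.ext h.symm)⟩
    | succ p =>
      have hpj : j + 1 = p + 1 := by rw [← hj, CochainComplex.prev_nat_succ]
      refine Iff.trans ?_ (P.extMk_eq_zero_iff f _ rfl hf j hpj).symm
      exact ⟨fun h ↦ h.imp fun g hg ↦ congrArg Subtype.val hg,
        fun h ↦ h.imp fun g hg ↦ Subtype.ext hg⟩
  exact ⟨((P.isoExt n Y) ≪≫ e ≪≫ S.moduleCatHomologyIso).toLinearEquiv ≪≫ₗ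
    Submodule.quotEquivOfEq _ _ hrange ≪≫ₗ φ.quotKerEquivOfSurjective hφ⟩

end

open CategoryTheory.Abelian RingTheory.Sequence

namespace CategoryTheory

section

variable {C : Type u} [Category.{v} C] [Abelian C] [HasExt.{w} C] {R : Type t} [CommRing R]
  [Linear R C]

variable (R) in
/-- The isomorphism on `Ext` induced by an isomorphism in the first variable. -/
noncomputable def Abelian.Ext.linearEquivOfIso {X X' : C} (e : X ≅ X') (Y : C) (n : ℕ) :
    Ext X' Y n ≃ₗ[R] Ext X Y n :=
  LinearEquiv.ofLinearMap ((Ext.mk₀ e.hom).precompOfLinear R Y (zero_add n))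
    ((Ext.mk₀ e.inv).precompOfLinear R Y (zero_add n))
    (by ext; simp) (by ext; simp)

variable {S : ShortComplex C} (hS : S.ShortExact) (Y : C) (n : ℕ)

variable (R) in
include hS in
lemma ShortComplex.ShortExact.nonempty_ext_quotient_linearEquiv
    [Subsingleton (Ext S.X₂ Y (n + 1))] :
    Nonempty ((Ext S.X₁ Y n ⧸
      LinearMap.range ((Ext.mk₀ S.f).precompOfLinear R Y (zero_add n))) ≃ₗ[R]
      Ext S.X₃ Y (n + 1)) := by
  let δ : Ext S.X₁ Y n →ₗ[R] Ext S.X₃ Y (n + 1) := hS.extClass.precompOfLinear R Y (add_comm 1 n)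
  have hδ : Function.Surjective δ := fun x ↦
    Ext.contravariant_sequence_exact₃ hS Y x (Subsingleton.elim _ _) (add_comm 1 n)
  have hker : LinearMap.range ((Ext.mk₀ S.f).precompOfLinear R Y (zero_add n)) =
      LinearMap.ker δ := by
    ext x
    constructor
    · rintro ⟨y, rfl⟩
      exact hS.extClass_comp_assoc y (h := add_comm 1 n)
    · intro hx
      exact Ext.contravariant_sequence_exact₁ hS Y x (add_comm 1 n) hx
  exact ⟨Submodule.quotEquivOfEq _ _ hker ≪≫ₗ δ.quotKerEquivOfSurjective hδ⟩

end

end CategoryTheory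

section

variable {R : Type u} [CommRing R]

/-- A linear equivalence induces one on the quotients by the multiples of an ideal. -/
noncomputable def LinearEquiv.quotSMulTop {M N : Type*} [AddCommGroup M] [Module R M]
    [AddCommGroup N] [Module R N] (e : M ≃ₗ[R] N) (I : Ideal R) :
    (M ⧸ (I • ⊤ : Submodule R M)) ≃ₗ[R] N ⧸ (I • ⊤ : Submodule R N) :=
  Submodule.Quotient.equiv _ _ e (by simp [Submodule.map_smul''])

lemma ModuleCat.smulShortComplex_precomp [Small.{v} R] (N ω : ModuleCat.{v} R) (x : R) (n : ℕ)
    (a : Ext N ω n) :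
    (Ext.mk₀ (N.smulShortComplex x).f).comp a (zero_add n) = x • a := by
  change (Ext.mk₀ (x • 𝟙 N)).comp a (zero_add n) = x • a
  rw [Ext.mk₀_smul, Ext.smul_comp, Ext.mk₀_id_comp]

variable [IsNoetherianRing R] [IsLocalRing R]

open scoped Pointwise in
lemma ext_of_isWeaklyRegular [Small.{v} R] (ω : ModuleCat.{v} R) [Module.Finite R ω] (xs : List R)
    (hxs : ∀ x ∈ xs, x ∈ maximalIdeal R) (s : ℕ) (N : ModuleCat.{v} R) [Module.Finite R N]
    (hreg : IsWeaklyRegular N xs)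
    (h : ∀ i ≠ s + xs.length,
      Subsingleton (Ext (ModuleCat.of R (N ⧸ (Ideal.ofList xs • ⊤ : Submodule R N))) ω i)) :
    (∀ i ≠ s, Subsingleton (Ext N ω i)) ∧ IsWeaklyRegular (Ext N ω s) xs ∧
      Nonempty ((Ext N ω s ⧸ (Ideal.ofList xs • ⊤ : Submodule R (Ext N ω s))) ≃ₗ[R]
        Ext (ModuleCat.of R (N ⧸ (Ideal.ofList xs • ⊤ : Submodule R N))) ω (s + xs.length)) := by
  induction xs generalizing s N with
  | nil =>
    let e : (N ⧸ (Ideal.ofList ([] : List R) • ⊤ : Submodule R N)) ≃ₗ[R] N :=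
      Submodule.quotEquivOfEqBot _ (by simp)
    have e' := Ext.linearEquivOfIso R e.toModuleIso ω
    refine ⟨fun i hi ↦ ?_, .nil R _, ⟨Submodule.quotEquivOfEqBot _ (by simp) ≪≫ₗ e' s⟩⟩
    have := h i (by simpa using hi)
    exact (e' i).toEquiv.subsingleton
  | cons x rs ih =>
    obtain ⟨hx, hrs⟩ := (isWeaklyRegular_cons_iff _ _ _).1 hreg
    have hS := IsSMulRegular.smulShortComplex_shortExact hx
    let e := Submodule.quotOfListConsSMulTopEquivQuotSMulTopInner N x rs
    let e' := Ext.linearEquivOfIso R e.toModuleIso ω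
    have hlen : s + 1 + rs.length = s + (x :: rs).length := by
      rw [List.length_cons]; lia
    obtain ⟨h₁, h₂, ⟨h₃⟩⟩ := ih (fun y hy ↦ hxs y (.tail _ hy)) (s + 1)
      (ModuleCat.of R (QuotSMulTop x N)) hrs (fun i hi ↦ by
        have := h i (by lia)
        exact (e' i).toEquiv.subsingleton)
    have hvan : ∀ i ≠ s, Subsingleton (Ext N ω i) := by
      intro i hi
      have hsub : Subsingleton (Ext (ModuleCat.of R (QuotSMulTop x N)) ω (1 + i)) :=
        h₁ _ (by lia)
      have htop : (⊤ : Submodule R (Ext N ω i)) ≤ maximalIdeal R • ⊤ := by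
        intro a _
        obtain ⟨b, rfl⟩ := Ext.contravariant_sequence_exact₁ hS ω a rfl (hsub.elim _ _)
        erw [ModuleCat.smulShortComplex_precomp]
        exact Submodule.smul_mem_smul (hxs x (.head _)) trivial
      have := Submodule.eq_bot_of_le_smul_of_le_jacobson_bot _ _ (Module.Finite.fg_top) htop
        (IsLocalRing.maximalIdeal_le_jacobson _)
      exact (Submodule.subsingleton_iff R).1 (subsingleton_of_bot_eq_top this.symm)
    have hsub : Subsingleton (Ext (N.smulShortComplex x).X₂ ω (s + 1)) := hvan _ (by lia)
    let mulx : Ext N ω s →ₗ[R] Ext N ω s :=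
      (Ext.mk₀ (N.smulShortComplex x).f).precompOfLinear R ω (zero_add s)
    have hmulx : LinearMap.range mulx = x • (⊤ : Submodule R (Ext N ω s)) := by
      ext a
      rw [Submodule.mem_smul_pointwise_iff_exists]
      exact exists_congr fun b ↦ (by rw [← N.smulShortComplex_precomp ω x s b]; simp; rfl)
    obtain ⟨e₁⟩ : Nonempty ((Ext N ω s ⧸ LinearMap.range mulx) ≃ₗ[R]
      Ext (ModuleCat.of R (QuotSMulTop x N)) ω (s + 1)) :=
        hS.nonempty_ext_quotient_linearEquiv R ω s
    have e₂ : QuotSMulTop x (Ext N ω s) ≃ₗ[R] Ext (ModuleCat.of R (QuotSMulTop x N)) ω (s + 1) :=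
      Submodule.quotEquivOfEq _ _ hmulx.symm ≪≫ₗ e₁
    refine ⟨hvan, (isWeaklyRegular_cons_iff _ _ _).2 ⟨?_, (e₂.isWeaklyRegular_congr rs).2 h₂⟩,
      ⟨Submodule.quotOfListConsSMulTopEquivQuotSMulTopInner _ x rs ≪≫ₗ e₂.quotSMulTop _ ≪≫ₗ
        h₃ ≪≫ₗ (hlen ▸ e' (s + 1 + rs.length))⟩⟩
    · refine isSMulRegular_iff_right_eq_zero_of_smul.2 fun a ha ↦ ?_
      obtain ⟨b, rfl⟩ := Ext.contravariant_sequence_exact₂ hS ω (n := s) a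
        ((ModuleCat.smulShortComplex_precomp N ω x s a).trans ha)
      have hsub : Subsingleton (Ext (N.smulShortComplex x).X₃ ω s) := h₁ _ (by lia)
      rw [hsub.elim b 0, Ext.comp_zero]
      rfl

end

lemma CategoryTheory.Abelian.Ext.subsingleton_of_isZero {C : Type u} [Category.{v} C] [Abelian C]
    [HasExt.{w} C] {X : C} (hX : Limits.IsZero X) (Y : C) (n : ℕ) : Subsingleton (Ext X Y n) :=
  subsingleton_of_forall_eq 0 fun α ↦ by
    rw [← α.mk₀_id_comp, hX.eq_of_src (𝟙 X) 0, Ext.mk₀_zero, Ext.zero_comp]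

section

variable {C : Type u} [Category.{v} C] [Abelian C] [HasExt.{w} C] {S : ShortComplex C}
  (hS : S.ShortExact) (Y : C) (n : ℕ)

include hS

namespace CategoryTheory.ShortComplex.ShortExact

lemma subsingleton_ext_X₂ [h₁ : Subsingleton (Ext S.X₁ Y n)] [h₃ : Subsingleton (Ext S.X₃ Y n)] :
    Subsingleton (Ext S.X₂ Y n) := by
  refine subsingleton_of_forall_eq 0 fun a ↦ ?_
  obtain ⟨b, rfl⟩ := Ext.contravariant_sequence_exact₂ hS Y a (h₁.elim _ _)
  rw [h₃.elim b 0, Ext.comp_zero]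

lemma precomp_f_surjective [h₃ : Subsingleton (Ext S.X₃ Y (n + 1))] :
    Function.Surjective ((Ext.mk₀ S.f).precomp Y (zero_add n)) := fun a ↦
  Ext.contravariant_sequence_exact₁ hS Y a (add_comm 1 n) (h₃.elim _ _)

lemma precomp_g_injective (h₁ : ∀ m, m + 1 = n → Subsingleton (Ext S.X₁ Y m)) :
    Function.Injective ((Ext.mk₀ S.g).precomp Y (zero_add n)) := by
  cases n with
  | zero =>
    have := hS.epi_g
    exact Ext.precomp_mk₀_injective_of_epi Y S.g
  | succ m =>
    refine (injective_iff_map_eq_zero _).2 fun a ha ↦ ?_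
    obtain ⟨b, rfl⟩ := Ext.contravariant_sequence_exact₃ hS Y a ha (add_comm 1 m)
    rw [(h₁ m rfl).elim b 0, Ext.comp_zero]

lemma precomp_exact :
    Function.Exact ((Ext.mk₀ S.g).precomp Y (zero_add n))
      ((Ext.mk₀ S.f).precomp Y (zero_add n)) := fun a ↦ by
  refine ⟨fun ha ↦ Ext.contravariant_sequence_exact₂ hS Y a ha, ?_⟩
  rintro ⟨b, rfl⟩
  simp

end CategoryTheory.ShortComplex.ShortExact

end

section

variable {R : Type u} [CommRing R] {M N : Type u} [AddCommGroup M] [Module R M]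
    [AddCommGroup N] [Module R N]

/-- The short complex `P ⟶ M ⟶ M ⧸ P` attached to a submodule `P` of `M`. -/
abbrev Submodule.shortComplex (P : Submodule R M) : ShortComplex (ModuleCat.{u} R) :=
  ModuleCat.shortComplexOfCompEqZero P.subtype P.mkQ
    (LinearMap.exact_subtype_mkQ P).linearMap_comp_eq_zero

lemma Submodule.shortComplex_shortExact (P : Submodule R M) : P.shortComplex.ShortExact :=
  ModuleCat.shortComplex_shortExact _ (LinearMap.exact_subtype_mkQ P) P.injective_subtype
    P.mkQ_surjective

end

section

variable {R : Type u} [CommRing R] [IsLocalRing R] {ω : ModuleCat.{u} R} {d : ℕ}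
  (hvan : ∀ i ≠ d, Subsingleton (Ext (ModuleCat.of R (ResidueField R)) ω i))

lemma IsLocalRing.nonempty_linearEquiv_residueField (N : Type u) [AddCommGroup N] [Module R N]
    [IsSimpleModule R N] : Nonempty (N ≃ₗ[R] ResidueField R) := by
  obtain ⟨I, hI, ⟨e⟩⟩ := isSimpleModule_iff_quot_maximal.1 ‹IsSimpleModule R N›
  obtain rfl := IsLocalRing.eq_maximalIdeal hI
  exact ⟨e⟩

include hvan

lemma IsFiniteLength.subsingleton_ext {N : Type u} [AddCommGroup N] [Module R N]
    (hN : IsFiniteLength R N) {i : ℕ} (hi : i ≠ d) : Subsingleton (Ext (ModuleCat.of R N) ω i) := by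
  induction hN with
  | of_subsingleton =>
    exact Ext.subsingleton_of_isZero (ModuleCat.isZero_of_subsingleton _) ω i
  | @of_simple_quotient N _ _ P _ hP ih =>
    obtain ⟨e⟩ := IsLocalRing.nonempty_linearEquiv_residueField (R := R) (N ⧸ P)
    have := hvan i hi
    have : Subsingleton (Ext (ModuleCat.of R (N ⧸ P)) ω i) :=
      (Ext.linearEquivOfIso R e.toModuleIso ω i).symm.toEquiv.subsingleton
    exact P.shortComplex_shortExact.subsingleton_ext_X₂ ω i

/-- `Ext^d(-, ω)` is exact on modules of finite length. -/
lemma IsFiniteLength.ext_exact {N : Type u} [AddCommGroup N] [Module R N]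
    (hN : IsFiniteLength R N) (P : Submodule R N) :
    Function.Injective ((Ext.mk₀ P.shortComplex.g).precomp ω (zero_add d)) ∧
      Function.Surjective ((Ext.mk₀ P.shortComplex.f).precomp ω (zero_add d)) := by
  have : Subsingleton (Ext (ModuleCat.of R (N ⧸ P)) ω (d + 1)) :=
    (hN.of_surjective P.mkQ_surjective).subsingleton_ext hvan (by lia)
  exact ⟨P.shortComplex_shortExact.precomp_g_injective ω d fun m hm ↦
    (hN.of_injective P.injective_subtype).subsingleton_ext hvan (by lia),
    P.shortComplex_shortExact.precomp_f_surjective ω d⟩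

lemma IsFiniteLength.length_ext (e : Ext (ModuleCat.of R (ResidueField R)) ω d ≃ₗ[R] ResidueField R)
    {N : Type u} [AddCommGroup N] [Module R N]
    (hN : IsFiniteLength R N) :
    Module.length R (Ext (ModuleCat.of R N) ω d) = Module.length R N := by
  induction hN with
  | @of_subsingleton N =>
    have := Ext.subsingleton_of_isZero (ModuleCat.isZero_of_subsingleton (ModuleCat.of R N)) ω d
    exact (Module.length_eq_zero_iff.2 this).trans (Module.length_eq_zero_iff.2 ‹_›).symm
  | @of_simple_quotient N _ _ P _ hP ih =>
    obtain ⟨e'⟩ := IsLocalRing.nonempty_linearEquiv_residueField (R := R) (N ⧸ P)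
    obtain ⟨h₁, h₂⟩ := (IsFiniteLength.of_simple_quotient hP).ext_exact hvan P
    rw [Module.length_eq_add_of_exact _ _ P.injective_subtype P.mkQ_surjective
        (LinearMap.exact_subtype_mkQ P),
      Module.length_eq_add_of_exact ((Ext.mk₀ P.shortComplex.g).precompOfLinear R ω (zero_add d))
        ((Ext.mk₀ P.shortComplex.f).precompOfLinear R ω (zero_add d)) h₁ h₂
        (P.shortComplex_shortExact.precomp_exact ω d), add_comm, e'.length_eq]
    exact congrArg₂ _ ih ((Ext.linearEquivOfIso R e'.toModuleIso ω d).symm.trans e).length_eq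

lemma IsFiniteLength.smul_eq_zero_of_ext
    (e : Ext (ModuleCat.of R (ResidueField R)) ω d ≃ₗ[R] ResidueField R)
    {N : Type u} [AddCommGroup N] [Module R N] (hN : IsFiniteLength R N) (a : R)
    (ha : ∀ α : Ext (ModuleCat.of R N) ω d, a • α = 0) (y : N) : a • y = 0 := by
  let f : N →ₗ[R] N := LinearMap.lsmul R N a
  let P := LinearMap.range f
  suffices Subsingleton P from congrArg Subtype.val (Subsingleton.elim ⟨a • y, y, rfl⟩ (0 : P))
  have hP : IsFiniteLength R P := hN.of_injective P.injective_subtype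
  rw [← Module.length_eq_zero_iff (R := R), ← hP.length_ext hvan e, Module.length_eq_zero_iff]
  refine subsingleton_of_forall_eq 0 fun α ↦ ?_
  obtain ⟨β, rfl⟩ := (hN.ext_exact hvan P).2 α
  let π : ModuleCat.of R N ⟶ ModuleCat.of R P := ModuleCat.ofHom f.rangeRestrict
  have hπ : Function.Injective ((Ext.mk₀ π).precomp ω (zero_add d)) := by
    have hS : (ModuleCat.shortComplexOfCompEqZero (LinearMap.ker f).subtype f.rangeRestrict
        (LinearMap.ext fun y ↦ Subtype.ext y.2)).ShortExact :=
      ModuleCat.shortComplex_shortExact _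
        (LinearMap.exact_iff.2 ((f.ker_rangeRestrict).trans (Submodule.range_subtype _).symm))
        (Submodule.injective_subtype _) f.surjective_rangeRestrict
    exact hS.precomp_g_injective ω d fun m hm ↦
      (hN.of_injective (LinearMap.ker f).injective_subtype).subsingleton_ext hvan (by lia)
  apply hπ
  have hfac : π ≫ P.shortComplex.f = a • 𝟙 (ModuleCat.of R N) := rfl
  rw [map_zero, ← ha β]
  change (Ext.mk₀ π).comp ((Ext.mk₀ P.shortComplex.f).comp β (zero_add d)) (zero_add d) = _
  rw [Ext.mk₀_comp_mk₀_assoc, hfac, Ext.mk₀_smul, Ext.smul_comp, Ext.mk₀_id_comp]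

end

section

variable {R : Type u} [CommRing R] {A B : Type*} [AddCommGroup A] [Module R A] [AddCommGroup B]
  [Module R B]

lemma QuotSMulTop.mk_mem_ofList_smul_top_iff (x : R) (rs : List R) (a : A) :
    (Submodule.Quotient.mk a : QuotSMulTop x A) ∈ (Ideal.ofList rs • ⊤ : Submodule R _) ↔
      a ∈ (Ideal.ofList (x :: rs) • ⊤ : Submodule R A) := by
  rw [Ideal.ofList_cons, Submodule.sup_smul, Submodule.ideal_span_singleton_smul,
    ← Submodule.comap_map_mkQ, Submodule.map_smul'', Submodule.map_top, Submodule.range_mkQ]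
  rfl

lemma LinearMap.injective_of_comap_smul_top_le [IsNoetherianRing R] [IsLocalRing R]
    [Module.Finite R A] (f : A →ₗ[R] B) (xs : List R) (hxs : ∀ x ∈ xs, x ∈ maximalIdeal R)
    (hreg : IsWeaklyRegular B xs)
    (h : (Ideal.ofList xs • ⊤ : Submodule R B).comap f ≤ Ideal.ofList xs • ⊤) :
    Function.Injective f := by
  rw [← LinearMap.ker_eq_bot]
  induction xs generalizing A B with
  | nil => simpa using h
  | cons x rs ih =>
    obtain ⟨hx, hrs⟩ := (isWeaklyRegular_cons_iff _ _ _).1 hreg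
    have hinj := ih (QuotSMulTop.map x f) (fun y hy ↦ hxs y (.tail _ hy)) hrs (by
      intro a
      induction a using Submodule.Quotient.induction_on with | _ a =>
      rw [Submodule.mem_comap, QuotSMulTop.map_apply_mk, QuotSMulTop.mk_mem_ofList_smul_top_iff,
        QuotSMulTop.mk_mem_ofList_smul_top_iff]
      exact @h a)
    refine Submodule.eq_bot_of_le_smul_of_le_jacobson_bot (maximalIdeal R) _
      (IsNoetherian.noetherian _) ?_ (IsLocalRing.maximalIdeal_le_jacobson _)
    intro a ha
    have ha' : (Submodule.Quotient.mk a : QuotSMulTop x A) = 0 := by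
      rw [← Submodule.mem_bot R, ← hinj, LinearMap.mem_ker, QuotSMulTop.map_apply_mk, ha]
      rfl
    obtain ⟨b, -, rfl⟩ := (Submodule.mem_smul_pointwise_iff_exists _ _ _).1
      ((Submodule.Quotient.mk_eq_zero _).1 ha')
    refine Submodule.smul_mem_smul (hxs x (.head _)) ?_
    rw [LinearMap.mem_ker, map_smul] at ha
    exact isSMulRegular_iff_right_eq_zero_of_smul.1 hx _ ha

end

section

variable {R : Type u} [CommRing R] [IsNoetherianRing R] [IsLocalRing R]

/-- A local ring of depth at least its dimension has a regular sequence such that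
quotients by it have finite length. -/
lemma exists_isRegular_isFiniteLength {d : ℕ} (hd : ringKrullDim R = d)
    (hdepth : ∀ i < d, Subsingleton (Ext (ModuleCat.of R (ResidueField R)) (ModuleCat.of R R) i)) :
    ∃ xs : List R, xs.length = d ∧ (∀ x ∈ xs, x ∈ maximalIdeal R) ∧ IsRegular R xs ∧
      IsFiniteLength R (R ⧸ (Ideal.ofList xs • ⊤ : Submodule R R)) := by
  obtain ⟨xs, hlen, hxs, hreg⟩ := ModuleCat.exists_isRegular_of_exists_subsingleton_ext
    (maximalIdeal R) d (ModuleCat.of R R) (by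
      simpa [lt_top_iff_ne_top] using (maximalIdeal.isMaximal R).ne_top)
    (ModuleCat.of R (ResidueField R))
    (by
      rw [Module.support_eq_zeroLocus]
      exact congrArg (fun I : Ideal R ↦ PrimeSpectrum.zeroLocus (I : Set R))
        Ideal.annihilator_quotient) hdepth
  refine ⟨xs, hlen, hxs, hreg, ?_⟩
  have hI : (Ideal.ofList xs • ⊤ : Submodule R R) = Ideal.ofList xs := by simp
  have hdim := ringKrullDim_add_length_eq_ringKrullDim_of_isRegular xs hreg
  have : Ring.KrullDimLE 0 (R ⧸ Ideal.ofList xs) := by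
    rw [Ring.krullDimLE_iff]
    rw [hlen, hd] at hdim
    rw [← ENat.WithBot.add_le_add_natCast_right_iff, hdim]
    simp
  have : IsArtinianRing (R ⧸ Ideal.ofList xs) := isArtinianRing_iff_krullDimLE_zero.2 this
  have : IsArtinian R (R ⧸ Ideal.ofList xs) :=
    isArtinian_of_surjective_algebraMap (R := R ⧸ Ideal.ofList xs) Ideal.Quotient.mk_surjective
  rw [hI, isFiniteLength_iff_isNoetherian_isArtinian]
  exact ⟨inferInstance, this⟩

lemma canonical_ext_self {d : ℕ} (hd : ringKrullDim R = d)
    (hdepth : ∀ i < d, Subsingleton (Ext (ModuleCat.of R (ResidueField R)) (ModuleCat.of R R) i))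
    (ω : ModuleCat.{u} R) [Module.Finite R ω]
    (hvan : ∀ i ≠ d, Subsingleton (Ext (ModuleCat.of R (ResidueField R)) ω i))
    (e : Ext (ModuleCat.of R (ResidueField R)) ω d ≃ₗ[R] ResidueField R) :
    (∀ i ≠ 0, Subsingleton (Ext ω ω i)) ∧ Function.Bijective (LinearMap.lsmul R ω) := by
  obtain ⟨xs, rfl, hxs, hreg, hfin⟩ := exists_isRegular_isFiniteLength hd hdepth
  set I := Ideal.ofList xs with hI
  obtain ⟨-, hω, ⟨e₁⟩⟩ := ext_of_isWeaklyRegular ω xs hxs 0 (ModuleCat.of R R)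
    hreg.toIsWeaklyRegular fun i hi ↦ hfin.subsingleton_ext hvan (by lia)
  rw [zero_add, ← hI] at e₁
  have eω : Ext (ModuleCat.of R R) ω 0 ≃ₗ[R] ω := Ext.linearEquiv₀ ≪≫ₗ
    ModuleCat.homLinearEquiv ≪≫ₗ LinearMap.ringLmapEquivSelf R R ω
  rw [eω.isWeaklyRegular_congr] at hω
  have e₁ := (eω.quotSMulTop I).symm ≪≫ₗ e₁
  have hlenω := e₁.length_eq.trans (hfin.length_ext hvan e)
  have hfinω : IsFiniteLength R (ω ⧸ (I • ⊤ : Submodule R ω)) := by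
    rwa [← Module.length_ne_top_iff, hlenω, Module.length_ne_top_iff]
  obtain ⟨hzero, hE, ⟨e₂⟩⟩ := ext_of_isWeaklyRegular ω xs hxs 0 ω hω
    fun i hi ↦ hfinω.subsingleton_ext hvan (by lia)
  refine ⟨hzero, ?_⟩
  rw [zero_add, ← hI] at e₂
  have eE : Ext ω ω 0 ≃ₗ[R] (ω →ₗ[R] ω) := Ext.linearEquiv₀ ≪≫ₗ ModuleCat.homLinearEquiv
  rw [eE.isWeaklyRegular_congr] at hE
  have hlenE := ((eE.quotSMulTop I).symm ≪≫ₗ e₂).length_eq.trans (hfinω.length_ext hvan e)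
  rw [hlenω] at hlenE
  have hcomap : (I • ⊤ : Submodule R (ω →ₗ[R] ω)).comap (LinearMap.lsmul R ω) ≤ I • ⊤ := by
    intro a ha
    have hkill (y : ω ⧸ (I • ⊤ : Submodule R ω)) : a • y = 0 := by
      induction y using Submodule.Quotient.induction_on with | _ y =>
      have hy := Submodule.mem_map_of_mem (f := LinearMap.applyₗ (R := R) (M₂ := ω) y)
        (Submodule.mem_comap.1 ha)
      rw [Submodule.map_smul''] at hy
      rw [← Submodule.Quotient.mk_smul, Submodule.Quotient.mk_eq_zero]
      exact (smul_mono_right _ le_top : _ ≤ (I • ⊤ : Submodule R ω)) hy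
    have := hfin.smul_eq_zero_of_ext hvan e a
      (fun α ↦ e₁.symm.injective (by rw [map_smul, hkill, map_zero])) (Submodule.Quotient.mk 1)
    rw [← Submodule.Quotient.mk_smul, Submodule.Quotient.mk_eq_zero] at this
    simpa using this
  refine ⟨LinearMap.injective_of_comap_smul_top_le _ xs hxs hE hcomap, ?_⟩
  have hle : (I • ⊤ : Submodule R R) ≤
      (I • ⊤ : Submodule R (ω →ₗ[R] ω)).comap (LinearMap.lsmul R ω) := by
    rw [← Submodule.map_le_iff_le_comap, Submodule.map_smul'']
    exact smul_mono_right _ le_top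
  let g := Submodule.mapQ _ _ (LinearMap.lsmul R ω) hle
  have hg : Function.Injective g := by
    rw [← LinearMap.ker_eq_bot, Submodule.ker_mapQ, ← le_bot_iff,
      Submodule.map_le_iff_le_comap]
    exact fun a ha ↦ (Submodule.Quotient.mk_eq_zero _).2 (hcomap ha)
  have hrange : LinearMap.range g = ⊤ := by
    have hfinE : IsFiniteLength R ((ω →ₗ[R] ω) ⧸ (I • ⊤ : Submodule R (ω →ₗ[R] ω))) := by
      rwa [← Module.length_ne_top_iff, hlenE, Module.length_ne_top_iff]
    obtain ⟨_, _⟩ := isFiniteLength_iff_isNoetherian_isArtinian.1 hfinE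
    by_contra hne
    have := Submodule.length_lt hne
    rw [← (LinearEquiv.ofInjective g hg).length_eq, hlenE] at this
    exact this.false
  rw [← LinearMap.range_eq_top, ← top_le_iff]
  have : Module.Finite R (ω →ₗ[R] ω) := Module.Finite.equiv eE
  refine Submodule.le_of_le_smul_of_le_jacobson_bot (I := maximalIdeal R) Module.Finite.fg_top
    (IsLocalRing.maximalIdeal_le_jacobson _) fun φ _ ↦ ?_
  obtain ⟨y, hy⟩ := LinearMap.range_eq_top.1 hrange (Submodule.Quotient.mk φ)
  induction y using Submodule.Quotient.induction_on with | _ a =>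
  rw [← sub_sub_cancel (LinearMap.lsmul R ω a) φ]
  exact sub_mem (Submodule.mem_sup_left ⟨a, rfl⟩) (Submodule.mem_sup_right
    (Submodule.smul_mono_left (Ideal.span_le.2 hxs) ((Submodule.Quotient.eq _).1 hy)))

end

lemma LinearMap.rTensor_lTensor_apply {R : Type*} [CommSemiring R] {A B M N : Type*}
    [AddCommMonoid A] [Module R A] [AddCommMonoid B] [Module R B] [AddCommMonoid M] [Module R M]
    [AddCommMonoid N] [Module R N] (f : A →ₗ[R] B) (g : M →ₗ[R] N) (x : TensorProduct R M A) :
    g.rTensor B (f.lTensor M x) = f.lTensor N (g.rTensor A x) := by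
  rw [← LinearMap.comp_apply, ← LinearMap.comp_apply, rTensor_comp_lTensor, lTensor_comp_rTensor]

section

variable {R : Type u} [CommRing R] {F M : Type*} [AddCommGroup F] [Module R F] [Module.Flat R F]
  [AddCommGroup M] [Module R M] {π : F →ₗ[R] M} (hπ : Function.Surjective π)

include hπ

lemma LinearMap.exact_lTensor_ker {A₀ A₁ A₂ A₃ : Type*} [AddCommGroup A₀] [Module R A₀]
    [AddCommGroup A₁] [Module R A₁] [Module.Flat R A₁] [AddCommGroup A₂] [Module R A₂]
    [AddCommGroup A₃] [Module R A₃] {f₁ : A₁ →ₗ[R] A₀} {f₂ : A₂ →ₗ[R] A₁} {f₃ : A₃ →ₗ[R] A₂}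
    (h₁ : Function.Exact f₂ f₁) (h₂ : Function.Exact f₃ f₂)
    (hM : Function.Exact (f₃.lTensor M) (f₂.lTensor M)) (z : TensorProduct R π.ker A₁)
    (hz : π.ker.subtype.rTensor A₀ (f₁.lTensor _ z) = 0) : ∃ y, f₂.lTensor _ y = z := by
  have hex₁ := rTensor_exact A₁ π.exact_subtype_ker_map hπ
  have hex₂ := rTensor_exact A₂ π.exact_subtype_ker_map hπ
  rw [LinearMap.rTensor_lTensor_apply] at hz
  obtain ⟨x, hx⟩ := (Module.Flat.lTensor_exact F h₁ _).1 hz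
  have hx' : f₂.lTensor M (π.rTensor A₂ x) = 0 := by
    rw [← LinearMap.rTensor_lTensor_apply, hx]
    exact hex₁.apply_apply_eq_zero z
  obtain ⟨y, hy⟩ := (hM _).1 hx'
  obtain ⟨y, rfl⟩ := rTensor_surjective A₃ hπ y
  obtain ⟨n, hn⟩ := (hex₂ (x - f₃.lTensor F y)).1 (by
    rw [map_sub, LinearMap.rTensor_lTensor_apply, hy, sub_self])
  refine ⟨n, Module.Flat.rTensor_preserves_injective_linearMap (M := A₁) _
    π.ker.injective_subtype ?_⟩
  rw [LinearMap.rTensor_lTensor_apply, hn, map_sub, hx,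
    (Module.Flat.lTensor_exact F h₂).apply_apply_eq_zero, sub_zero]

end

section

variable {R : Type u} [CommRing R] {ω : Type u} [AddCommGroup ω] [Module R ω]

lemma subsingleton_ext_tensorProduct {i : ℕ}
    [h : Subsingleton (Ext (ModuleCat.of R ω) (ModuleCat.of R ω) i)] (n : ℕ) :
    Subsingleton (Ext (ModuleCat.of R (TensorProduct R (Fin n → R) ω)) (ModuleCat.of R ω) i) := by
  let e : TensorProduct R (Fin n → R) ω ≃ₗ[R] (Fin n → ω) :=
    TensorProduct.comm R _ _ ≪≫ₗ TensorProduct.piScalarRight R R ω (Fin n)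
  suffices Subsingleton (Ext (ModuleCat.of R (Fin n → ω)) (ModuleCat.of R ω) i) from
    (Ext.linearEquivOfIso R e.toModuleIso (ModuleCat.of R ω) i).symm.toEquiv.subsingleton
  refine subsingleton_of_forall_eq 0 fun α ↦ ?_
  have hid : 𝟙 (ModuleCat.of R (Fin n → ω)) =
      ∑ j, ModuleCat.ofHom (LinearMap.proj j) ≫
        ModuleCat.ofHom (LinearMap.single R (fun _ ↦ ω) j) := by
    ext x
    simp [ModuleCat.hom_sum]
  rw [← α.mk₀_id_comp, hid, Ext.mk₀_sum, Ext.sum_comp]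
  refine Finset.sum_eq_zero fun j _ ↦ ?_
  rw [← Ext.mk₀_comp_mk₀_assoc, h.elim (Ext.comp _ _ _) 0, Ext.comp_zero]

variable (hω : Function.Bijective (LinearMap.lsmul R ω))

/-- If `R ≅ End ω`, then `Hom(M, R) ≅ Hom(M ⊗ ω, ω)`. -/
noncomputable def homTensorEquiv (M : Type u) [AddCommGroup M] [Module R M] :
    (M →ₗ[R] R) ≃ₗ[R] (TensorProduct R M ω →ₗ[R] ω) :=
  (LinearEquiv.ofBijective _ hω).congrRight ≪≫ₗ TensorProduct.lift.equiv (.id R) M ω ω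

/-- If `R ≅ End ω`, then `Ext⁰(M, R) ≅ Ext⁰(M ⊗ ω, ω)`. -/
noncomputable def extZeroTensorEquiv (M : Type u) [AddCommGroup M] [Module R M] :
    Ext (ModuleCat.of R M) (ModuleCat.of R R) 0 ≃ₗ[R]
      Ext (ModuleCat.of R (TensorProduct R M ω)) (ModuleCat.of R ω) 0 :=
  Ext.linearEquiv₀ ≪≫ₗ ModuleCat.homLinearEquiv ≪≫ₗ homTensorEquiv hω M ≪≫ₗ
    (ModuleCat.homLinearEquiv (M := ModuleCat.of R (TensorProduct R M ω))
      (N := ModuleCat.of R ω)).symm ≪≫ₗ Ext.linearEquiv₀.symm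

lemma extZeroTensorEquiv_precomp {M N : Type u} [AddCommGroup M] [Module R M] [AddCommGroup N]
    [Module R N] (f : N →ₗ[R] M) (α : Ext (ModuleCat.of R M) (ModuleCat.of R R) 0) :
    extZeroTensorEquiv hω N ((Ext.mk₀ (ModuleCat.ofHom f)).comp α (zero_add 0)) =
      (Ext.mk₀ (ModuleCat.ofHom (f.rTensor ω))).comp (extZeroTensorEquiv hω M α) (zero_add 0) := by
  obtain ⟨g, rfl⟩ := Ext.linearEquiv₀ (R := R).symm.surjective α
  simp only [extZeroTensorEquiv, LinearEquiv.trans_apply, Ext.linearEquiv₀_symm_apply,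
    Ext.mk₀_comp_mk₀]
  simp only [← Ext.linearEquiv₀_symm_apply (R := R), LinearEquiv.apply_symm_apply]
  congr 1
  ext : 1
  refine TensorProduct.ext' fun x y ↦ rfl

include hω

lemma nonempty_ext_tensorProduct_linearEquiv {B : ℕ → Type u} [∀ n, AddCommGroup (B n)]
    [∀ n, Module R (B n)] [∀ n, Module.Flat R (B (n + 1))] (D : ∀ n, B (n + 1) →ₗ[R] B n)
    (hD : ∀ n, Function.Exact (D (n + 1)) (D n)) (ε : Function.Surjective (D 0))
    (e : B 0 ≃ₗ[R] ω) [IsNoetherianRing R]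
    (hωω : ∀ i ≠ 0, Subsingleton (Ext (ModuleCat.of R ω) (ModuleCat.of R ω) i)) (i : ℕ)
    (M : Type u) [AddCommGroup M] [Module R M] [Module.Finite R M]
    (hM : ∀ n, Function.Exact ((D (n + 1)).lTensor M) ((D n).lTensor M)) :
    Nonempty (Ext (ModuleCat.of R M) (ModuleCat.of R R) i ≃ₗ[R]
      Ext (ModuleCat.of R (TensorProduct R M ω)) (ModuleCat.of R ω) i) := by
  induction i generalizing M with
  | zero => exact ⟨extZeroTensorEquiv hω M⟩
  | succ i ih =>
    obtain ⟨n, π, hπ⟩ := Module.Finite.exists_fin' R M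
    have hN (n : ℕ) : Function.Exact ((D (n + 1)).lTensor π.ker) ((D n).lTensor π.ker) := by
      intro z
      refine ⟨fun hz ↦ LinearMap.exact_lTensor_ker hπ (hD n) (hD (n + 1)) (hM _) z
        (by rw [hz, map_zero]), ?_⟩
      rintro ⟨y, rfl⟩
      rw [← LinearMap.comp_apply, ← LinearMap.lTensor_comp, (hD n).linearMap_comp_eq_zero,
        LinearMap.lTensor_zero, LinearMap.zero_apply]
    have hinj : Function.Injective (π.ker.subtype.rTensor ω) := by
      refine (injective_iff_map_eq_zero _).2 fun x hx ↦ ?_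
      have hq : Function.Surjective (e.toLinearMap ∘ₗ D 0) := e.surjective.comp ε
      obtain ⟨z, rfl⟩ := LinearMap.lTensor_surjective π.ker hq x
      obtain ⟨y, rfl⟩ := LinearMap.exact_lTensor_ker hπ
        (LinearEquiv.postcomp_exact_iff_exact.2 (hD 0)) (hD 1) (hM 1) z hx
      rw [← LinearMap.comp_apply, ← LinearMap.lTensor_comp, LinearMap.comp_assoc,
        (hD 0).linearMap_comp_eq_zero, LinearMap.comp_zero, LinearMap.lTensor_zero,
        LinearMap.zero_apply]
    let S := ModuleCat.shortComplexOfCompEqZero π.ker.subtype π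
      π.exact_subtype_ker_map.linearMap_comp_eq_zero
    have hS : S.ShortExact := ModuleCat.shortComplex_shortExact _ π.exact_subtype_ker_map
      π.ker.injective_subtype hπ
    have hex := rTensor_exact ω π.exact_subtype_ker_map hπ
    let T := ModuleCat.shortComplexOfCompEqZero (M := TensorProduct R π.ker ω)
      (N := TensorProduct R (Fin n → R) ω) (π.ker.subtype.rTensor ω) (π.rTensor ω)
      hex.linearMap_comp_eq_zero
    have hT : T.ShortExact := ModuleCat.shortComplex_shortExact _ hex hinj
      (LinearMap.rTensor_surjective ω hπ)
    have hP : Projective S.X₂ := (IsProjective.iff_projective _).1 inferInstance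
    have hS₂ (j : ℕ) : Subsingleton (Ext S.X₂ (ModuleCat.of R R) (j + 1)) :=
      Ext.subsingleton_of_projective _ _ _
    have hT₂ (j : ℕ) : Subsingleton (Ext T.X₂ (ModuleCat.of R ω) (j + 1)) :=
      have := hωω (j + 1) (by lia)
      subsingleton_ext_tensorProduct n
    obtain ⟨e₁⟩ := hS.nonempty_ext_quotient_linearEquiv R (ModuleCat.of R R) i
    obtain ⟨e₂⟩ := hT.nonempty_ext_quotient_linearEquiv R (ModuleCat.of R ω) i
    suffices Nonempty (_ ≃ₗ[R] _) from this.map fun e ↦ e₁.symm ≪≫ₗ e ≪≫ₗ e₂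
    cases i with
    | zero =>
      refine ⟨Submodule.Quotient.equiv _ _ (extZeroTensorEquiv hω π.ker) ?_⟩
      rw [← LinearMap.range_comp]
      refine le_antisymm ?_ ?_
      · rintro _ ⟨a, rfl⟩
        exact ⟨extZeroTensorEquiv hω _ a, (extZeroTensorEquiv_precomp hω π.ker.subtype a).symm⟩
      · rintro _ ⟨b, rfl⟩
        obtain ⟨a, rfl⟩ := (extZeroTensorEquiv hω (Fin n → R)).surjective b
        exact ⟨a, extZeroTensorEquiv_precomp hω π.ker.subtype a⟩
    | succ i =>
      obtain ⟨e⟩ := ih π.ker hN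
      have h₁ : (Ext.mk₀ S.f).precompOfLinear R (ModuleCat.of R R) (zero_add (i + 1)) = 0 :=
        LinearMap.ext fun x ↦ by rw [(hS₂ i).elim x 0, map_zero, map_zero]
      have h₂ : (Ext.mk₀ T.f).precompOfLinear R (ModuleCat.of R ω) (zero_add (i + 1)) = 0 :=
        LinearMap.ext fun x ↦ by rw [(hT₂ i).elim x 0, map_zero, map_zero]
      exact ⟨Submodule.quotEquivOfEqBot _ (LinearMap.range_eq_bot.2 h₁) ≪≫ₗ e ≪≫ₗ
        (Submodule.quotEquivOfEqBot _ (LinearMap.range_eq_bot.2 h₂)).symm⟩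

end

namespace CategoryTheory.ProjectiveResolution

variable {C : Type u} [Category.{v} C] [Abelian C] {X : C} (P : ProjectiveResolution X)

/-- The objects `X, P₀, P₁, …` of the augmented complex of a projective resolution. -/
noncomputable def augmentedX : ℕ → C
  | 0 => X
  | n + 1 => P.complex.X n

/-- The differentials of the augmented complex of a projective resolution. -/
noncomputable def augmentedD : ∀ n, P.augmentedX (n + 1) ⟶ P.augmentedX n
  | 0 => P.π.f 0
  | n + 1 => P.complex.d (n + 1) n

end CategoryTheory.ProjectiveResolution

section

variable {R : Type u} [CommRing R]

lemma exact_lTensor_of_subsingleton_tor {M ω : ModuleCat.{u} R} (P : ProjectiveResolution ω)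
    (n : ℕ) (h : Subsingleton (((Tor (ModuleCat R) (n + 1)).obj M).obj ω)) :
    Function.Exact ((P.complex.d (n + 2) (n + 1)).hom.lTensor M)
      ((P.complex.d (n + 1) n).hom.lTensor M) := by
  let F := (MonoidalCategory.tensoringLeft (ModuleCat R)).obj M
  have hF : Limits.IsZero ((F.leftDerived (n + 1)).obj ω) :=
    ModuleCat.isZero_of_subsingleton (((Tor (ModuleCat R) (n + 1)).obj M).obj ω)
  have hz := hF.of_iso (P.isoLeftDerivedObj F (n + 1)).symm
  have hex := (HomologicalComplex.exactAt_iff_isZero_homology _ _).2 hz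
  rw [HomologicalComplex.exactAt_iff' _ (n + 2) (n + 1) n (by simp) (by simp),
    ShortComplex.ShortExact.moduleCat_exact_iff_function_exact] at hex
  exact hex

lemma nonempty_ext_tensorProduct_linearEquiv_of_tor [IsNoetherianRing R] {M ω : ModuleCat.{u} R}
    [Module.Finite R M] (hω : Function.Bijective (LinearMap.lsmul R ω))
    (hωω : ∀ i ≠ 0, Subsingleton (Ext ω ω i))
    (h : ∀ i, 0 < i → Subsingleton (((Tor (ModuleCat R) i).obj M).obj ω)) (i : ℕ) :
    Nonempty (Ext M (ModuleCat.of R R) i ≃ₗ[R] Ext (ModuleCat.of R (TensorProduct R M ω)) ω i) := by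
  let P := projectiveResolution ω
  let B := P.augmentedX
  let D := P.augmentedD
  have hB (n : ℕ) : Module.Flat R (B (n + 1)) :=
    have : Module.Projective R (P.complex.X n) := (IsProjective.iff_projective _).2 (P.projective n)
    inferInstanceAs (Module.Flat R (P.complex.X n))
  have hsurj : Function.Surjective (D 0).hom :=
    (ModuleCat.epi_iff_surjective _).1 (inferInstanceAs (Epi (P.π.f 0)))
  have hD (n : ℕ) : Function.Exact (D (n + 1)).hom (D n).hom := by
    cases n with
    | zero => exact (ShortComplex.ShortExact.moduleCat_exact_iff_function_exact _).1 P.exact₀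
    | succ n =>
      exact (ShortComplex.ShortExact.moduleCat_exact_iff_function_exact _).1 (P.exact_succ n)
  refine nonempty_ext_tensorProduct_linearEquiv hω (B := fun n ↦ B n) (fun n ↦ (D n).hom) hD hsurj
    (.refl R ω) hωω i M fun n ↦ ?_
  cases n with
  | zero => exact lTensor_exact M (hD 0) hsurj
  | succ n => exact exact_lTensor_of_subsingleton_tor P n (h _ n.succ_pos)

end

/-- Over a Cohen-Macaulay Noetherian local ring with canonical module `ω`,
if `Tor_i^R(M, ω) = 0` for all `i > 0`, then `Ext^i_R(M, R) ≅ Ext^i_R(M ⊗_R ω, ω)` for all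
`i ≥ 0`. -/
theorem statement15 (R : Type) [CommRing R] [IsNoetherianRing R] [IsLocalRing R]
    (d : ℕ) (hR : isCMLocalRing R d)
    (ω : Type) [AddCommGroup ω] [Module R ω] (hω : isCanonicalModule R d ω)
    (M : Type) [AddCommGroup M] [Module R M] [Module.Finite R M]
    (htor : ∀ i : ℕ, 0 < i → Subsingleton (torMod R M ω i)) :
    ∀ i : ℕ, Nonempty ((extMod R M R i) ≃ₗ[R] (extMod R (TensorProduct R M ω) ω i)) := by
  obtain ⟨hfin, hvan, ⟨e⟩⟩ := hω
  have hdepth (i : ℕ) (hi : i < d) :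
      Subsingleton (Ext (ModuleCat.of R (ResidueField R)) (ModuleCat.of R R) i) := by
    obtain ⟨e⟩ := nonempty_ext_linearEquiv (R := R) (ModuleCat.of R (ResidueField R))
      (ModuleCat.of R R) i
    refine not_nontrivial_iff_subsingleton.1 fun h ↦ hi.not_ge ?_
    rw [← Nat.cast_le (α := ℕ∞), ← hR.2]
    exact sInf_le ⟨i, e.toEquiv.nontrivial, rfl⟩
  have hvan' (i : ℕ) (hi : i ≠ d) :
      Subsingleton (Ext (ModuleCat.of R (ResidueField R)) (ModuleCat.of R ω) i) := by
    obtain ⟨e⟩ := nonempty_ext_linearEquiv (R := R) (ModuleCat.of R (ResidueField R))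
      (ModuleCat.of R ω) i
    exact @Equiv.subsingleton _ _ e.symm.toEquiv (hvan i hi)
  obtain ⟨e'⟩ := nonempty_ext_linearEquiv (R := R) (ModuleCat.of R (ResidueField R))
    (ModuleCat.of R ω) d
  obtain ⟨h₁, h₂⟩ := canonical_ext_self hR.1 hdepth (.of R ω) hvan' (e'.symm ≪≫ₗ e)
  intro i
  obtain ⟨f⟩ := nonempty_ext_tensorProduct_linearEquiv_of_tor (M := .of R M) h₂ h₁ htor i
  obtain ⟨f₁⟩ := nonempty_ext_linearEquiv (R := R) (ModuleCat.of R M) (ModuleCat.of R R) i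
  obtain ⟨f₂⟩ := nonempty_ext_linearEquiv (R := R)
    (ModuleCat.of R (TensorProduct R M ω)) (ModuleCat.of R ω) i
  exact ⟨f₁ ≪≫ₗ f ≪≫ₗ f₂.symm⟩
end
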